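/- arXiv:math/0608714 — 5 statements merged into one kernel-verified Lean document; each statement's English description precedes it below -/
import Mathlib

section
/- Let Q_1,...,Q_n be convex polytopes in R^n. The function (λ_1,...,λ_n) ↦ vol(λ_1 Q_1 + ... + λ_n Q_n) (for nonnegative λ_i, using Minkowski sums) is a homogeneous polynomial function of degree n in λ_1,...,λ_n. -/
open Pointwise MeasureTheory

/-- A (convex) polytope: the convex hull of a nonempty finite set of points. -/
def IsPolytope {n : ℕ} (P : Set (Fin n → ℝ)) : Prop :=
  ∃ F : Finset (Fin n → ℝ), F.Nonempty ∧ P = convexHull ℝ (F : Set (Fin n → ℝ))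

section LP
variable {J : Type*} [Fintype J] {E : Type*} [AddCommGroup E] [Module ℝ E]

/-- `μ` is an optimal solution of the linear program `min c ν`, `ν ≥ 0`, `A ν = A μ`. -/
def MVOpt (A : (J → ℝ) →ₗ[ℝ] E) (c : (J → ℝ) →ₗ[ℝ] ℝ) (μ : J → ℝ) : Prop :=
  (∀ j, 0 ≤ μ j) ∧ ∀ ν : J → ℝ, (∀ j, 0 ≤ ν j) → A ν = A μ → c μ ≤ c ν

/-- Genericity of the cost functional. -/
def MVGen (A : (J → ℝ) →ₗ[ℝ] E) (c : (J → ℝ) →ₗ[ℝ] ℝ) : Prop :=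
  ∀ S : Set J, (∃ d, A d = 0 ∧ (∀ j ∉ S, d j = 0) ∧ d ≠ 0) →
    ∃ d, A d = 0 ∧ (∀ j ∉ S, d j = 0) ∧ c d ≠ 0

lemma mv_exists_gen (A : (J → ℝ) →ₗ[ℝ] E) : ∃ c, MVGen A c := by
  classical
  let I := {S : Set J // ∃ d, A d = 0 ∧ (∀ j ∉ S, d j = 0) ∧ d ≠ 0}
  have hI : ∀ S : I, ∃ d, A d = 0 ∧ (∀ j ∉ S.1, d j = 0) ∧ d ≠ 0 := fun S => S.2
  choose d h1 h2 h3 using hI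
  obtain ⟨c, hc⟩ := Module.exists_dual_forall_apply_ne_zero (K := ℝ) d h3
  exact ⟨c, fun S hS => ⟨d ⟨S, hS⟩, h1 ⟨S, hS⟩, h2 ⟨S, hS⟩, hc ⟨S, hS⟩⟩⟩

lemma mv_perturb (μ d : J → ℝ) (h0 : ∀ j, 0 ≤ μ j) (hd : ∀ j, μ j = 0 → 0 ≤ d j) :
    ∃ ε : ℝ, 0 < ε ∧ ∀ j, 0 ≤ (μ + ε • d) j := by
  have h : ∀ᶠ ε : ℝ in nhdsWithin 0 (Set.Ioi 0), ∀ j, 0 ≤ (μ + ε • d) j := by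
    rw [Filter.eventually_all]
    intro j
    rcases (h0 j).eq_or_lt with h | h
    · filter_upwards [self_mem_nhdsWithin] with ε hε
      simp only [Pi.add_apply, Pi.smul_apply, smul_eq_mul, ← h, zero_add]
      exact mul_nonneg (le_of_lt hε) (hd j h.symm)
    · have hc : Continuous fun ε : ℝ => (μ + ε • d) j := by
        simp only [Pi.add_apply, Pi.smul_apply, smul_eq_mul]; fun_prop
      have : ∀ᶠ ε : ℝ in nhds 0, 0 < (μ + ε • d) j :=
        hc.continuousAt.eventually (lt_mem_nhds (by simpa using h))
      exact (this.filter_mono nhdsWithin_le_nhds).mono fun _ h => h.le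
  obtain ⟨ε, h1, h2⟩ := (h.and self_mem_nhdsWithin).exists
  exact ⟨ε, h2, h1⟩

lemma mv_opt_dir {A : (J → ℝ) →ₗ[ℝ] E} {c : (J → ℝ) →ₗ[ℝ] ℝ} {μ d : J → ℝ}
    (h : MVOpt A c μ) (hA : A d = 0) (hd : ∀ j, μ j = 0 → 0 ≤ d j) : 0 ≤ c d := by
  obtain ⟨ε, hε, h'⟩ := mv_perturb μ d h.1 hd
  have := h.2 _ h' (by simp [hA])
  simp only [map_add, map_smul, smul_eq_mul] at this
  by_contra! hc
  nlinarith

lemma mv_opt_indep {A : (J → ℝ) →ₗ[ℝ] E} {c : (J → ℝ) →ₗ[ℝ] ℝ} (hc : MVGen A c) {μ d : J → ℝ}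
    (h : MVOpt A c μ) (hA : A d = 0) (hd : ∀ j, μ j = 0 → d j = 0) : d = 0 := by
  by_contra hne
  obtain ⟨e, h1, h2, h3⟩ := hc {j | μ j ≠ 0} ⟨d, hA, fun j hj => hd j (by simpa using hj), hne⟩
  have h2' : ∀ j, μ j = 0 → e j = 0 := fun j hj => h2 j (by simpa using hj)
  have a := mv_opt_dir h h1 fun j hj => (h2' j hj).ge
  have b := mv_opt_dir (d := -e) h (by simp [h1]) fun j hj => by simp [h2' j hj]
  rw [map_neg] at b
  exact h3 (by linarith)

lemma mv_opt_unique {A : (J → ℝ) →ₗ[ℝ] E} {c : (J → ℝ) →ₗ[ℝ] ℝ} (hc : MVGen A c) {μ ν : J → ℝ}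
    (h : MVOpt A c μ) (h' : MVOpt A c ν) (hA : A μ = A ν) : μ = ν := by
  have hcc : c μ = c ν := le_antisymm (h.2 _ h'.1 hA.symm) (h'.2 _ h.1 hA)
  have hm : MVOpt A c ((1 / 2 : ℝ) • (μ + ν)) := by
    refine ⟨fun j => ?_, fun ρ h1 h2 => ?_⟩
    · have := h.1 j; have := h'.1 j
      simp only [Pi.smul_apply, Pi.add_apply, smul_eq_mul]; linarith
    · have h3 : A ρ = A μ := by
        rw [h2, map_smul, map_add, ← hA, ← two_smul ℝ, smul_smul]; norm_num
      have := h.2 _ h1 h3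
      simp only [map_smul, map_add, smul_eq_mul]; linarith
  have := mv_opt_indep hc (d := μ - ν) hm (by simp [hA]) fun j hj => by
    have := h.1 j; have := h'.1 j
    simp only [Pi.smul_apply, Pi.add_apply, smul_eq_mul] at hj
    simp only [Pi.sub_apply]; linarith
  exact sub_eq_zero.1 this

lemma mv_opt_face {A : (J → ℝ) →ₗ[ℝ] E} {c : (J → ℝ) →ₗ[ℝ] ℝ} {μ ν : J → ℝ}
    (h : MVOpt A c μ) (h0 : ∀ j, 0 ≤ ν j) (hs : ∀ j, μ j = 0 → ν j = 0) : MVOpt A c ν := by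
  refine ⟨h0, fun ρ h1 h2 => ?_⟩
  have := mv_opt_dir (d := ρ - ν) h (by simp [h2]) fun j hj => by
    simpa [hs j hj] using h1 j
  rw [map_sub] at this
  linarith
end LP

section Cells
variable {n : ℕ} {J : Type*} [Fintype J]

/-- weights grouped by colour -/
def mvP (p : J → Fin n) : (J → ℝ) →ₗ[ℝ] (Fin n → ℝ) where
  toFun μ i := ∑ j, if p j = i then μ j else 0
  map_add' μ ν := by
    ext i; simp only [Pi.add_apply, ← Finset.sum_add_distrib]
    exact Finset.sum_congr rfl fun j _ => by split_ifs <;> simp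
  map_smul' r μ := by
    ext i; simp [Finset.mul_sum]

/-- weighted sum of the points -/
def mvV (v : J → Fin n → ℝ) : (J → ℝ) →ₗ[ℝ] (Fin n → ℝ) where
  toFun μ := ∑ j, μ j • v j
  map_add' μ ν := by simp [add_smul, Finset.sum_add_distrib]
  map_smul' r μ := by simp [Finset.smul_sum, smul_smul]

lemma mvP_apply (p : J → Fin n) (μ i) : mvP p μ i = ∑ j, if p j = i then μ j else 0 := rfl
lemma mvV_apply (v : J → Fin n → ℝ) (μ) : mvV v μ = ∑ j, μ j • v j := rfl

/-- weights with support exactly `S` and prescribed colour sums -/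
def mvM (p : J → Fin n) (S : Set J) (l : Fin n → ℝ) : Set (J → ℝ) :=
  {μ | (∀ j ∈ S, 0 < μ j) ∧ (∀ j ∉ S, μ j = 0) ∧ mvP p μ = l}

lemma mvP_scale (p : J → Fin n) (l : Fin n → ℝ) (μ : J → ℝ) :
    mvP p (fun j => l (p j) * μ j) = l * mvP p μ := by
  ext i
  simp only [mvP_apply, Pi.mul_apply, Finset.mul_sum]
  exact Finset.sum_congr rfl fun j _ => by split_ifs with h <;> simp [h]

lemma mv_le (p : J → Fin n) {μ : J → ℝ} (h0 : ∀ j, 0 ≤ μ j) (j : J) : μ j ≤ mvP p μ (p j) := by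
  have := Finset.single_le_sum (f := fun k => if p k = p j then μ k else 0) (s := Finset.univ)
    (fun k _ => by split_ifs <;> simp [h0]) (Finset.mem_univ j)
  simpa [mvP_apply] using this

lemma mvM_nonneg {p : J → Fin n} {S : Set J} {l : Fin n → ℝ} {μ} (h : μ ∈ mvM p S l) (j : J) :
    0 ≤ μ j := by
  by_cases hj : j ∈ S
  · exact (h.1 j hj).le
  · exact (h.2.1 j hj).ge

lemma mvM_scale (p : J → Fin n) (S : Set J) {l : Fin n → ℝ} (hl : ∀ i, 0 < l i) :
    mvM p S l = (fun (μ : J → ℝ) j => l (p j) * μ j) '' mvM p S 1 := by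
  ext μ
  constructor
  · intro h
    refine ⟨fun j => l⁻¹ (p j) * μ j, ⟨fun j hj => ?_, fun j hj => ?_, ?_⟩, ?_⟩
    · exact mul_pos (inv_pos.2 (hl _)) (h.1 j hj)
    · simp [h.2.1 j hj]
    · rw [mvP_scale, h.2.2]; ext i; simp [(hl i).ne']
    · ext j; simp [(hl (p j)).ne']
  · rintro ⟨ν, h, rfl⟩
    refine ⟨fun j hj => mul_pos (hl _) (h.1 j hj), fun j hj => ?_, ?_⟩
    · simp [h.2.1 j hj]
    · rw [mvP_scale, h.2.2, mul_one]

lemma mv_cell_volume (p : J → Fin n) (v : J → Fin n → ℝ) (S : Set J)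
    (hS : ∀ d, mvV v d = 0 → mvP p d = 0 → (∀ j ∉ S, d j = 0) → d = 0) :
    ∃ P : MvPolynomial (Fin n) ℝ, P.IsHomogeneous n ∧ ∀ l : Fin n → ℝ, (∀ i, 0 < l i) →
      volume (mvV v '' mvM p S l) ≠ ⊤ ∧
      (volume (mvV v '' mvM p S l)).toReal = MvPolynomial.eval l P := by
  classical
  by_cases hr : ∀ i, ∃ j ∈ S, p j = i
  swap
  · push Not at hr
    obtain ⟨i, hi⟩ := hr
    refine ⟨0, MvPolynomial.isHomogeneous_zero _ _ _, fun l hl => ?_⟩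
    have : mvM p S l = ∅ := by
      rw [Set.eq_empty_iff_forall_notMem]
      intro μ h
      have h1 : mvP p μ i = 0 := by
        rw [mvP_apply]
        refine Finset.sum_eq_zero fun j _ => ?_
        split_ifs with hj
        · exact h.2.1 j fun h => hi j h hj
        · rfl
      rw [h.2.2] at h1
      exact (hl i).ne' h1
    simp [this]
  choose r hrS hrp using hr
  let S' := {j : J // j ∈ S ∧ j ≠ r (p j)}
  let T : (S' → ℝ) →ₗ[ℝ] (Fin n → ℝ) :=
    Fintype.linearCombination ℝ (fun k : S' => v k.1 - v (r (p k.1)))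
  have hT : ∀ ξ, T ξ = ∑ k : S', ξ k • (v k.1 - v (r (p k.1))) := fun ξ => rfl
  have key : ∀ μ : J → ℝ, (∀ j ∉ S, μ j = 0) →
      mvV v μ = ∑ i, mvP p μ i • v (r i) + T (fun k => μ k.1) := by
    intro μ hμ
    have e1 : ∑ i, mvP p μ i • v (r i) = ∑ j, μ j • v (r (p j)) := by
      simp only [mvP_apply, Finset.sum_smul]
      rw [Finset.sum_comm]
      refine Finset.sum_congr rfl fun j _ => ?_
      simp [ite_smul]
    have e2 : T (fun k => μ k.1) = ∑ j, μ j • (v j - v (r (p j))) := by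
      rw [hT]
      rw [← Finset.sum_subtype (Finset.univ.filter fun j => j ∈ S ∧ j ≠ r (p j)) (by simp)
        (fun j => μ j • (v j - v (r (p j))))]
      refine Finset.sum_subset (Finset.subset_univ _) fun j _ hj => ?_
      by_cases h1 : j ∈ S
      · have h2 : j = r (p j) := by
          by_contra h2
          exact hj (by simp [h1, h2])
        rw [← h2]; simp
      · simp [hμ j h1]
    rw [e1, e2, ← Finset.sum_add_distrib, mvV_apply]
    exact Finset.sum_congr rfl fun j _ => by rw [← smul_add]; congr 1; abel
  have hTinj : Function.Injective T := by
    rw [injective_iff_map_eq_zero]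
    intro ξ hξ
    let μ0 : J → ℝ := fun j => if h : j ∈ S ∧ j ≠ r (p j) then ξ ⟨j, h⟩ else 0
    let d : J → ℝ := μ0 - ∑ i, mvP p μ0 i • Pi.single (r i) (1 : ℝ)
    have hsing : ∀ i, mvP p (Pi.single (r i) (1 : ℝ)) = Pi.single i 1 := by
      intro i
      ext i'
      rw [mvP_apply, Finset.sum_eq_single (r i)]
      · simp [hrp, Pi.single_apply, eq_comm]
      · intro j _ hj; simp [hj]
      · simp
    have hPd : mvP p d = 0 := by
      simp only [d, map_sub, map_sum, map_smul, hsing]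
      rw [sub_eq_zero]
      ext i
      simp [Finset.sum_apply, Pi.single_apply]
    have hdS : ∀ j ∉ S, d j = 0 := by
      intro j hj
      have h1 : ∀ i, j ≠ r i := fun i h => hj (h ▸ hrS i)
      simp [d, μ0, hj, h1, Pi.single_apply]
    have hdξ : (fun k : S' => d k.1) = ξ := by
      ext ⟨j, hj⟩
      have h1 : ∀ i, j ≠ r i := fun i h => hj.2 (by rw [h, hrp])
      have h2 : μ0 j = ξ ⟨j, hj⟩ := dif_pos hj
      simp [d, h2, h1, Pi.single_apply]
    have hd0 : d = 0 := hS d (by rw [key d hdS, hPd, hdξ, hξ]; simp) hPd hdS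
    rw [← hdξ, hd0]; rfl
  have hcard : Fintype.card S' ≤ n := by
    simpa using LinearMap.finrank_le_finrank_of_injective hTinj
  have hcell : ∀ l, mvV v '' mvM p S l =
      (fun x => ∑ i, l i • v (r i) + x) '' (T '' ((fun μ k => μ k.1) '' mvM p S l)) := by
    intro l
    simp only [Set.image_image]
    exact Set.image_congr fun μ h => by rw [key μ h.2.1, h.2.2]
  have hvol : ∀ l, volume (mvV v '' mvM p S l) =
      volume (T '' ((fun μ k => μ k.1) '' mvM p S l)) := by
    intro l
    rw [hcell, Set.image_add_left, measure_preimage_add]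
  rcases hcard.lt_or_eq with hlt | heq
  · refine ⟨0, MvPolynomial.isHomogeneous_zero _ _ _, fun l hl => ?_⟩
    have h0 : volume (mvV v '' mvM p S l) = 0 := by
      rw [hvol]
      refine measure_mono_null (t := (LinearMap.range T : Set (Fin n → ℝ))) ?_ ?_
      · rintro _ ⟨x, -, rfl⟩; exact ⟨x, rfl⟩
      · apply Measure.addHaar_submodule
        intro htop
        have := LinearMap.finrank_range_le T
        rw [htop] at this
        simp at this
        omega
    simp [h0]
  · let e : Fin n ≃ S' := (Fintype.equivFinOfCardEq heq).symm
    let k : Fin n → J := fun a => (e a).1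
    let T2 : (Fin n → ℝ) →ₗ[ℝ] (Fin n → ℝ) := T ∘ₗ LinearMap.funLeft ℝ ℝ e.symm
    let U : Set (Fin n → ℝ) := (fun μ a => μ (k a)) '' mvM p S 1
    have hU : volume U ≠ ⊤ := by
      refine ne_top_of_le_ne_top ?_ (measure_mono (t := Set.Icc 0 1) ?_)
      · exact isCompact_Icc.measure_ne_top
      · rintro _ ⟨μ, h, rfl⟩
        refine ⟨fun a => mvM_nonneg h _, fun a => ?_⟩
        have := mv_le p (mvM_nonneg h) (k a)
        rwa [h.2.2] at this
    have hmain : ∀ l : Fin n → ℝ, (∀ i, 0 < l i) → volume (mvV v '' mvM p S l) =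
        ENNReal.ofReal |LinearMap.det T2| * (ENNReal.ofReal (∏ a, l (p (k a))) * volume U) := by
      intro l hl
      have e1 : T '' ((fun μ k => μ k.1) '' mvM p S l) =
          T2 '' (Matrix.toLin' (Matrix.diagonal fun a => l (p (k a))) '' U) := by
        rw [mvM_scale p S hl]
        simp only [U, Set.image_image]
        refine Set.image_congr fun μ h => ?_
        simp only [T2, LinearMap.comp_apply]
        congr 1
        ext x
        simp [LinearMap.funLeft, Matrix.mulVec_diagonal, k]
      rw [hvol, e1, Measure.addHaar_image_linearMap, Measure.addHaar_image_linearMap,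
        LinearMap.det_toLin', Matrix.det_diagonal,
        abs_of_pos (Finset.prod_pos fun a _ => hl _)]
    refine ⟨MvPolynomial.C (|LinearMap.det T2| * (volume U).toReal) *
      ∏ a, MvPolynomial.X (p (k a)), ?_, fun l hl => ⟨?_, ?_⟩⟩
    · have h1 := MvPolynomial.IsHomogeneous.prod Finset.univ
        (fun a : Fin n => (MvPolynomial.X (p (k a)) : MvPolynomial (Fin n) ℝ)) (fun _ => 1)
        (fun a _ => MvPolynomial.isHomogeneous_X _ _)
      have := (MvPolynomial.isHomogeneous_C (Fin n) (|LinearMap.det T2| * (volume U).toReal)).mul h1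
      simpa using this
    · rw [hmain l hl]
      exact ENNReal.mul_ne_top ENNReal.ofReal_ne_top (ENNReal.mul_ne_top ENNReal.ofReal_ne_top hU)
    · rw [hmain l hl, ENNReal.toReal_mul, ENNReal.toReal_mul, ENNReal.toReal_ofReal (abs_nonneg _),
        ENNReal.toReal_ofReal (Finset.prod_nonneg fun a _ => (hl _).le)]
      simp
      ring
end Cells

section Main
variable {n : ℕ}

lemma mv_exists_opt {J : Type*} [Fintype J] (p : J → Fin n) (v : J → Fin n → ℝ)
    (c : (J → ℝ) →ₗ[ℝ] ℝ) (μ : J → ℝ) (h0 : ∀ j, 0 ≤ μ j) :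
    ∃ ν, MVOpt ((mvV v).prod (mvP p)) c ν ∧ mvV v ν = mvV v μ ∧ mvP p ν = mvP p μ := by
  let F : Set (J → ℝ) := {ν | (∀ j, 0 ≤ ν j) ∧ mvV v ν = mvV v μ ∧ mvP p ν = mvP p μ}
  have cV : Continuous (mvV v) := LinearMap.continuous_of_finiteDimensional _
  have cP : Continuous (mvP p) := LinearMap.continuous_of_finiteDimensional _
  have cc : Continuous c := LinearMap.continuous_of_finiteDimensional _
  have hclosed : IsClosed F := by
    refine IsClosed.inter ?_ (IsClosed.inter ?_ ?_)
    · change IsClosed {ν : J → ℝ | ∀ j, 0 ≤ ν j}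
      simp only [Set.ofPred_forall]
      exact isClosed_iInter fun j => isClosed_le continuous_const (continuous_apply j)
    · exact isClosed_eq cV continuous_const
    · exact isClosed_eq cP continuous_const
  have hcomp : IsCompact F := by
    refine IsCompact.of_isClosed_subset (isCompact_Icc (a := (0 : J → ℝ))
      (b := fun j => mvP p μ (p j))) hclosed ?_
    intro ν hν
    refine ⟨hν.1, fun j => ?_⟩
    have := mv_le p hν.1 j
    rwa [hν.2.2] at this
  obtain ⟨ν, hν, hmin⟩ := hcomp.exists_isMinOn ⟨μ, h0, rfl, rfl⟩ cc.continuousOn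
  refine ⟨ν, ⟨hν.1, fun ρ h1 h2 => ?_⟩, hν.2⟩
  have a1 : mvV v ρ = mvV v ν := congrArg Prod.fst h2
  have a2 : mvP p ρ = mvP p ν := congrArg Prod.snd h2
  exact hmin ⟨h1, a1.trans hν.2.1, a2.trans hν.2.2⟩

lemma mv_pos {J : Type*} [Fintype J] (p : J → Fin n) (v : J → Fin n → ℝ) :
    ∃ P : MvPolynomial (Fin n) ℝ, P.IsHomogeneous n ∧ ∀ l : Fin n → ℝ, (∀ i, 0 < l i) →
      (volume (mvV v '' {μ | (∀ j, 0 ≤ μ j) ∧ mvP p μ = l})).toReal = MvPolynomial.eval l P := by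
  classical
  let A := (mvV v).prod (mvP p)
  obtain ⟨c, hc⟩ := mv_exists_gen A
  have hA : ∀ μ ν, mvV v μ = mvV v ν → mvP p μ = mvP p ν → A μ = A ν := by
    intro μ ν h1 h2
    simp [A, h1, h2]
  let B : Finset (Set J) := Finset.univ.filter fun S => ∃ μ, MVOpt A c μ ∧ ∀ j, j ∈ S ↔ μ j ≠ 0
  have hB : ∀ S ∈ B, ∃ μ, MVOpt A c μ ∧ ∀ j, j ∈ S ↔ μ j ≠ 0 := fun S hS => by
    simpa [B] using hS
  have hind : ∀ S ∈ B, ∀ d, mvV v d = 0 → mvP p d = 0 → (∀ j ∉ S, d j = 0) → d = 0 := by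
    intro S hS d h1 h2 h3
    obtain ⟨μ, hμ, hs⟩ := hB S hS
    refine mv_opt_indep hc hμ (d := d) (by simp [A, h1, h2]) fun j hj => h3 j ?_
    rw [hs]; simpa using hj
  have hopt : ∀ S ∈ B, ∀ l, ∀ μ ∈ mvM p S l, MVOpt A c μ := by
    intro S hS l μ hμ
    obtain ⟨ν, hν, hs⟩ := hB S hS
    refine mv_opt_face hν (mvM_nonneg hμ) fun j hj => hμ.2.1 j ?_
    rw [hs]; simpa using hj
  have hunion : ∀ l, mvV v '' {μ | (∀ j, 0 ≤ μ j) ∧ mvP p μ = l} =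
      ⋃ S ∈ B, mvV v '' mvM p S l := by
    intro l
    ext x
    simp only [Set.mem_iUnion, exists_prop]
    constructor
    · rintro ⟨μ, ⟨h0, h1⟩, rfl⟩
      obtain ⟨ν, hν, e1, e2⟩ := mv_exists_opt p v c μ h0
      refine ⟨{j | ν j ≠ 0}, ?_, ν, ⟨fun j hj => (hν.1 j).lt_of_ne' hj, fun j hj => by simpa using hj,
        e2.trans h1⟩, e1⟩
      simp only [B, Finset.mem_filter, Finset.mem_univ, true_and]
      exact ⟨ν, hν, fun j => Iff.rfl⟩
    · rintro ⟨S, hS, μ, hμ, rfl⟩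
      exact ⟨μ, ⟨mvM_nonneg hμ, hμ.2.2⟩, rfl⟩
  have hdisj : ∀ l, (B : Set (Set J)).PairwiseDisjoint fun S => mvV v '' mvM p S l := by
    intro l S hS S' hS' hne
    rw [Function.onFun, Set.disjoint_left]
    rintro _ ⟨μ, hμ, rfl⟩ ⟨ν, hν, e⟩
    have : μ = ν := mv_opt_unique hc (hopt S hS l μ hμ) (hopt S' hS' l ν hν)
      (hA _ _ e.symm (hμ.2.2.trans hν.2.2.symm))
    subst this
    apply hne
    ext j
    constructor
    · intro h; by_contra h'; exact (hμ.1 j h).ne' (hν.2.1 j h')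
    · intro h; by_contra h'; exact (hν.1 j h).ne' (hμ.2.1 j h')
  have hmeas : ∀ l, ∀ S ∈ B, MeasurableSet (mvV v '' mvM p S l) := by
    intro l S hS
    have cV : Continuous (mvV v) := LinearMap.continuous_of_finiteDimensional _
    have cP : Continuous (mvP p) := LinearMap.continuous_of_finiteDimensional _
    refine MeasurableSet.image_of_continuousOn_injOn ?_ cV.continuousOn ?_
    · refine MeasurableSet.inter ?_ (MeasurableSet.inter ?_ ?_)
      · change MeasurableSet {μ : J → ℝ | ∀ j ∈ S, 0 < μ j}
        simp only [Set.ofPred_forall]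
        exact MeasurableSet.iInter fun j => MeasurableSet.iInter fun _ =>
          measurableSet_lt measurable_const (measurable_pi_apply j)
      · change MeasurableSet {μ : J → ℝ | ∀ j ∉ S, μ j = 0}
        simp only [Set.ofPred_forall]
        exact MeasurableSet.iInter fun j => MeasurableSet.iInter fun _ =>
          measurableSet_eq_fun (measurable_pi_apply j) measurable_const
      · exact (isClosed_eq cP continuous_const).measurableSet
    · intro μ hμ ν hν e
      exact mv_opt_unique hc (hopt S hS l μ hμ) (hopt S hS l ν hν)
        (hA _ _ e (hμ.2.2.trans hν.2.2.symm))
  have hcell : ∀ S : B, _ := fun S => mv_cell_volume p v S.1 (hind S.1 S.2)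
  choose P hP1 hP2 using hcell
  refine ⟨∑ S : B, P S, MvPolynomial.IsHomogeneous.sum _ _ _ fun S _ => hP1 S, fun l hl => ?_⟩
  rw [hunion, measure_biUnion_finset (hdisj l) (hmeas l), ENNReal.toReal_sum
    (fun S hS => (hP2 ⟨S, hS⟩ l hl).1), map_sum, ← Finset.sum_coe_sort B]
  exact Finset.sum_congr rfl fun S _ => (hP2 S l hl).2

lemma mv_minkowski (F : Fin n → Finset (Fin n → ℝ)) (l : Fin n → ℝ) (hl : ∀ i, 0 < l i) :
    ∑ i, l i • convexHull ℝ (F i : Set (Fin n → ℝ)) =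
      mvV (fun j : (Σ i, F i) => (j.2 : Fin n → ℝ)) ''
        {μ | (∀ j, 0 ≤ μ j) ∧ mvP (fun j : (Σ i, F i) => j.1) μ = l} := by
  have hP : ∀ (μ : (Σ i, F i) → ℝ) i, mvP (fun j : (Σ i, F i) => j.1) μ i = ∑ y : F i, μ ⟨i, y⟩ := by
    intro μ i
    rw [mvP_apply, Fintype.sum_sigma, Finset.sum_eq_single i]
    · simp
    · intro k _ hk; simp [hk]
    · simp
  ext x
  rw [Set.mem_finsetSum]
  constructor
  · rintro ⟨g, hg, rfl⟩
    have hg' : ∀ i, ∃ w : (Fin n → ℝ) → ℝ, (∀ y ∈ F i, 0 ≤ w y) ∧ ∑ y ∈ F i, w y = 1 ∧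
        l i • ∑ y ∈ F i, w y • y = g i := by
      intro i
      obtain ⟨z, hz, e⟩ := hg (Finset.mem_univ i)
      obtain ⟨w, h1, h2, h3⟩ := Finset.mem_convexHull'.1 hz
      exact ⟨w, h1, h2, by rw [h3]; exact e⟩
    choose w h1 h2 h3 using hg'
    refine ⟨fun j => l j.1 * w j.1 j.2, ⟨fun j => mul_nonneg (hl _).le (h1 _ _ j.2.2), ?_⟩, ?_⟩
    · ext i
      rw [hP]
      simp only
      rw [← Finset.mul_sum, Finset.sum_coe_sort (F i) (w i), h2, mul_one]
    · rw [mvV_apply, Fintype.sum_sigma]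
      refine Finset.sum_congr rfl fun i _ => ?_
      rw [← h3, Finset.smul_sum, ← Finset.sum_coe_sort (F i)]
      simp [mul_smul]
  · rintro ⟨μ, ⟨h0, h1⟩, rfl⟩
    refine ⟨fun i => ∑ y : F i, μ ⟨i, y⟩ • (y : Fin n → ℝ), fun {i} _ => ?_, ?_⟩
    · have hs : ∑ y : F i, μ ⟨i, y⟩ = l i := by rw [← hP, h1]
      rw [Set.mem_smul_set_iff_inv_smul_mem₀ (hl i).ne', Finset.smul_sum]
      simp only [smul_smul]
      refine (convex_convexHull ℝ _).sum_mem (fun y _ => ?_) ?_ fun y _ =>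
        subset_convexHull ℝ _ y.2
      · exact mul_nonneg (inv_nonneg.2 (hl i).le) (h0 _)
      · rw [← Finset.mul_sum, hs, inv_mul_cancel₀ (hl i).ne']
    · rw [mvV_apply, Fintype.sum_sigma]

lemma mv_compact_sum {ι : Type*} (s : Finset ι) (K : ι → Set (Fin n → ℝ))
    (h : ∀ i, IsCompact (K i)) : IsCompact (∑ i ∈ s, K i) := by
  classical
  induction s using Finset.induction_on with
  | empty => simp
  | insert a s ha ih => rw [Finset.sum_insert ha]; exact (h a).add ih

lemma mv_continuity (Q : Fin n → Set (Fin n → ℝ)) (hc : ∀ i, Convex ℝ (Q i))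
    (hk : ∀ i, IsCompact (Q i)) (hne : ∀ i, (Q i).Nonempty) (l : Fin n → ℝ) (hl : ∀ i, 0 ≤ l i) :
    Filter.Tendsto (fun ε : ℝ => volume (∑ i, (l i + ε) • Q i)) (nhdsWithin 0 (Set.Ioi 0))
      (nhds (volume (∑ i, l i • Q i))) := by
  set K := ∑ i, l i • Q i with hK
  set L := ∑ i, Q i with hL
  have hKc : IsCompact K := mv_compact_sum _ _ fun i => (hk i).smul _
  have hLc : IsCompact L := mv_compact_sum _ _ hk
  obtain ⟨q, hq⟩ : L.Nonempty := by
    choose q hq using hne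
    exact ⟨∑ i, q i, Set.mem_finsetSum _ _ _ |>.2 ⟨q, fun {i} _ => hq i, rfl⟩⟩
  obtain ⟨R, hR0, hR⟩ := hLc.isBounded.subset_closedBall_lt 0 0
  have hsum : ∀ ε : ℝ, 0 < ε → ∑ i, (l i + ε) • Q i = K + ε • L := by
    intro ε hε
    rw [hK, hL, Finset.smul_sum, ← Finset.sum_add_distrib]
    exact Finset.sum_congr rfl fun i _ => (hc i).add_smul (hl i) hε.le
  have hth := tendsto_measure_cthickening_of_isCompact (μ := (volume : Measure (Fin n → ℝ))) hKc
  have h1 : Filter.Tendsto (fun ε : ℝ => ε * R) (nhdsWithin 0 (Set.Ioi 0)) (nhds 0) := by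
    have : Continuous fun ε : ℝ => ε * R := by fun_prop
    have := this.tendsto 0
    rw [zero_mul] at this
    exact this.mono_left nhdsWithin_le_nhds
  refine tendsto_of_tendsto_of_tendsto_of_le_of_le' tendsto_const_nhds (hth.comp h1) ?_ ?_
  · filter_upwards [self_mem_nhdsWithin] with ε hε
    rw [hsum ε hε, ← measure_preimage_add_right volume (-(ε • q)) K]
    refine measure_mono fun x hx => ?_
    exact ⟨x + -(ε • q), hx, ε • q, Set.smul_mem_smul_set hq, by simp⟩
  · filter_upwards [self_mem_nhdsWithin] with ε hε
    have hε' : 0 < ε := hε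
    rw [hsum ε hε, Function.comp_apply, ← hKc.add_closedBall_zero (mul_pos hε' hR0).le]
    refine measure_mono (Set.add_subset_add_left ?_)
    rintro _ ⟨y, hy, rfl⟩
    have := hR hy
    simp only [mem_closedBall_zero_iff] at this ⊢
    rw [norm_smul, Real.norm_of_nonneg hε'.le]
    gcongr
end Main

/-- The function `(λ₁,…,λₙ) ↦ vol(λ₁Q₁ + ⋯ + λₙQₙ)` (Minkowski sums, nonnegative
scalars) is a homogeneous polynomial function of degree `n`. -/
theorem volume_minkowski_sum_polynomial (n : ℕ) (Q : Fin n → Set (Fin n → ℝ))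
    (hQ : ∀ i, IsPolytope (Q i)) :
    ∃ P : MvPolynomial (Fin n) ℝ, P.IsHomogeneous n ∧
      ∀ lam : Fin n → ℝ, (∀ i, 0 ≤ lam i) →
        (volume (∑ i : Fin n, lam i • Q i)).toReal = MvPolynomial.eval lam P := by
  choose F hF hQF using hQ
  obtain rfl : Q = fun i => convexHull ℝ (F i : Set (Fin n → ℝ)) := funext hQF
  obtain ⟨P, hP, hv⟩ := mv_pos (fun j : (Σ i, F i) => j.1)
    (fun j : (Σ i, F i) => (j.2 : Fin n → ℝ))
  refine ⟨P, hP, fun l hl => ?_⟩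
  have hk : ∀ i, IsCompact (convexHull ℝ (F i : Set (Fin n → ℝ))) := fun i =>
    (F i).finite_toSet.isCompact_convexHull ℝ
  have h1 := mv_continuity (fun i => convexHull ℝ (F i : Set (Fin n → ℝ)))
    (fun i => convex_convexHull ℝ _) hk (fun i => (Finset.coe_nonempty.2 (hF i)).convexHull) l hl
  have hfin : volume (∑ i, l i • convexHull ℝ (F i : Set (Fin n → ℝ))) ≠ ⊤ :=
    (mv_compact_sum _ _ fun i => (hk i).smul _).measure_ne_top
  have h2 := (ENNReal.tendsto_toReal hfin).comp h1
  have h3 : Filter.Tendsto (fun ε : ℝ => MvPolynomial.eval (fun i => l i + ε) P)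
      (nhdsWithin 0 (Set.Ioi 0)) (nhds (MvPolynomial.eval l P)) := by
    have hcont : Continuous fun ε : ℝ => MvPolynomial.eval (fun i => l i + ε) P :=
      (MvPolynomial.continuous_eval P).comp (by fun_prop)
    have := hcont.tendsto 0
    simp only [add_zero] at this
    exact this.mono_left nhdsWithin_le_nhds
  refine tendsto_nhds_unique (h2.congr' ?_) h3
  filter_upwards [self_mem_nhdsWithin] with ε hε
  have hpos : ∀ i, 0 < l i + ε := fun i => add_pos_of_nonneg_of_pos (hl i) hε
  simp only [Function.comp_apply]
  rw [mv_minkowski F (fun i => l i + ε) hpos]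
  exact hv _ hpos
end

section
/- Let Δ ⊂ R^{n+1} be the standard unit simplex contained in the hyperplane {x_{n+1} = 0}, let Q_1,...,Q_n ⊂ R^n be convex polytopes, and let c_1,...,c_n ≥ 0. Then the (n+1)-dimensional mixed volume satisfies MV_{n+1}(Δ, Q_1×[0,c_1], ..., Q_n×[0,c_n]) = Σ_{i=1}^n c_i · MV_n(Δ', Q_1, ..., Q_{i-1}, Q_{i+1}, ..., Q_n), where Δ' ⊂ R^n is the standard unit simplex. -/
open Pointwise MeasureTheory

/-- The mixed volume of `n` convex bodies in `ℝⁿ`, normalized as the coefficient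
of `λ₁⋯λₙ` in `vol(λ₁P₁ + ⋯ + λₙPₙ)`, given here by the standard
inclusion–exclusion formula
`MV(P₁,…,Pₙ) = Σ_{∅ ≠ S ⊆ [n]} (-1)^{n-#S} vol(Σ_{i∈S} Pᵢ)`. -/
noncomputable def mixedVol (n : ℕ) (P : Fin n → Set (Fin n → ℝ)) : ℝ :=
  ∑ S ∈ Finset.univ.powerset.filter Finset.Nonempty,
    (-1 : ℝ) ^ (n - S.card) * (volume (∑ i ∈ S, P i)).toReal


/-- The standard unit simplex `{x : xᵢ ≥ 0, Σxᵢ ≤ 1} ⊆ ℝⁿ`. -/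
def stdSimplexSet (n : ℕ) : Set (Fin n → ℝ) :=
  {x | (∀ i, 0 ≤ x i) ∧ ∑ i, x i ≤ 1}

/-- The standard unit simplex of `ℝⁿ` embedded in the hyperplane
`{x_{n+1} = 0} ⊆ ℝ^{n+1}`. -/
def liftedSimplex (n : ℕ) : Set (Fin (n + 1) → ℝ) :=
  {x | (∀ i, 0 ≤ x i) ∧ (∑ i, x i) ≤ 1 ∧ x (Fin.last n) = 0}

/-- The prism `Q × [0, c] ⊆ ℝ^{n+1}` over `Q ⊆ ℝⁿ` of height `c`. -/
def prism {n : ℕ} (Q : Set (Fin n → ℝ)) (c : ℝ) : Set (Fin (n + 1) → ℝ) :=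
  {x | (fun i : Fin n => x i.castSucc) ∈ Q ∧ x (Fin.last n) ∈ Set.Icc 0 c}

section Core

set_option linter.unusedSectionVars false

variable {n : ℕ} {ι : Type} [Fintype ι] [DecidableEq ι] {β : ι → Type} [∀ i, Fintype (β i)]
  [∀ i, DecidableEq (β i)]

/-- The Cayley map. -/
noncomputable def phi (a : (Σ i, β i) → (Fin n → ℝ)) :
    ((Σ i, β i) → ℝ) →ₗ[ℝ] (Fin n → ℝ) × (ι → ℝ) where
  toFun w := (∑ j, w j • a j, fun i => ∑ b, w ⟨i, b⟩)
  map_add' u v := by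
    ext
    · simp [add_mul, Finset.sum_add_distrib]
    · simp [Finset.sum_add_distrib]
  map_smul' c v := by
    ext
    · simp [Finset.mul_sum, mul_assoc]
    · simp [Finset.mul_sum]

lemma phi_fst (a : (Σ i, β i) → (Fin n → ℝ)) (w : (Σ i, β i) → ℝ) :
    (phi a w).1 = ∑ j, w j • a j := rfl

lemma phi_snd (a : (Σ i, β i) → (Fin n → ℝ)) (w : (Σ i, β i) → ℝ) (i : ι) :
    (phi a w).2 i = ∑ b, w ⟨i, b⟩ := rfl

lemma phi_continuous (a : (Σ i, β i) → (Fin n → ℝ)) : Continuous (phi a) :=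
  LinearMap.continuous_of_finiteDimensional _

lemma phi_single (a : (Σ i, β i) → (Fin n → ℝ)) (j : Σ i, β i) :
    phi a (Pi.single j 1) = (a j, Pi.single j.1 1) := by
  ext k
  · simp [phi_fst, Pi.single_apply, Finset.sum_apply, ite_apply]
  · obtain ⟨i, b⟩ := j
    simp only [phi_snd]
    by_cases h : k = i
    · subst h
      simp [Pi.single_apply]
    · simp [h]

/-- Minkowski sum slice. -/
def Kset (a : (Σ i, β i) → (Fin n → ℝ)) (l : ι → ℝ) : Set (Fin n → ℝ) :=
  {x | ∃ w : (Σ i, β i) → ℝ, (∀ j, 0 ≤ w j) ∧ phi a w = (x, l)}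

def cell (a : (Σ i, β i) → (Fin n → ℝ)) (B : Finset (Σ i, β i)) (l : ι → ℝ) :
    Set (Fin n → ℝ) :=
  {x | ∃ w : (Σ i, β i) → ℝ, (∀ j ∈ B, 0 < w j) ∧ (∀ j ∉ B, w j = 0) ∧ phi a w = (x, l)}

def lexpos {J : Type} (e : J → ℕ) (d : J → ℝ) : Prop :=
  ∃ j, (∀ i, e i < e j → d i = 0) ∧ 0 < d j

lemma lexpos_neg {J : Type} (e : J → ℕ) (he : Function.Injective e) (d : J → ℝ)
    (h : lexpos e d) (h' : lexpos e (-d)) : False := by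
  obtain ⟨j, hj, hj'⟩ := h
  obtain ⟨k, hk, hk'⟩ := h'
  simp only [Pi.neg_apply] at hk hk'
  rcases lt_trichotomy (e j) (e k) with h | h | h
  · have := hk j h
    linarith
  · have := he h
    subst this
    linarith
  · have := hj k h
    linarith

def Good (a : (Σ i, β i) → (Fin n → ℝ)) (e : (Σ i, β i) → ℕ) (B : Finset (Σ i, β i)) : Prop :=
  ∀ d : (Σ i, β i) → ℝ, phi a d = 0 → (∀ j ∉ B, 0 ≤ d j) → d = 0 ∨ lexpos e d

lemma nonneg_closed (J : Type) : IsClosed {w : J → ℝ | ∀ j, 0 ≤ w j} := by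
  simp only [Set.ofPred_forall]
  exact isClosed_iInter fun j => isClosed_le continuous_const (continuous_apply j)

lemma fiber_closed (a : (Σ i, β i) → (Fin n → ℝ)) (y : (Fin n → ℝ) × (ι → ℝ)) :
    IsClosed {w : (Σ i, β i) → ℝ | (∀ j, 0 ≤ w j) ∧ phi a w = y} := by
  apply IsClosed.inter
  · exact nonneg_closed _
  · exact isClosed_eq (phi_continuous a) continuous_const

lemma le_of_phi (a : (Σ i, β i) → (Fin n → ℝ)) (w : (Σ i, β i) → ℝ) (hw : ∀ j, 0 ≤ w j)
    (j : Σ i, β i) : w j ≤ (phi a w).2 j.1 := by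
  rw [phi_snd]
  exact Finset.single_le_sum (f := fun b => w ⟨j.1, b⟩) (fun b _ => hw _) (Finset.mem_univ j.2)

lemma fiber_compact (a : (Σ i, β i) → (Fin n → ℝ)) (y : (Fin n → ℝ) × (ι → ℝ)) :
    IsCompact {w : (Σ i, β i) → ℝ | (∀ j, 0 ≤ w j) ∧ phi a w = y} := by
  refine (isCompact_Icc (a := (0 : (Σ i, β i) → ℝ)) (b := fun j => y.2 j.1)).of_isClosed_subset
    (fiber_closed a y) ?_
  rintro w ⟨hw, rfl⟩
  exact ⟨hw, le_of_phi a w hw⟩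

lemma Kset_compact (a : (Σ i, β i) → (Fin n → ℝ)) (l : ι → ℝ) : IsCompact (Kset a l) := by
  have h : IsCompact {w : (Σ i, β i) → ℝ | (∀ j, 0 ≤ w j) ∧ (phi a w).2 = l} := by
    refine (isCompact_Icc (a := (0 : (Σ i, β i) → ℝ)) (b := fun j => l j.1)).of_isClosed_subset
      ?_ ?_
    · apply IsClosed.inter
      · exact nonneg_closed _
      · exact isClosed_eq (continuous_snd.comp (phi_continuous a)) continuous_const
    · rintro w ⟨hw, rfl⟩
      exact ⟨hw, le_of_phi a w hw⟩
  convert h.image (continuous_fst.comp (phi_continuous a)) using 1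
  ext x
  constructor
  · rintro ⟨w, hw, h⟩
    exact ⟨w, ⟨hw, by rw [h]⟩, by simp [h]⟩
  · rintro ⟨w, ⟨hw, h⟩, h'⟩
    exact ⟨w, hw, Prod.ext h' h⟩

lemma exists_lexmin {J : Type} [Fintype J] (e : J → ℕ) (he : Function.Injective e)
    (K : Set (J → ℝ)) (hK : IsCompact K) (hne : K.Nonempty) :
    ∃ w ∈ K, ∀ v ∈ K, v = w ∨ lexpos e (v - w) := by
  have key : ∀ l : ℕ, ∃ w ∈ K, ∀ v ∈ K, (∀ i, e i < l → v i = w i) ∨ lexpos e (v - w) := by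
    intro l
    induction l with
    | zero =>
      obtain ⟨w, hw⟩ := hne
      exact ⟨w, hw, fun v _ => Or.inl (by simp)⟩
    | succ l ih =>
      obtain ⟨w, hw, h⟩ := ih
      by_cases hl : ∃ j, e j = l
      · obtain ⟨j, hj⟩ := hl
        have hc : IsCompact (K ∩ {v | ∀ i, e i < l → v i = w i}) := by
          apply hK.inter_right
          simp only [Set.ofPred_forall]
          exact isClosed_iInter fun i => isClosed_iInter fun _ =>
            isClosed_eq (continuous_apply i) continuous_const
        obtain ⟨u, ⟨huK, hu⟩, hmin⟩ := hc.exists_isMinOn ⟨w, hw, fun i _ => rfl⟩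
          (f := fun v => v j) (continuous_apply j).continuousOn
        refine ⟨u, huK, fun v hv => ?_⟩
        rcases h v hv with h1 | ⟨k, hk, hk'⟩
        · have hle : u j ≤ v j := hmin ⟨hv, h1⟩
          rcases hle.eq_or_lt with h2 | h2
          · left
            intro i hi
            rcases Nat.lt_succ_iff_lt_or_eq.1 hi with h3 | h3
            · rw [h1 i h3, hu i h3]
            · have : i = j := he (h3.trans hj.symm)
              rw [this, h2]
          · right
            refine ⟨j, fun i hi => ?_, by simpa using h2⟩
            rw [hj] at hi
            simp [h1 i hi, hu i hi]
        · by_cases hkl : e k < l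
          · right
            refine ⟨k, fun i hi => ?_, ?_⟩
            · have := hk i hi
              simp only [Pi.sub_apply] at this ⊢
              rw [hu i (hi.trans hkl), this]
            · simp only [Pi.sub_apply] at hk' ⊢
              rw [hu k hkl]
              exact hk'
          · have h1 : ∀ i, e i < l → v i = w i := fun i hi => by
              have := hk i (by omega)
              simp only [Pi.sub_apply] at this
              linarith
            have hle : u j ≤ v j := hmin ⟨hv, h1⟩
            rcases hle.eq_or_lt with h2 | h2
            · left
              intro i hi
              rcases Nat.lt_succ_iff_lt_or_eq.1 hi with h3 | h3
              · rw [h1 i h3, hu i h3]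
              · have : i = j := he (h3.trans hj.symm)
                rw [this, h2]
            · right
              refine ⟨j, fun i hi => ?_, by simpa using h2⟩
              rw [hj] at hi
              simp [h1 i hi, hu i hi]
      · refine ⟨w, hw, fun v hv => ?_⟩
        rcases h v hv with h1 | h1
        · left
          intro i hi
          rcases Nat.lt_succ_iff_lt_or_eq.1 hi with h3 | h3
          · exact h1 i h3
          · exact absurd ⟨i, h3⟩ hl
        · exact Or.inr h1
  obtain ⟨w, hw, h⟩ := key (Finset.univ.sup e + 1)
  refine ⟨w, hw, fun v hv => (h v hv).imp_left fun h' => funext fun i => h' i ?_⟩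
  exact Nat.lt_succ_of_le (Finset.le_sup (Finset.mem_univ i))

lemma exists_good (a : (Σ i, β i) → (Fin n → ℝ)) (e : (Σ i, β i) → ℕ)
    (he : Function.Injective e) (w : (Σ i, β i) → ℝ) (hw : ∀ j, 0 ≤ w j) :
    ∃ B, Good a e B ∧ ∃ u : (Σ i, β i) → ℝ, (∀ j ∈ B, 0 < u j) ∧ (∀ j ∉ B, u j = 0) ∧
      phi a u = phi a w := by
  obtain ⟨u, ⟨hu, hphi⟩, hmin⟩ := exists_lexmin e he _ (fiber_compact a (phi a w)) ⟨w, hw, rfl⟩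
  refine ⟨Finset.univ.filter (fun j => 0 < u j), ?_, u, by simp, ?_, hphi⟩
  · intro d hd hd'
    have hev : ∀ᶠ ε in nhdsWithin (0:ℝ) (Set.Ioi 0), ∀ j, 0 ≤ u j + ε * d j := by
      rw [Filter.eventually_all]
      intro j
      rcases (hu j).eq_or_lt with h | h
      · filter_upwards [self_mem_nhdsWithin] with ε hε
        have := hd' j (by simp [← h])
        rw [← h, zero_add]
        exact mul_nonneg (le_of_lt hε) this
      · apply Filter.Eventually.filter_mono nhdsWithin_le_nhds
        have hc : Continuous fun ε : ℝ => u j + ε * d j := by fun_prop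
        have := hc.tendsto 0
        simp only [zero_mul, add_zero] at this
        exact (this.eventually (lt_mem_nhds h)).mono fun _ h => h.le
    obtain ⟨ε, hε, hpos⟩ := (hev.and self_mem_nhdsWithin).exists
    replace hpos : 0 < ε := hpos
    have := hmin (u + ε • d) ⟨fun j => by simpa using hε j, by simp [hd, hphi]⟩
    simp only [add_eq_left, add_sub_cancel_left, smul_eq_zero, hpos.ne', false_or] at this
    refine this.imp_right ?_
    rintro ⟨j, hj, hj'⟩
    refine ⟨j, fun i hi => ?_, ?_⟩
    · have := hj i hi
      simpa [hpos.ne'] using this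
    · simpa [hpos] using hj'
  · intro j hj
    simp only [Finset.mem_filter, Finset.mem_univ, true_and, not_lt] at hj
    exact le_antisymm hj (hu j)

lemma cell_nonneg {B : Finset (Σ i, β i)} {w : (Σ i, β i) → ℝ} (h1 : ∀ j ∈ B, 0 < w j)
    (h2 : ∀ j ∉ B, w j = 0) (j : Σ i, β i) : 0 ≤ w j := by
  by_cases h : j ∈ B
  · exact (h1 j h).le
  · exact (h2 j h).ge

lemma Kset_eq (a : (Σ i, β i) → (Fin n → ℝ)) (e : (Σ i, β i) → ℕ)
    (he : Function.Injective e) (l : ι → ℝ) (T : Finset (Finset (Σ i, β i)))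
    (hT : ∀ B, B ∈ T ↔ Good a e B) : Kset a l = ⋃ B ∈ T, cell a B l := by
  ext x
  simp only [Set.mem_iUnion, exists_prop, hT]
  constructor
  · rintro ⟨w, hw, h⟩
    obtain ⟨B, hB, u, h1, h2, h3⟩ := exists_good a e he w hw
    exact ⟨B, hB, u, h1, h2, h3.trans h⟩
  · rintro ⟨B, hB, u, h1, h2, h3⟩
    exact ⟨u, cell_nonneg h1 h2, h3⟩

lemma cell_disjoint (a : (Σ i, β i) → (Fin n → ℝ)) (e : (Σ i, β i) → ℕ)
    (he : Function.Injective e) (l : ι → ℝ) (B C : Finset (Σ i, β i))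
    (hB : Good a e B) (hC : Good a e C) (hne : B ≠ C) : Disjoint (cell a B l) (cell a C l) := by
  rw [Set.disjoint_left]
  rintro x ⟨u, u1, u2, u3⟩ ⟨v, v1, v2, v3⟩
  have huv : u = v := by
    have h1 := hB (v - u) (by simp [u3, v3]) (fun j hj => by
      simpa [u2 j hj] using cell_nonneg v1 v2 j)
    have h2 := hC (u - v) (by simp [u3, v3]) (fun j hj => by
      simpa [v2 j hj] using cell_nonneg u1 u2 j)
    rcases h1 with h1 | h1
    · exact (sub_eq_zero.1 h1).symm
    rcases h2 with h2 | h2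
    · exact sub_eq_zero.1 h2
    rw [← neg_sub] at h2
    exact (lexpos_neg e he _ h1 h2).elim
  subst huv
  apply hne
  ext j
  constructor
  · intro h
    by_contra h'
    exact (u1 j h).ne' (v2 j h')
  · intro h
    by_contra h'
    exact (v1 j h).ne' (u2 j h')

lemma cell_convex (a : (Σ i, β i) → (Fin n → ℝ)) (l : ι → ℝ) (B : Finset (Σ i, β i)) :
    Convex ℝ (cell a B l) := by
  rintro x ⟨u, u1, u2, u3⟩ y ⟨v, v1, v2, v3⟩ s t hs ht hst
  refine ⟨s • u + t • v, fun j hj => ?_, fun j hj => ?_, ?_⟩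
  · have h1 := u1 j hj
    have h2 := v1 j hj
    simp only [Pi.add_apply, Pi.smul_apply, smul_eq_mul]
    rcases hs.eq_or_lt with h | h
    · have : t = 1 := by linarith
      subst this
      simpa [← h] using h2
    · have := mul_pos h h1
      have := mul_nonneg ht h2.le
      linarith
  · simp [u2 j hj, v2 j hj]
  · rw [map_add, map_smul, map_smul, u3, v3]
    ext
    · simp
    · simp [← add_mul, hst]

lemma volume_Kset (a : (Σ i, β i) → (Fin n → ℝ)) (e : (Σ i, β i) → ℕ)
    (he : Function.Injective e) (l : ι → ℝ) (T : Finset (Finset (Σ i, β i)))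
    (hT : ∀ B, B ∈ T ↔ Good a e B) :
    (volume (Kset a l)).toReal = ∑ B ∈ T, (volume (cell a B l)).toReal := by
  have h := measure_biUnion_finset₀ (μ := volume) (s := T) (f := fun B => cell a B l)
    (fun B hB C hC hne => (cell_disjoint a e he l B C ((hT B).1 hB) ((hT C).1 hC) hne).aedisjoint)
    (fun B _ => (cell_convex a l B).nullMeasurableSet volume)
  have hfin : volume (Kset a l) ≠ ⊤ := (Kset_compact a l).measure_lt_top.ne
  rw [Kset_eq a e he l T hT] at hfin ⊢
  rw [h] at hfin ⊢
  rw [ENNReal.toReal_sum]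
  intro B hB
  exact (ENNReal.sum_ne_top.1 hfin) B hB

lemma good_card (a : (Σ i, β i) → (Fin n → ℝ)) (e : (Σ i, β i) → ℕ)
    (he : Function.Injective e) (B : Finset (Σ i, β i)) (hB : Good a e B) :
    B.card ≤ n + Fintype.card ι := by
  let ext0 : (B → ℝ) →ₗ[ℝ] ((Σ i, β i) → ℝ) :=
    { toFun := fun w j => if h : j ∈ B then w ⟨j, h⟩ else 0
      map_add' := fun u v => by
        ext j
        by_cases h : j ∈ B <;> simp [h]
      map_smul' := fun c v => by
        ext j
        by_cases h : j ∈ B <;> simp [h] }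
  have hinj : Function.Injective ((phi a).comp ext0) := by
    rw [injective_iff_map_eq_zero]
    intro w hw
    have h0 : ∀ j ∉ B, ext0 w j = 0 := fun j hj => by simp [ext0, hj]
    have hz : ext0 w = 0 := by
      rcases hB (ext0 w) hw (fun j hj => (h0 j hj).ge) with h1 | h1
      · exact h1
      rcases hB (-ext0 w) (by rw [map_neg, neg_eq_zero]; exact hw)
        (fun j hj => by simp [h0 j hj]) with h2 | h2
      · exact neg_eq_zero.1 h2
      exact (lexpos_neg e he _ h1 h2).elim
    ext ⟨j, hj⟩
    have := congrFun hz j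
    simpa [ext0, hj] using this
  have := LinearMap.finrank_le_finrank_of_injective hinj
  simpa using this

lemma good_class (a : (Σ i, β i) → (Fin n → ℝ)) (e : (Σ i, β i) → ℕ)
    (he : Function.Injective e) (hι : n < Fintype.card ι)
    (B : Finset (Σ i, β i)) (hB : Good a e B) :
    ∃ i, ∀ b b' : β i, ⟨i, b⟩ ∈ B → ⟨i, b'⟩ ∈ B → b = b' := by
  by_contra! hcon
  have h1 := good_card a e he B hB
  have h2 : B.card = ∑ i, (B.filter (fun j => j.1 = i)).card :=
    Finset.card_eq_sum_card_fiberwise (fun _ _ => Finset.mem_univ _)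
  have h3 : ∀ i, 2 ≤ (B.filter (fun j => j.1 = i)).card := by
    intro i
    obtain ⟨b, b', h, h', hne⟩ := hcon i
    have : 1 < (B.filter (fun j => j.1 = i)).card := by
      rw [Finset.one_lt_card]
      exact ⟨⟨i, b⟩, by simp [h], ⟨i, b'⟩, by simp [h'], by simpa using hne⟩
    exact this
  have h4 : ∑ i : ι, 2 ≤ ∑ i, (B.filter (fun j => j.1 = i)).card :=
    Finset.sum_le_sum fun i _ => h3 i
  simp at h4
  omega

lemma cell_le (a : (Σ i, β i) → (Fin n → ℝ)) (B : Finset (Σ i, β i)) (i : ι)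
    (hi : ∀ b b' : β i, ⟨i, b⟩ ∈ B → ⟨i, b'⟩ ∈ B → b = b') (l : ι → ℝ) (t : ℝ)
    (hl : 0 < l i) (hl' : 0 < l i + t) :
    volume (cell a B l) ≤ volume (cell a B (l + t • Pi.single i 1)) := by
  by_cases h : ∃ b, ⟨i, b⟩ ∈ B
  · obtain ⟨b, hb⟩ := h
    rw [← measure_preimage_add_right volume (t • a ⟨i, b⟩)
      (cell a B (l + t • Pi.single i 1))]
    apply measure_mono
    rintro x ⟨w, w1, w2, w3⟩
    have hwb : w ⟨i, b⟩ = l i := by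
      have h : ∑ b', w ⟨i, b'⟩ = l i := by
        rw [← phi_snd a, w3]
      rw [← h, Finset.sum_eq_single b]
      · intro b' _ hne
        exact w2 _ fun h' => hne (hi _ _ h' hb)
      · simp
    refine ⟨w + t • Pi.single ⟨i, b⟩ 1, fun j hj => ?_, fun j hj => ?_, ?_⟩
    · by_cases hji : j = ⟨i, b⟩
      · subst hji
        simpa [hwb] using hl'
      · simpa [Pi.single_apply, hji] using w1 j hj
    · have hji : j ≠ ⟨i, b⟩ := fun h => hj (h ▸ hb)
      simpa [Pi.single_apply, hji] using w2 j hj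
    · rw [map_add, map_smul, w3, phi_single]
      rfl
  · have : cell a B l = ∅ := by
      rw [Set.eq_empty_iff_forall_notMem]
      rintro x ⟨w, w1, w2, w3⟩
      have h' : ∑ b', w ⟨i, b'⟩ = l i := by
        rw [← phi_snd a, w3]
      rw [Finset.sum_eq_zero] at h'
      · linarith
      · intro b _
        exact w2 _ fun h' => h ⟨b, h'⟩
    simp [this]

lemma cell_eq (a : (Σ i, β i) → (Fin n → ℝ)) (B : Finset (Σ i, β i)) (i : ι)
    (hi : ∀ b b' : β i, ⟨i, b⟩ ∈ B → ⟨i, b'⟩ ∈ B → b = b') (l : ι → ℝ) (t : ℝ)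
    (hl : 0 < l i) (hl' : 0 < l i + t) :
    volume (cell a B (l + t • Pi.single i 1)) = volume (cell a B l) := by
  apply le_antisymm _ (cell_le a B i hi l t hl hl')
  have := cell_le a B i hi (l + t • Pi.single i 1) (-t) (by simpa using hl') (by simpa using hl)
  simpa using this

/-- indicator vector of `S` -/
def ind (S : Finset ι) : ι → ℝ := fun i => if i ∈ S then 1 else 0

lemma sum_split {M : Type} [AddCommMonoid M] (f : Finset ι → M) (i : ι) :
    ∑ S, f S = ∑ U ∈ (Finset.univ.erase i).powerset, (f U + f (insert i U)) := by
  rw [Finset.sum_add_distrib, ← Finset.sum_powerset_insert (Finset.notMem_erase _ _),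
    Finset.insert_erase (Finset.mem_univ i), Finset.powerset_univ]

lemma alt_sum_eps (a : (Σ i, β i) → (Fin n → ℝ)) (hι : n < Fintype.card ι) (ε : ℝ) (hε : 0 < ε) :
    ∑ S : Finset ι, (-1 : ℝ) ^ S.card * (volume (Kset a ((fun _ => ε) + ind S))).toReal = 0 := by
  classical
  let e : (Σ i, β i) → ℕ := fun j => (Fintype.equivFin (Σ i, β i) j : ℕ)
  have he : Function.Injective e :=
    fun x y h => (Fintype.equivFin (Σ i, β i)).injective (Fin.ext h)
  let T : Finset (Finset (Σ i, β i)) := Finset.univ.filter (Good a e)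
  have hT : ∀ B, B ∈ T ↔ Good a e B := by simp [T]
  simp_rw [volume_Kset a e he _ T hT, Finset.mul_sum]
  rw [Finset.sum_comm]
  apply Finset.sum_eq_zero
  intro B hB
  obtain ⟨i, hi⟩ := good_class a e he hι B ((hT B).1 hB)
  rw [sum_split _ i]
  apply Finset.sum_eq_zero
  intro U hU
  have hiU : i ∉ U := fun h => by
    have := Finset.mem_powerset.1 hU h
    simp at this
  have h1 : (fun _ => ε) + ind (insert i U)
      = ((fun _ => ε) + ind U) + (1 : ℝ) • (Pi.single i 1 : ι → ℝ) := by
    ext k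
    by_cases hk : k = i
    · subst hk
      simp [ind, hiU]
    · simp [ind, hk]
  rw [h1, cell_eq a B i hi, Finset.card_insert_of_notMem hiU]
  · ring
  · simp [ind, hiU, hε]
  · simp [ind, hiU]
    linarith

lemma Kset_lower (a : (Σ i, β i) → (Fin n → ℝ)) (hne : ∀ i, Nonempty (β i)) (l : ι → ℝ) (ε : ℝ)
    (hε : 0 ≤ ε) :
    volume (Kset a l) ≤ volume (Kset a ((fun _ => ε) + l)) := by
  have b : ∀ i, β i := fun i => (hne i).some
  rw [← measure_preimage_add_right volume (∑ i, ε • a ⟨i, b i⟩) (Kset a ((fun _ => ε) + l))]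
  apply measure_mono
  rintro x ⟨w, hw, h⟩
  refine ⟨w + ∑ i, ε • Pi.single ⟨i, b i⟩ 1, fun j => ?_, ?_⟩
  · simp only [Pi.add_apply, Finset.sum_apply, Pi.smul_apply, smul_eq_mul]
    refine add_nonneg (hw j) (Finset.sum_nonneg fun i _ => mul_nonneg hε ?_)
    rw [Pi.single_apply]
    split_ifs <;> norm_num
  · rw [map_add, map_sum, h]
    simp_rw [map_smul, phi_single]
    ext k
    · simp [Prod.fst_sum]
    · simp [Prod.snd_sum, Pi.single_apply, add_comm]

lemma Kset_upper (a : (Σ i, β i) → (Fin n → ℝ)) (S : Finset ι) (ε : ℝ) (hε : 0 ≤ ε) :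
    Kset a ((fun _ => ε) + ind S) ⊆
      Metric.cthickening (ε * ∑ j, ‖a j‖) (Kset a (ind S)) := by
  rintro x ⟨w, hw, h⟩
  have h1 : ∀ i, ∑ b, w ⟨i, b⟩ = ε + ind S i := fun i => by rw [← phi_snd a, h]; rfl
  have hx : x = ∑ j, w j • a j := by rw [← phi_fst, h]
  let w' : (Σ i, β i) → ℝ := fun j => if j.1 ∈ S then w j / (1 + ε) else 0
  have hpos : 0 < 1 + ε := by linarith
  have hw' : ∀ j, 0 ≤ w' j := fun j => by
    simp only [w']
    split_ifs
    · exact div_nonneg (hw j) hpos.le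
    · exact le_rfl
  have h2 : (phi a w').2 = ind S := by
    ext i
    rw [phi_snd]
    by_cases hi : i ∈ S
    · simp only [w', hi, if_true, ← Finset.sum_div, h1, ind]
      rw [add_comm]
      exact div_self hpos.ne'
    · simp [w', hi, ind]
  refine Metric.mem_cthickening_of_dist_le x ((phi a w').1) _ _ ⟨w', hw', Prod.ext rfl h2⟩ ?_
  rw [hx, phi_fst, dist_eq_norm, ← Finset.sum_sub_distrib, Finset.mul_sum]
  refine (norm_sum_le _ _).trans (Finset.sum_le_sum fun j _ => ?_)
  rw [← sub_smul, norm_smul]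
  refine mul_le_mul_of_nonneg_right ?_ (norm_nonneg _)
  have hle : w j ≤ ε + ind S j.1 := by
    have := le_of_phi a w hw j
    rw [h] at this
    exact this
  rw [Real.norm_eq_abs]
  by_cases hj : j.1 ∈ S
  · simp only [w', hj, if_true]
    simp only [ind, hj, if_true] at hle
    have : w j - w j / (1 + ε) = ε * (w j / (1 + ε)) := by
      field_simp
      ring
    rw [this, abs_of_nonneg (mul_nonneg hε (div_nonneg (hw j) hpos.le))]
    refine mul_le_of_le_one_right hε ?_
    rw [div_le_one hpos]
    linarith
  · simp only [w', hj, if_false, sub_zero, abs_of_nonneg (hw j)]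
    simpa [ind, hj] using hle

lemma Kset_tendsto (a : (Σ i, β i) → (Fin n → ℝ)) (hne : ∀ i, Nonempty (β i)) (S : Finset ι) :
    Filter.Tendsto (fun ε : ℝ => (volume (Kset a ((fun _ => ε) + ind S))).toReal)
      (nhdsWithin 0 (Set.Ioi 0)) (nhds (volume (Kset a (ind S))).toReal) := by
  refine (ENNReal.tendsto_toReal (Kset_compact a (ind S)).measure_lt_top.ne).comp ?_
  have h1 : Filter.Tendsto (fun ε : ℝ => volume (Metric.cthickening (ε * ∑ j, ‖a j‖)
      (Kset a (ind S)))) (nhdsWithin 0 (Set.Ioi 0)) (nhds (volume (Kset a (ind S)))) := by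
    refine (tendsto_measure_cthickening_of_isCompact (Kset_compact a (ind S))).comp ?_
    have hc : Continuous fun ε : ℝ => ε * ∑ j, ‖a j‖ := by fun_prop
    have := hc.tendsto 0
    simp only [zero_mul] at this
    exact this.mono_left nhdsWithin_le_nhds
  refine tendsto_of_tendsto_of_tendsto_of_le_of_le' tendsto_const_nhds h1 ?_ ?_
  · filter_upwards [self_mem_nhdsWithin] with ε hε
    exact Kset_lower a hne _ ε (le_of_lt hε)
  · filter_upwards [self_mem_nhdsWithin] with ε hε
    exact measure_mono (Kset_upper a S ε (le_of_lt hε))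

lemma alt_sum_Kset (a : (Σ i, β i) → (Fin n → ℝ)) (hne : ∀ i, Nonempty (β i))
    (hι : n < Fintype.card ι) :
    ∑ S : Finset ι, (-1 : ℝ) ^ S.card * (volume (Kset a (ind S))).toReal = 0 := by
  have h1 := tendsto_finsetSum (Finset.univ : Finset (Finset ι))
    (fun S _ => (Kset_tendsto a hne S).const_mul ((-1 : ℝ) ^ S.card))
  refine tendsto_nhds_unique h1 ?_
  refine tendsto_const_nhds.congr' ?_
  filter_upwards [self_mem_nhdsWithin] with ε hε
  exact (alt_sum_eps a hι ε hε).symm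

end Core

lemma Kset_eq_sum {n : ℕ} {ι : Type} [Fintype ι] [DecidableEq ι] (F : ι → Finset (Fin n → ℝ))
    (S : Finset ι) :
    Kset (β := fun i => F i) (fun j => (j.2 : Fin n → ℝ)) (ind S)
      = ∑ i ∈ S, convexHull ℝ (F i : Set (Fin n → ℝ)) := by
  ext x
  rw [Set.mem_finsetSum]
  constructor
  · rintro ⟨w, hw, h⟩
    have h1 : ∀ i, ∑ b, w ⟨i, b⟩ = ind S i := fun i =>
      congrFun (congrArg Prod.snd h) i
    have hx : ∑ j, w j • (j.2 : Fin n → ℝ) = x :=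
      congrArg Prod.fst h
    refine ⟨fun i => ∑ b : F i, w ⟨i, b⟩ • (b : Fin n → ℝ), fun {i} hi => ?_, ?_⟩
    · refine mem_convexHull_of_exists_fintype (fun b : F i => w ⟨i, b⟩) (fun b => (b : Fin n → ℝ))
        (fun b => hw _) ?_ (fun b => b.2) rfl
      rw [h1]
      simp [ind, hi]
    · rw [← hx, Fintype.sum_sigma]
      apply Finset.sum_subset (Finset.subset_univ S)
      intro i _ hi
      have h2 := h1 i
      simp only [ind, hi, if_false] at h2
      rw [Finset.sum_eq_zero_iff_of_nonneg (fun b _ => hw _)] at h2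
      exact Finset.sum_eq_zero fun b hb => by rw [h2 b hb, zero_smul]
  · rintro ⟨g, hg, rfl⟩
    have h1 : ∀ i, ∃ u : (Fin n → ℝ) → ℝ, i ∈ S → (∀ y ∈ F i, 0 ≤ u y) ∧
        ∑ y ∈ F i, u y = 1 ∧ ∑ y ∈ F i, u y • y = g i := by
      intro i
      by_cases hi : i ∈ S
      · obtain ⟨u, hu⟩ := Finset.mem_convexHull'.1 (hg hi)
        exact ⟨u, fun _ => hu⟩
      · exact ⟨0, fun h => absurd h hi⟩
    choose u hu using h1
    refine ⟨fun j => if j.1 ∈ S then u j.1 j.2 else 0, fun j => ?_, Prod.ext ?_ ?_⟩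
    · dsimp only
      split_ifs with hj
      · exact (hu j.1 hj).1 _ j.2.2
      · exact le_rfl
    · rw [phi_fst, Fintype.sum_sigma]
      simp only
      rw [← Finset.sum_subset (Finset.subset_univ S)]
      · refine Finset.sum_congr rfl fun i hi => ?_
        simp only [hi, if_true]
        rw [← (hu i hi).2.2]
        exact Finset.sum_coe_sort (F i) (fun y => u i y • y)
      · intro i _ hi
        simp [hi]
    · ext i
      rw [phi_snd]
      by_cases hi : i ∈ S
      · simp only [hi, if_true, ind]
        rw [← (hu i hi).2.1]
        exact Finset.sum_coe_sort (F i) (fun y => u i y)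
      · simp [hi, ind]

lemma alt_sum_poly {n : ℕ} {ι : Type} [Fintype ι] [DecidableEq ι] (hι : n < Fintype.card ι)
    (P : ι → Set (Fin n → ℝ)) (hP : ∀ i, IsPolytope (P i)) :
    ∑ S : Finset ι, (-1 : ℝ) ^ S.card * (volume (∑ i ∈ S, P i)).toReal = 0 := by
  choose F hF hPF using hP
  have := alt_sum_Kset (β := fun i => F i) (fun j => (j.2 : Fin n → ℝ))
    (fun i => (hF i).to_subtype) hι
  simp_rw [Kset_eq_sum] at this
  simp_rw [hPF]
  exact this

lemma isPolytope_stdSimplexSet (n : ℕ) : IsPolytope (stdSimplexSet n) := by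
  classical
  refine ⟨insert 0 (Finset.univ.image fun i : Fin n => Pi.single i 1), by simp, ?_⟩
  apply Set.Subset.antisymm
  · rintro x ⟨hx, hx'⟩
    refine mem_convexHull_of_exists_fintype
      (fun o : Option (Fin n) => o.elim (1 - ∑ i, x i) x)
      (fun o : Option (Fin n) => o.elim 0 (fun i => Pi.single i 1)) ?_ ?_ ?_ ?_
    · rintro (_ | i)
      · simpa using hx'
      · exact hx i
    · simp [Fintype.sum_option]
    · rintro (_ | i) <;> simp
    · ext k
      simp [Fintype.sum_option, Pi.single_apply]
  · apply convexHull_min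
    · intro y hy
      simp only [Finset.coe_insert, Finset.coe_image, Finset.coe_univ, Set.image_univ,
        Set.mem_insert_iff, Set.mem_range] at hy
      rcases hy with rfl | ⟨i, rfl⟩
      · exact ⟨by simp, by simp⟩
      · refine ⟨fun k => ?_, by simp⟩
        rw [Pi.single_apply]
        split_ifs <;> norm_num
    · rintro x ⟨x1, x2⟩ y ⟨y1, y2⟩ s t hs ht hst
      refine ⟨fun i => ?_, ?_⟩
      · have := mul_nonneg hs (x1 i)
        have := mul_nonneg ht (y1 i)
        simp only [Pi.add_apply, Pi.smul_apply, smul_eq_mul]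
        linarith
      · simp only [Pi.add_apply, Pi.smul_apply, smul_eq_mul, Finset.sum_add_distrib,
          ← Finset.mul_sum]
        nlinarith

lemma volume_prism {n : ℕ} (A : Set (Fin n → ℝ)) (c : ℝ) (hc : 0 ≤ c) :
    (volume (prism A c)).toReal = c * (volume A).toReal := by
  have h := volume_preserving_piFinSuccAbove (fun _ : Fin (n + 1) => ℝ) (Fin.last n)
  have h2 : prism A c = (MeasurableEquiv.piFinSuccAbove (fun _ : Fin (n + 1) => ℝ) (Fin.last n))
      ⁻¹' (Set.Icc 0 c ×ˢ A) := by
    ext x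
    simp only [prism, Set.mem_preimage, Set.mem_prod, MeasurableEquiv.piFinSuccAbove_apply]
    rw [and_comm]
    simp [Fin.insertNthEquiv, Fin.removeNth]
    intros
    rfl
  rw [h2, h.measure_preimage_equiv, Measure.volume_eq_prod, Measure.prod_prod, Real.volume_Icc,
    ENNReal.toReal_mul, sub_zero, ENNReal.toReal_ofReal hc]

lemma prism_add {n : ℕ} (A B : Set (Fin n → ℝ)) (c d : ℝ) (hc : 0 ≤ c) (hd : 0 ≤ d) :
    prism A c + prism B d = prism (A + B) (c + d) := by
  ext x
  rw [Set.mem_add]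
  constructor
  · rintro ⟨y, ⟨hy, hy1, hy2⟩, z, ⟨hz, hz1, hz2⟩, rfl⟩
    refine ⟨Set.add_mem_add hy hz, ?_, ?_⟩
    · simp only [Pi.add_apply]
      linarith
    · simp only [Pi.add_apply]
      linarith
  · rintro ⟨h, h1, h2⟩
    obtain ⟨y, hy, z, hz, hyz⟩ := Set.mem_add.1 h
    refine ⟨Fin.snoc y (min (x (Fin.last n)) c), ⟨by simpa using hy, ?_⟩,
      Fin.snoc z (x (Fin.last n) - min (x (Fin.last n)) c), ⟨by simpa using hz, ?_⟩, ?_⟩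
    · simp [hc, h1]
    · simp only [Fin.snoc_last, Set.mem_Icc, sub_nonneg, min_le_iff, le_refl, true_or, true_and]
      rcases min_cases (x (Fin.last n)) c with ⟨h, _⟩ | ⟨h, _⟩ <;> rw [h] <;> linarith
    · ext k
      refine Fin.lastCases ?_ (fun i => ?_) k
      · simp
      · simpa using congrFun hyz i

lemma prism_sum {n : ℕ} {ι : Type} (Q : ι → Set (Fin n → ℝ)) (c : ι → ℝ) (hc : ∀ i, 0 ≤ c i)
    (T : Finset ι) : ∑ i ∈ T, prism (Q i) (c i) = prism (∑ i ∈ T, Q i) (∑ i ∈ T, c i) := by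
  classical
  induction T using Finset.induction_on with
  | empty =>
    ext x
    simp only [Finset.sum_empty, prism, Set.mem_zero, Set.Icc_self, Set.mem_singleton_iff,
      Set.mem_ofPred_eq]
    constructor
    · rintro rfl
      exact ⟨rfl, rfl⟩
    · rintro ⟨h1, h2⟩
      ext k
      refine Fin.lastCases h2 (fun i => congrFun h1 i) k
  | insert i T hi ih =>
    rw [Finset.sum_insert hi, Finset.sum_insert hi, Finset.sum_insert hi, ih,
      prism_add _ _ _ _ (hc i) (Finset.sum_nonneg fun i _ => hc i)]

lemma liftedSimplex_eq (n : ℕ) : liftedSimplex n = prism (stdSimplexSet n) 0 := by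
  ext x
  simp only [liftedSimplex, prism, stdSimplexSet, Set.mem_ofPred_eq, Set.Icc_self,
    Set.mem_singleton_iff, Fin.sum_univ_castSucc]
  constructor
  · rintro ⟨h1, h2, h3⟩
    exact ⟨⟨fun i => h1 _, by linarith⟩, h3⟩
  · rintro ⟨⟨h1, h2⟩, h3⟩
    exact ⟨fun k => Fin.lastCases h3.ge (fun i => h1 i) k, by linarith, h3⟩

lemma mixedVol_eq (n : ℕ) (hn : 0 < n) (P : Fin n → Set (Fin n → ℝ)) :
    mixedVol n P = (-1 : ℝ) ^ n *
      ∑ S : Finset (Fin n), (-1 : ℝ) ^ S.card * (volume (∑ i ∈ S, P i)).toReal := by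
  have : Nonempty (Fin n) := ⟨⟨0, hn⟩⟩
  unfold mixedVol
  rw [Finset.mul_sum, Finset.powerset_univ, Finset.sum_filter]
  refine Finset.sum_congr rfl fun S _ => ?_
  split_ifs with h
  · rw [← mul_assoc, ← pow_add]
    congr 1
    have h1 : S.card ≤ n := by simpa using S.card_le_univ
    have h2 : n + S.card = (n - S.card) + 2 * S.card := by omega
    rw [h2, pow_add, pow_mul]
    simp
  · rw [Finset.not_nonempty_iff_eq_empty] at h
    subst h
    have : volume (0 : Set (Fin n → ℝ)) = 0 := by
      rw [← Set.singleton_zero]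
      exact measure_singleton _
    simp [this]

lemma sum_finset_succ (n : ℕ) (f : Finset (Fin (n + 1)) → ℝ) :
    ∑ S, f S = ∑ T : Finset (Fin n), (f (T.map (Fin.succEmb n))
      + f (insert 0 (T.map (Fin.succEmb n)))) := by
  rw [sum_split f 0]
  symm
  refine Finset.sum_bij (fun T _ => T.map (Fin.succEmb n)) ?_ ?_ ?_ ?_
  · intro T _
    rw [Finset.mem_powerset]
    intro k hk
    obtain ⟨i, _, rfl⟩ := Finset.mem_map.1 hk
    simp [Fin.succ_ne_zero]
  · intro T _ U _ h
    exact Finset.map_injective _ h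
  · intro U hU
    refine ⟨Finset.univ.filter (fun i => Fin.succ i ∈ U), Finset.mem_univ _, ?_⟩
    ext k
    simp only [Finset.mem_map, Finset.mem_filter, Finset.mem_univ, true_and]
    constructor
    · rintro ⟨i, hi, rfl⟩
      exact hi
    · intro hk
      have hk0 : k ≠ 0 := by
        have := Finset.mem_powerset.1 hU hk
        simpa using this
      obtain ⟨i, rfl⟩ := Fin.exists_succ_eq.2 hk0
      exact ⟨i, hk, rfl⟩
  · intro T _
    rfl

lemma zero_notMem_map (n : ℕ) (T : Finset (Fin n)) : (0 : Fin (n + 1)) ∉ T.map (Fin.succEmb n) := by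
  simp [Fin.succ_ne_zero]

/-- `MV_{n+1}(Δ, Q₁×[0,c₁], …, Qₙ×[0,cₙ]) = Σᵢ cᵢ·MV_n(Δ', Q₁,…,Q̂ᵢ,…,Qₙ)`,
where `Δ` is the standard unit simplex in the hyperplane `{x_{n+1}=0}` and `Δ'`
the standard unit simplex of `ℝⁿ` (on the right, `Qᵢ` is replaced by `Δ'`,
which by symmetry of the mixed volume amounts to omitting `Qᵢ` and adjoining
`Δ'`). -/
theorem mixedVol_prisms (n : ℕ) (Q : Fin n → Set (Fin n → ℝ))
    (hQ : ∀ i, IsPolytope (Q i)) (c : Fin n → ℝ) (hc : ∀ i, 0 ≤ c i) :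
    mixedVol (n + 1) (Fin.cons (liftedSimplex n) (fun i => prism (Q i) (c i)))
      = ∑ i : Fin n, c i * mixedVol n (Function.update Q i (stdSimplexSet n)) := by
  classical
  set D := stdSimplexSet n with hD
  set u : Finset (Fin n) → ℝ := fun T => (volume (D + ∑ i ∈ T, Q i)).toReal with hu
  set v : Finset (Fin n) → ℝ := fun T => (volume (∑ i ∈ T, Q i)).toReal with hv
  -- vanishing of the `(n+1)`-st mixed difference
  have key : ∑ T : Finset (Fin n), (-1 : ℝ) ^ T.card * (u T - v T) = 0 := by
    have h := alt_sum_poly (n := n) (ι := Fin (n + 1)) (by simp) (Fin.cons D Q) (by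
      intro i
      refine Fin.cases ?_ (fun i => ?_) i
      · exact isPolytope_stdSimplexSet n
      · exact hQ i)
    rw [sum_finset_succ] at h
    simp only [Finset.sum_insert (zero_notMem_map n _), Finset.card_insert_of_notMem
      (zero_notMem_map n _), Finset.card_map, Finset.sum_map, Fin.coe_succEmb, Fin.cons_succ,
      Fin.cons_zero] at h
    rw [← neg_eq_zero, ← Finset.sum_neg_distrib, ← h]
    refine Finset.sum_congr rfl fun T _ => ?_
    simp only [hu, hv]
    ring
  have hL : mixedVol (n + 1) (Fin.cons (liftedSimplex n) (fun i => prism (Q i) (c i)))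
      = (-1 : ℝ) ^ n * ∑ T : Finset (Fin n),
          (∑ i ∈ T, c i) * ((-1 : ℝ) ^ T.card * (u T - v T)) := by
    rw [mixedVol_eq _ (Nat.succ_pos n), sum_finset_succ]
    simp only [Finset.sum_insert (zero_notMem_map n _), Finset.card_insert_of_notMem
      (zero_notMem_map n _), Finset.card_map, Finset.sum_map, Fin.coe_succEmb, Fin.cons_succ,
      Fin.cons_zero]
    rw [pow_succ, mul_assoc]
    congr 1
    rw [Finset.mul_sum]
    refine Finset.sum_congr rfl fun T _ => ?_
    have hT : 0 ≤ ∑ i ∈ T, c i := Finset.sum_nonneg fun i _ => hc i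
    rw [prism_sum Q c hc, liftedSimplex_eq, prism_add _ _ _ _ le_rfl hT, zero_add,
      volume_prism _ _ hT, volume_prism _ _ hT]
    simp only [hu, hv, hD]
    ring
  have hR : ∀ i, mixedVol n (Function.update Q i D)
      = (-1 : ℝ) ^ n * ∑ T : Finset (Fin n),
          (if i ∈ T then (-1 : ℝ) ^ T.card * (u T - v T) else 0) := by
    intro i
    rw [mixedVol_eq n (Fin.pos i)]
    congr 1
    rw [← sub_eq_zero, ← neg_eq_zero, ← Finset.sum_sub_distrib, ← Finset.sum_neg_distrib]
    refine Eq.trans ?_ key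
    rw [sum_split _ i, sum_split (fun T => (-1 : ℝ) ^ T.card * (u T - v T)) i]
    refine Finset.sum_congr rfl fun U hU => ?_
    have hiU : i ∉ U := fun h => by
      have := Finset.mem_powerset.1 hU h
      simp at this
    have h1 : ∑ k ∈ U, Function.update Q i D k = ∑ k ∈ U, Q k :=
      Finset.sum_congr rfl fun k hk => by
        rw [Function.update_of_ne (ne_of_mem_of_not_mem hk hiU)]
    rw [Finset.sum_insert hiU, h1, Function.update_self, Finset.card_insert_of_notMem hiU]
    simp only [hiU, if_false, Finset.mem_insert_self, if_true, hu, hv]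
    ring
  rw [hL]
  simp_rw [hR]
  rw [Finset.mul_sum]
  simp_rw [Finset.mul_sum, mul_left_comm (c _) _ _]
  rw [Finset.sum_comm]
  refine Finset.sum_congr rfl fun T _ => ?_
  rw [← Finset.mul_sum, Finset.sum_mul]
  congr 1
  simp [Finset.sum_ite_mem]
end

section
/- Mixed volume is monotone: if P_i ⊆ Q_i are convex polytopes in R^n for i = 1,...,n, then MV(P_1,...,P_n) ≤ MV(Q_1,...,Q_n). -/
open Pointwise MeasureTheory

namespace MVaux
variable {n : ℕ}

noncomputable def wt (c : (Fin n → ℝ) → ℝ) (x a : Fin n → ℝ) : ℝ := c a * Real.exp (a ⬝ᵥ x)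
noncomputable def Z (F : Finset (Fin n → ℝ)) (c : (Fin n → ℝ) → ℝ) (x : Fin n → ℝ) : ℝ :=
  ∑ a ∈ F, wt c x a
noncomputable def gr (F : Finset (Fin n → ℝ)) (c : (Fin n → ℝ) → ℝ) (x : Fin n → ℝ) : Fin n → ℝ :=
  fun j => (∑ a ∈ F, wt c x a * a j) / Z F c x
noncomputable def hs (F : Finset (Fin n → ℝ)) (c : (Fin n → ℝ) → ℝ) (x : Fin n → ℝ) :
    Matrix (Fin n) (Fin n) ℝ :=
  ∑ a ∈ F, (wt c x a / Z F c x) • Matrix.vecMulVec (a - gr F c x) (a - gr F c x)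

/-- Admissible weights. -/
def Adm (F : Finset (Fin n → ℝ)) (c : (Fin n → ℝ) → ℝ) : Prop :=
  (∀ a ∈ F, 0 ≤ c a) ∧ ∃ a ∈ F, 0 < c a

/-- hull of the support -/
def body (F : Finset (Fin n → ℝ)) (c : (Fin n → ℝ) → ℝ) : Set (Fin n → ℝ) :=
  convexHull ℝ {a | a ∈ F ∧ 0 < c a}

/-- The linear functional. -/
noncomputable def dotL (a : Fin n → ℝ) : (Fin n → ℝ) →L[ℝ] ℝ :=
  LinearMap.toContinuousLinearMap
    { toFun := fun x => a ⬝ᵥ x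
      map_add' := fun x y => dotProduct_add a x y
      map_smul' := fun r x => by simp [dotProduct_smul] }

@[simp] lemma dotL_apply (a x : Fin n → ℝ) : dotL a x = a ⬝ᵥ x := rfl

variable {F : Finset (Fin n → ℝ)} {c : (Fin n → ℝ) → ℝ}

lemma wt_nonneg (h : Adm F c) (x : Fin n → ℝ) {a : Fin n → ℝ} (ha : a ∈ F) : 0 ≤ wt c x a :=
  mul_nonneg (h.1 a ha) (Real.exp_pos _).le

lemma Z_pos (h : Adm F c) (x : Fin n → ℝ) : 0 < Z F c x := by
  obtain ⟨a, ha, hc⟩ := h.2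
  exact Finset.sum_pos' (fun a ha => wt_nonneg h x ha) ⟨a, ha, mul_pos hc (Real.exp_pos _)⟩

lemma hasFDerivAt_wt (c : (Fin n → ℝ) → ℝ) (x a : Fin n → ℝ) :
    HasFDerivAt (fun x => wt c x a) (wt c x a • dotL a) x := by
  have h : HasFDerivAt (fun x => a ⬝ᵥ x) (dotL a) x := (dotL a).hasFDerivAt
  have := (h.exp).const_mul (c a)
  simpa [wt, smul_smul] using this

lemma hasFDerivAt_Z (x : Fin n → ℝ) :
    HasFDerivAt (fun x => Z F c x) (∑ a ∈ F, wt c x a • dotL a) x := by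
  unfold Z
  exact HasFDerivAt.fun_sum fun a _ => hasFDerivAt_wt c x a

lemma gr_dot (x v : Fin n → ℝ) : gr F c x ⬝ᵥ v = (∑ a ∈ F, wt c x a * (a ⬝ᵥ v)) / Z F c x := by
  simp only [gr, dotProduct, Finset.sum_div, Finset.mul_sum, Finset.sum_mul]
  rw [Finset.sum_comm]
  refine Finset.sum_congr rfl fun a _ => Finset.sum_congr rfl fun i _ => by ring

lemma hasFDerivAt_log (h : Adm F c) (x : Fin n → ℝ) :
    HasFDerivAt (fun x => Real.log (Z F c x)) (dotL (gr F c x)) x := by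
  have := (hasFDerivAt_Z (F := F) (c := c) x).log (Z_pos h x).ne'
  refine this.congr_fderiv ?_
  ext1 v
  simp only [dotL_apply, gr_dot]
  simp [div_eq_inv_mul]

lemma hs_mulVec (x v : Fin n → ℝ) (j : Fin n) :
    (hs F c x).mulVec v j =
      ∑ a ∈ F, wt c x a / Z F c x * ((a j - gr F c x j) * ((a ⬝ᵥ v) - gr F c x ⬝ᵥ v)) := by
  simp only [hs, Matrix.sum_mulVec, Finset.sum_apply, Matrix.smul_mulVec, Matrix.vecMulVec_mulVec]
  refine Finset.sum_congr rfl fun a _ => ?_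
  simp [sub_dotProduct]

lemma hasFDerivAt_gr (h : Adm F c) (x : Fin n → ℝ) :
    HasFDerivAt (gr F c) (LinearMap.toContinuousLinearMap (Matrix.toLin' (hs F c x))) x := by
  rw [hasFDerivAt_pi']
  intro j
  have hZ := (Z_pos h x).ne'
  have h1 : HasFDerivAt (fun x => ∑ a ∈ F, wt c x a * a j)
      (∑ a ∈ F, a j • (wt c x a • dotL a)) x :=
    HasFDerivAt.fun_sum fun a _ => (hasFDerivAt_wt c x a).mul_const (a j)
  have h2 : HasFDerivAt (fun x => (Z F c x)⁻¹)
      ((-(Z F c x ^ 2)⁻¹) • ∑ a ∈ F, wt c x a • dotL a) x :=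
    (hasDerivAt_inv hZ).comp_hasFDerivAt x (hasFDerivAt_Z (F := F) (c := c) x)
  have := h1.mul h2
  refine this.congr_fderiv ?_
  ext1 v
  have e : (ContinuousLinearMap.proj (R := ℝ) (φ := fun _ : Fin n => ℝ) j ∘SL
      LinearMap.toContinuousLinearMap (Matrix.toLin' (hs F c x))) v = (hs F c x).mulVec v j := rfl
  rw [e, hs_mulVec]
  have e2 : ∀ a ∈ F, wt c x a / Z F c x * ((a j - gr F c x j) * ((a ⬝ᵥ v) - gr F c x ⬝ᵥ v)) =
    (wt c x a * a j * (a ⬝ᵥ v)) * (Z F c x)⁻¹ - (wt c x a * a j) * ((gr F c x ⬝ᵥ v) * (Z F c x)⁻¹)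
     - (wt c x a * (a ⬝ᵥ v)) * (gr F c x j * (Z F c x)⁻¹)
      + wt c x a * (gr F c x j * (gr F c x ⬝ᵥ v) * (Z F c x)⁻¹) := fun a _ => by
    rw [div_eq_mul_inv]; ring
  rw [Finset.sum_congr rfl e2]
  simp only [Finset.sum_add_distrib, Finset.sum_sub_distrib, ← Finset.sum_mul]
  rw [gr_dot, gr]
  have hz : ∑ a ∈ F, wt c x a = Z F c x := rfl
  rw [hz]
  have s1 : (∑ a ∈ F, a j • (wt c x a • dotL a)) v = ∑ a ∈ F, wt c x a * a j * (a ⬝ᵥ v) := by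
    simp only [_root_.sum_apply, _root_.smul_apply, dotL_apply, smul_eq_mul]
    exact Finset.sum_congr rfl fun a _ => by ring
  have s2 : (∑ a ∈ F, (wt c x a • dotL a)) v = ∑ a ∈ F, wt c x a * (a ⬝ᵥ v) := by
    simp only [_root_.sum_apply, _root_.smul_apply, dotL_apply, smul_eq_mul]
  simp only [_root_.add_apply, _root_.smul_apply, s1, s2, smul_eq_mul]
  field_simp
  ring

lemma gr_mem (h : Adm F c) (x : Fin n → ℝ) : gr F c x ∈ body F c := by
  have hZ := Z_pos h x
  have key : gr F c x = ∑ a ∈ F.filter (fun a => 0 < c a), (wt c x a / Z F c x) • a := by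
    rw [Finset.sum_filter_of_ne]
    · ext j
      simp [gr, Finset.sum_div, Finset.sum_apply]
      exact Finset.sum_congr rfl fun a _ => by ring
    · intro a ha hne
      refine lt_of_le_of_ne (h.1 a ha) fun h0 => hne ?_
      simp [wt, ← h0]
  rw [key]
  refine (convex_convexHull ℝ _).sum_mem ?_ ?_ ?_
  · intro a ha
    exact div_nonneg (wt_nonneg h x (Finset.mem_filter.1 ha).1) hZ.le
  · rw [Finset.sum_filter_of_ne, ← Finset.sum_div]
    · exact div_self hZ.ne'
    · intro a ha hne
      refine lt_of_le_of_ne (h.1 a ha) fun h0 => hne ?_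
      simp [wt, ← h0]
  · intro a ha
    exact subset_convexHull ℝ _ (by simpa using ha)

lemma log_ge (h : Adm F c) : ∃ C : ℝ, ∀ a ∈ body F c, ∀ x, a ⬝ᵥ x - C ≤ Real.log (Z F c x) := by
  refine ⟨∑ a ∈ F, |Real.log (c a)|, fun a ha x => ?_⟩
  have hcv : Convex ℝ {a : Fin n → ℝ | a ⬝ᵥ x ≤ Real.log (Z F c x) + ∑ a ∈ F, |Real.log (c a)|} := by
    refine convex_halfSpace_le (f := fun a => a ⬝ᵥ x) ⟨fun a b => add_dotProduct a b x, fun r a => ?_⟩ _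
    simp
  have : a ∈ {a : Fin n → ℝ | a ⬝ᵥ x ≤ Real.log (Z F c x) + ∑ a ∈ F, |Real.log (c a)|} := by
    refine convexHull_min ?_ hcv ha
    rintro b ⟨hb, hc⟩
    have h1 : wt c x b ≤ Z F c x :=
      Finset.single_le_sum (f := fun a => wt c x a) (fun a ha => wt_nonneg h x ha) hb
    have h2 := Real.log_le_log (mul_pos hc (Real.exp_pos _)) h1
    rw [Real.log_mul hc.ne' (Real.exp_pos _).ne', Real.log_exp] at h2
    have h3 : |Real.log (c b)| ≤ ∑ a ∈ F, |Real.log (c a)| :=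
      Finset.single_le_sum (f := fun a => |Real.log (c a)|) (fun a ha => abs_nonneg _) hb
    have h4 := neg_abs_le (Real.log (c b))
    simp only [Set.mem_ofPred_eq]
    linarith
  simp only [Set.mem_ofPred_eq] at this
  linarith

lemma mono_aux (s t : ℝ) : 0 ≤ (s - t) * (Real.exp s - Real.exp t) := by
  rcases le_total s t with h | h
  · have := Real.exp_le_exp.2 h; nlinarith
  · have := Real.exp_le_exp.2 h; nlinarith

lemma gr_sub_dot (h : Adm F c) (y v : Fin n → ℝ) :
    (gr F c (y + v) ⬝ᵥ v - gr F c y ⬝ᵥ v) * (2 * Z F c (y + v) * Z F c y) =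
     ∑ a ∈ F, ∑ b ∈ F, wt c y a * wt c y b * (((a ⬝ᵥ v) - (b ⬝ᵥ v)) *
      (Real.exp (a ⬝ᵥ v) - Real.exp (b ⬝ᵥ v))) := by
  have h1 := (Z_pos h y).ne'
  have h2 := (Z_pos h (y + v)).ne'
  have hw : ∀ a, wt c (y + v) a = wt c y a * Real.exp (a ⬝ᵥ v) := fun a => by
    simp [wt, dotProduct_add, Real.exp_add]; ring
  have e : ∀ a ∈ F, ∀ b ∈ F, wt c y a * wt c y b * (((a ⬝ᵥ v) - (b ⬝ᵥ v)) *
      (Real.exp (a ⬝ᵥ v) - Real.exp (b ⬝ᵥ v))) =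
      (wt c (y+v) a * (a ⬝ᵥ v)) * wt c y b - (wt c y a * (a ⬝ᵥ v)) * wt c (y+v) b
      - wt c (y+v) a * (wt c y b * (b ⬝ᵥ v)) + wt c y a * (wt c (y+v) b * (b ⬝ᵥ v)) :=
    fun a _ b _ => by rw [hw, hw]; ring
  rw [Finset.sum_congr rfl fun a ha => Finset.sum_congr rfl fun b hb => e a ha b hb]
  simp only [Finset.sum_add_distrib, Finset.sum_sub_distrib, ← Finset.sum_mul, ← Finset.mul_sum]
  rw [gr_dot, gr_dot]
  have hz : ∀ x, ∑ a ∈ F, wt c x a = Z F c x := fun _ => rfl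
  simp only [hz]
  field_simp
  ring

lemma gr_mono (h : Adm F c) (y v : Fin n → ℝ) : 0 ≤ gr F c (y + v) ⬝ᵥ v - gr F c y ⬝ᵥ v := by
  have h1 := (Z_pos h y)
  have h2 := (Z_pos h (y + v))
  refine nonneg_of_mul_nonneg_left (b := 2 * Z F c (y + v) * Z F c y) ?_ (by positivity)
  rw [gr_sub_dot h]
  exact Finset.sum_nonneg fun a ha => Finset.sum_nonneg fun b hb =>
    mul_nonneg (mul_nonneg (wt_nonneg h y ha) (wt_nonneg h y hb)) (mono_aux _ _)

lemma gr_eq (h : Adm F c) (y v : Fin n → ℝ) (h0 : gr F c (y + v) ⬝ᵥ v - gr F c y ⬝ᵥ v = 0) :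
    ∃ d : ℝ, ∀ a ∈ F, 0 < c a → a ⬝ᵥ v = d := by
  have := gr_sub_dot h y v
  rw [h0, zero_mul] at this
  have nn : ∀ a ∈ F, ∀ b ∈ F, 0 ≤ wt c y a * wt c y b * (((a ⬝ᵥ v) - (b ⬝ᵥ v)) *
      (Real.exp (a ⬝ᵥ v) - Real.exp (b ⬝ᵥ v))) := fun a ha b hb =>
    mul_nonneg (mul_nonneg (wt_nonneg h y ha) (wt_nonneg h y hb)) (mono_aux _ _)
  obtain ⟨b, hb, hcb⟩ := h.2
  refine ⟨b ⬝ᵥ v, fun a ha hca => ?_⟩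
  have z1 := (Finset.sum_eq_zero_iff_of_nonneg (fun a ha => Finset.sum_nonneg (nn a ha))).1 this.symm a ha
  have z2 := (Finset.sum_eq_zero_iff_of_nonneg (nn a ha)).1 z1 b hb
  have p1 : wt c y a ≠ 0 := (mul_pos hca (Real.exp_pos _)).ne'
  have p2 : wt c y b ≠ 0 := (mul_pos hcb (Real.exp_pos _)).ne'
  simp only [mul_eq_zero, p1, p2, false_or, sub_eq_zero, Real.exp_eq_exp, or_self] at z2
  exact z2

lemma hs_posSemidef (h : Adm F c) (x : Fin n → ℝ) : (hs F c x).PosSemidef := by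
  refine Matrix.posSemidef_sum _ fun a ha => ?_
  refine Matrix.PosSemidef.smul ?_ (div_nonneg (wt_nonneg h x ha) (Z_pos h x).le)
  simpa using Matrix.posSemidef_vecMulVec_self_star (a - gr F c x)

lemma hs_mulVec_eq_zero (h : Adm F c) (x v : Fin n → ℝ) {d : ℝ}
    (hd : ∀ a ∈ F, 0 < c a → a ⬝ᵥ v = d) : (hs F c x).mulVec v = 0 := by
  have hZ := (Z_pos h x).ne'
  have h1 : ∀ a ∈ F, wt c x a * (a ⬝ᵥ v) = wt c x a * d := fun a ha => by
    rcases (h.1 a ha).eq_or_lt with h0 | h0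
    · simp [wt, ← h0]
    · rw [hd a ha h0]
  have h2 : gr F c x ⬝ᵥ v = d := by
    rw [gr_dot, Finset.sum_congr rfl h1, ← Finset.sum_mul]
    exact mul_div_cancel_left₀ _ hZ
  ext j
  rw [hs_mulVec, h2]
  refine Finset.sum_eq_zero fun a ha => ?_
  have := h1 a ha
  have : wt c x a * ((a ⬝ᵥ v) - d) = 0 := by rw [mul_sub, this, sub_self]
  calc _ = (wt c x a * ((a ⬝ᵥ v) - d)) * ((Z F c x)⁻¹ * (a j - gr F c x j)) := by
        rw [div_eq_mul_inv]; ring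
    _ = _ := by rw [this, zero_mul]

lemma continuous_wt (a : Fin n → ℝ) : Continuous (fun x => wt c x a) := by
  unfold wt dotProduct; fun_prop

lemma continuous_Z : Continuous (Z F c) := by
  unfold Z
  exact continuous_finsetSum _ fun a _ => continuous_wt a

lemma continuous_gr (h : Adm F c) : Continuous (gr F c) := by
  refine continuous_pi fun j => ?_
  exact (continuous_finsetSum _ fun a _ => (continuous_wt a).mul continuous_const).div
    continuous_Z fun x => (Z_pos h x).ne'

lemma continuous_hs (h : Adm F c) : Continuous (hs F c) := by
  unfold hs
  refine continuous_finsetSum _ fun a _ => ?_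
  refine ((continuous_wt a).div continuous_Z fun x => (Z_pos h x).ne').smul ?_
  have := continuous_gr h
  exact Continuous.matrix_vecMulVec (continuous_const.sub this) (continuous_const.sub this)

end MVaux

namespace MVaux
variable {n : ℕ}

lemma hyperplane_interior {K : Set (Fin n → ℝ)} {v : Fin n → ℝ} (hv : v ≠ 0) {d : ℝ}
    (hK : ∀ k ∈ K, k ⬝ᵥ v = d) : interior K = ∅ := by
  rw [Set.eq_empty_iff_forall_notMem]
  intro z hz
  have hc : Filter.Tendsto (fun t : ℝ => z + t • v) (nhdsWithin 0 (Set.Ioi 0)) (nhds z) := by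
    have : Continuous (fun t : ℝ => z + t • v) := by fun_prop
    have := this.tendsto 0
    simp only [zero_smul, add_zero] at this
    exact this.mono_left nhdsWithin_le_nhds
  have h1 := hc.eventually (mem_interior_iff_mem_nhds.1 hz)
  obtain ⟨t, ht, ht0⟩ := (h1.and self_mem_nhdsWithin).exists
  have e1 := hK _ ht
  have e2 := hK _ (interior_subset hz)
  rw [add_dotProduct, e2, smul_dotProduct, smul_eq_mul] at e1
  have : t * (v ⬝ᵥ v) = 0 := by linarith
  rcases mul_eq_zero.1 this with h | h
  · exact (ne_of_gt ht0) h
  · exact hv (dotProduct_self_eq_zero.1 h)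

lemma volume_eq_of_sandwich {K R : Set (Fin n → ℝ)} (hK : Convex ℝ K) (h1 : R ⊆ K)
    (h2 : interior K ⊆ R) : volume R = volume K := by
  refine le_antisymm (measure_mono h1) ?_
  calc volume K ≤ volume (interior K ∪ frontier K) :=
        measure_mono (by rw [← closure_eq_interior_union_frontier]; exact subset_closure)
    _ ≤ volume (interior K) + volume (frontier K) := measure_union_le _ _
    _ = volume (interior K) := by rw [hK.addHaar_frontier volume, add_zero]
    _ ≤ volume R := measure_mono h2

lemma body_convex (F : Finset (Fin n → ℝ)) (c : (Fin n → ℝ) → ℝ) : Convex ℝ (body F c) :=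
  convex_convexHull ℝ _

lemma body_compact (F : Finset (Fin n → ℝ)) (c : (Fin n → ℝ) → ℝ) : IsCompact (body F c) :=
  Set.Finite.isCompact_convexHull ℝ
    (F.finite_toSet.subset (t := {a | a ∈ F ∧ 0 < c a}) fun _ h => h.1)

lemma compact_sum {ι : Type*} (S : Finset ι) (P : ι → Set (Fin n → ℝ)) (h : ∀ i, IsCompact (P i)) :
    IsCompact (∑ i ∈ S, P i) := by
  classical
  induction S using Finset.induction_on with
  | empty => simp
  | insert i S hi ih => rw [Finset.sum_insert hi]; exact (h i).add ih

variable {F : Fin n → Finset (Fin n → ℝ)} {c : Fin n → (Fin n → ℝ) → ℝ}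

lemma interior_subset_range (h : ∀ i, Adm (F i) (c i)) (S : Finset (Fin n)) :
    interior (∑ i ∈ S, body (F i) (c i)) ⊆
      (fun x => ∑ i ∈ S, gr (F i) (c i) x) '' Set.univ := by
  intro p hp
  choose C hC using fun i => log_ge (h i)
  have hG : ∀ k ∈ ∑ i ∈ S, body (F i) (c i), ∀ x,
      k ⬝ᵥ x - ∑ i ∈ S, C i ≤ ∑ i ∈ S, Real.log (Z (F i) (c i) x) := by
    intro k hk x
    obtain ⟨g, hg, rfl⟩ := (Set.mem_finsetSum _ _ _).1 hk
    rw [sum_dotProduct, ← Finset.sum_sub_distrib]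
    exact Finset.sum_le_sum fun i hi => hC i _ (hg hi) x
  obtain ⟨r, hr, hball⟩ := Metric.nhds_basis_closedBall.mem_iff.1 (mem_interior_iff_mem_nhds.1 hp)
  set G : (Fin n → ℝ) → ℝ := fun x => ∑ i ∈ S, Real.log (Z (F i) (c i) x) - p ⬝ᵥ x with hGdef
  have hd : ∀ x, HasFDerivAt G (∑ i ∈ S, dotL (gr (F i) (c i) x) - dotL p) x := fun x =>
    (HasFDerivAt.fun_sum fun i _ => hasFDerivAt_log (h i) x).sub (dotL p).hasFDerivAt
  have hcont : Continuous G := continuous_iff_continuousAt.2 fun x => (hd x).continuousAt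
  have hlow : ∀ x, r * ‖x‖ - ∑ i ∈ S, C i ≤ G x := by
    intro x
    suffices hs : ‖x‖ ≤ (G x + ∑ i ∈ S, C i) / r by
      rw [le_div_iff₀ hr] at hs; linarith
    have hcoord : ∀ s : ℝ, |s| ≤ r → ∀ j, s * x j ≤ G x + ∑ i ∈ S, C i := by
      intro s hs j
      have hm : p + Pi.single j s ∈ Metric.closedBall p r := by
        simp [Metric.mem_closedBall, dist_eq_norm, Pi.norm_single, hs]
      have := hG _ (hball hm) x
      rw [add_dotProduct, single_dotProduct] at this
      simp only [hGdef]; linarith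
    have hz : 0 ≤ (G x + ∑ i ∈ S, C i) / r := by
      have := hG p (interior_subset hp) x
      refine div_nonneg ?_ hr.le
      simp only [hGdef]; linarith
    rw [pi_norm_le_iff_of_nonneg hz]
    intro j
    rw [Real.norm_eq_abs, le_div_iff₀ hr]
    rcases abs_cases (x j) with ⟨e, _⟩ | ⟨e, _⟩
    · have := hcoord r (abs_of_pos hr).le j; rw [e]; linarith
    · have := hcoord (-r) (by rw [abs_neg, abs_of_pos hr]) j; rw [e]; linarith
  have hcoer : Filter.Tendsto G (Filter.cocompact _) Filter.atTop := by
    refine Filter.tendsto_atTop_mono hlow ?_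
    exact Filter.tendsto_atTop_add_const_right _ _
      ((tendsto_norm_cocompact_atTop).const_mul_atTop hr)
  obtain ⟨x, hx⟩ := hcont.exists_forall_le hcoer
  have hz := IsLocalMin.hasFDerivAt_eq_zero (Filter.Eventually.of_forall hx) (hd x)
  refine ⟨x, trivial, ?_⟩
  refine dotProduct_eq _ _ fun v => ?_
  have := congrArg (fun L => L v) hz
  simp only [_root_.sub_apply, _root_.sum_apply, dotL_apply,
    _root_.zero_apply] at this
  rw [sum_dotProduct]; linarith

lemma body_const {F : Finset (Fin n → ℝ)} {c : (Fin n → ℝ) → ℝ} {v : Fin n → ℝ} {d : ℝ}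
    (hd : ∀ a ∈ F, 0 < c a → a ⬝ᵥ v = d) : ∀ k ∈ body F c, k ⬝ᵥ v = d := by
  intro k hk
  have hcv : Convex ℝ {a : Fin n → ℝ | a ⬝ᵥ v = d} := by
    refine convex_hyperplane (f := fun a => a ⬝ᵥ v) ⟨fun a b => add_dotProduct a b v, fun r a => ?_⟩ _
    simp
  exact convexHull_min (fun a ha => hd a ha.1 ha.2) hcv hk

lemma lintegral_det (h : ∀ i, Adm (F i) (c i)) (S : Finset (Fin n)) :
    ∫⁻ x, ENNReal.ofReal (∑ i ∈ S, hs (F i) (c i) x).det =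
      volume (∑ i ∈ S, body (F i) (c i)) := by
  have hconv : Convex ℝ (∑ i ∈ S, body (F i) (c i)) := convex_sum _ fun i _ => body_convex _ _
  by_cases hv : ∃ v : Fin n → ℝ, v ≠ 0 ∧ ∀ i ∈ S, ∃ d : ℝ, ∀ a ∈ F i, 0 < c i a → a ⬝ᵥ v = d
  · obtain ⟨v, hv, hd⟩ := hv
    choose! d hd using hd
    have h0 : ∀ x, (∑ i ∈ S, hs (F i) (c i) x).det = 0 := fun x => by
      refine Matrix.exists_mulVec_eq_zero_iff.1 ⟨v, hv, ?_⟩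
      rw [Matrix.sum_mulVec]
      exact Finset.sum_eq_zero fun i hi => hs_mulVec_eq_zero (h i) x v (hd i hi)
    have hint : interior (∑ i ∈ S, body (F i) (c i)) = ∅ := by
      refine hyperplane_interior hv (d := ∑ i ∈ S, d i) fun k hk => ?_
      obtain ⟨g, hg, rfl⟩ := (Set.mem_finsetSum _ _ _).1 hk
      rw [sum_dotProduct]
      exact Finset.sum_congr rfl fun i hi => body_const (hd i hi) _ (hg hi)
    rw [← volume_eq_of_sandwich hconv (Set.empty_subset _) hint.le]
    simp [h0]
  · have hinj : Set.InjOn (fun x => ∑ i ∈ S, gr (F i) (c i) x) Set.univ := by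
      intro x _ y _ hxy
      by_contra hne
      refine hv ⟨x - y, sub_ne_zero.2 hne, fun i hi => gr_eq (h i) y (x - y) ?_⟩
      have hs : ∑ i ∈ S, (gr (F i) (c i) (y + (x - y)) ⬝ᵥ (x - y) - gr (F i) (c i) y ⬝ᵥ (x - y)) = 0 := by
        rw [Finset.sum_sub_distrib, ← sum_dotProduct, ← sum_dotProduct, add_sub_cancel]
        simp only at hxy
        rw [hxy, sub_self]
      exact (Finset.sum_eq_zero_iff_of_nonneg fun i _ => gr_mono (h i) y (x - y)).1 hs i hi
    have hder : ∀ x ∈ Set.univ, HasFDerivWithinAt (fun x => ∑ i ∈ S, gr (F i) (c i) x)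
        (LinearMap.toContinuousLinearMap (Matrix.toLin' (∑ i ∈ S, hs (F i) (c i) x))) Set.univ x := by
      intro x _
      rw [map_sum, map_sum]
      exact (HasFDerivAt.fun_sum fun i _ => hasFDerivAt_gr (h i) x).hasFDerivWithinAt
    have key := lintegral_abs_det_fderiv_eq_addHaar_image volume MeasurableSet.univ hder hinj
    rw [volume_eq_of_sandwich hconv ?_ (interior_subset_range h S)] at key
    · rw [← key, setLIntegral_univ]
      refine lintegral_congr fun x => ?_
      rw [ContinuousLinearMap.det, LinearMap.coe_toContinuousLinearMap, LinearMap.det_toLin',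
        abs_of_nonneg]
      exact (Matrix.posSemidef_sum _ fun i _ => hs_posSemidef (h i) x).det_nonneg
    · rintro _ ⟨x, -, rfl⟩
      exact Set.finsetSum_mem_finsetSum _ _ _ fun i _ => gr_mem (h i) x

/-- Mixed discriminant. -/
noncomputable def mdisc (n : ℕ) :
    MultilinearMap ℝ (fun _ : Fin n => Matrix (Fin n) (Fin n) ℝ) ℝ :=
  ∑ σ : Equiv.Perm (Fin n), MultilinearMap.domDomCongr σ
    ((Matrix.detRowAlternating (n := Fin n) (R := ℝ)).toMultilinearMap.compLinearMap
      (fun j => (LinearMap.proj j : (Fin n → Fin n → ℝ) →ₗ[ℝ] (Fin n → ℝ)) ∘ₗ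
        (Matrix.ofLinearEquiv ℝ).symm.toLinearMap))

lemma mdisc_apply (A : Fin n → Matrix (Fin n) (Fin n) ℝ) :
    mdisc n A = ∑ σ : Equiv.Perm (Fin n), (Matrix.of fun j k => A (σ j) j k).det := by
  simp only [mdisc, _root_.sum_apply, MultilinearMap.domDomCongr_apply]
  rfl

lemma mdisc_rank_one (w : Fin n → Fin n → ℝ) :
    mdisc n (fun i => Matrix.vecMulVec (w i) (w i)) = (Matrix.of w).det ^ 2 := by
  rw [mdisc_apply, sq]
  conv_rhs => enter [1]; rw [Matrix.det_apply']
  rw [Finset.sum_mul]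
  refine Finset.sum_congr rfl fun σ _ => ?_
  have : (Matrix.of fun j k => Matrix.vecMulVec (w (σ j)) (w (σ j)) j k) =
      Matrix.of fun j k => w (σ j) j * ((Matrix.of w).submatrix σ id) j k := by
    ext j k; simp [Matrix.vecMulVec_apply]
  rw [this, Matrix.det_mul_column, Matrix.det_permute]
  simp; ring

lemma mdisc_hs_nonneg (h : ∀ i, Adm (F i) (c i)) (x : Fin n → ℝ) :
    0 ≤ mdisc n (fun i => hs (F i) (c i) x) := by
  unfold hs
  rw [MultilinearMap.map_sum_finset]
  refine Finset.sum_nonneg fun b hb => ?_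
  rw [MultilinearMap.map_smul_univ, mdisc_rank_one, smul_eq_mul]
  refine mul_nonneg (Finset.prod_nonneg fun i _ => ?_) (sq_nonneg _)
  exact div_nonneg (wt_nonneg (h i) x (Fintype.mem_piFinset.1 hb i)) (Z_pos (h i) x).le

lemma alt_sum (R : Finset (Fin n)) :
    ∑ S ∈ (Finset.univ : Finset (Finset (Fin n))), (if R ⊆ S then (-1 : ℝ) ^ (n - S.card) else 0) =
      if R = Finset.univ then 1 else 0 := by
  rw [← Finset.sum_filter]
  have h1 : ∑ S ∈ (Finset.univ : Finset (Finset (Fin n))).filter (R ⊆ ·), (-1 : ℝ) ^ (n - S.card) =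
      ∑ T ∈ Rᶜ.powerset, (-1 : ℝ) ^ T.card := by
    refine Finset.sum_bij' (fun S _ => Sᶜ) (fun T _ => Tᶜ) ?_ ?_ ?_ ?_ ?_
    · intro S hS
      simp only [Finset.mem_filter, Finset.mem_univ, true_and] at hS
      simpa using hS
    · intro T hT
      simp only [Finset.mem_filter, Finset.mem_univ, true_and]
      rw [Finset.mem_powerset] at hT
      exact Finset.subset_compl_comm.1 hT
    · simp
    · simp
    · intro S _
      rw [Finset.card_compl, Fintype.card_fin]
  rw [h1]
  have h2 := Finset.sum_powerset_neg_one_pow_card (x := Rᶜ)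
  have h3 := congrArg (Int.cast : ℤ → ℝ) h2
  push_cast at h3
  rw [h3]
  simp [Finset.compl_eq_empty_iff]

lemma mdisc_eq_alt (A : Fin n → Matrix (Fin n) (Fin n) ℝ) :
    ∑ S : Finset (Fin n), (-1 : ℝ) ^ (n - S.card) * (∑ i ∈ S, A i).det = mdisc n A := by
  have h1 : ∀ S : Finset (Fin n), (∑ i ∈ S, A i).det =
      ∑ f : Fin n → Fin n, if Finset.univ.image f ⊆ S then
        (Matrix.of fun j k => A (f j) j k).det else 0 := by
    intro S
    have e1 : (∑ i ∈ S, A i).det =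
        (Matrix.detRowAlternating (n := Fin n) (R := ℝ)).toMultilinearMap
          (fun j => ∑ i ∈ S, (fun k => A i j k)) := by
      change Matrix.det _ = Matrix.det _
      congr 1
      ext j k
      simp [Matrix.sum_apply, Finset.sum_apply]
    rw [e1, MultilinearMap.map_sum_finset, ← Finset.sum_filter]
    refine Finset.sum_congr ?_ fun f _ => rfl
    ext f
    simp [Fintype.mem_piFinset, Finset.image_subset_iff]
  simp only [h1, Finset.mul_sum]
  rw [Finset.sum_comm]
  have h2 : ∀ f : Fin n → Fin n, (∑ S : Finset (Fin n), (-1 : ℝ) ^ (n - S.card) *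
      (if Finset.univ.image f ⊆ S then (Matrix.of fun j k => A (f j) j k).det else 0)) =
      if Function.Bijective f then (Matrix.of fun j k => A (f j) j k).det else 0 := by
    intro f
    have : ∀ S : Finset (Fin n), (-1 : ℝ) ^ (n - S.card) *
      (if Finset.univ.image f ⊆ S then (Matrix.of fun j k => A (f j) j k).det else 0) =
      (if Finset.univ.image f ⊆ S then (-1 : ℝ) ^ (n - S.card) else 0) *
        (Matrix.of fun j k => A (f j) j k).det := fun S => by split_ifs <;> simp
    simp only [this]
    rw [← Finset.sum_mul, alt_sum]
    have : Finset.univ.image f = Finset.univ ↔ Function.Bijective f := by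
      rw [← Finite.surjective_iff_bijective, Finset.eq_univ_iff_forall]
      simp [Function.Surjective]
    simp only [this]
    split_ifs <;> simp
  simp only [h2]
  rw [← Finset.sum_filter, mdisc_apply]
  symm
  refine Finset.sum_bij (fun σ _ => (σ : Fin n → Fin n)) ?_ ?_ ?_ ?_
  · intro σ _; exact Finset.mem_filter.2 ⟨Finset.mem_univ _, σ.bijective⟩
  · intro σ _ τ _ e; exact DFunLike.coe_injective e
  · intro f hf
    exact ⟨Equiv.ofBijective f (Finset.mem_filter.1 hf).2, Finset.mem_univ _, rfl⟩
  · intro σ _; rfl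

end MVaux

namespace MVaux
variable {n : ℕ}
variable {F : Fin n → Finset (Fin n → ℝ)} {c : Fin n → (Fin n → ℝ) → ℝ}

lemma continuous_mdisc (h : ∀ i, Adm (F i) (c i)) :
    Continuous fun x => mdisc n (fun i => hs (F i) (c i) x) := by
  simp only [mdisc_apply]
  refine continuous_finsetSum _ fun σ _ => Continuous.matrix_det ?_
  refine continuous_matrix fun j k => ?_
  exact (continuous_hs (h (σ j))).matrix_elem j k

lemma mixedVol_eq (hn : n ≠ 0) (h : ∀ i, Adm (F i) (c i)) :
    (0 ≤ mixedVol n fun i => body (F i) (c i)) ∧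
    ENNReal.ofReal (mixedVol n fun i => body (F i) (c i)) =
      ∫⁻ x, ENNReal.ofReal (mdisc n (fun i => hs (F i) (c i) x)) := by
  have hnn : ∀ (S : Finset (Fin n)) x, 0 ≤ (∑ i ∈ S, hs (F i) (c i) x).det := fun S x =>
    (Matrix.posSemidef_sum _ fun i _ => hs_posSemidef (h i) x).det_nonneg
  have hct : ∀ S : Finset (Fin n), Continuous fun x => (∑ i ∈ S, hs (F i) (c i) x).det := fun S =>
    Continuous.matrix_det (continuous_finsetSum _ fun i _ => continuous_hs (h i))
  have hfin : ∀ S : Finset (Fin n), volume (∑ i ∈ S, body (F i) (c i)) ≠ ⊤ := fun S =>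
    (compact_sum S _ fun i => body_compact _ _).measure_lt_top.ne
  have hint : ∀ S : Finset (Fin n), Integrable fun x => (∑ i ∈ S, hs (F i) (c i) x).det := by
    intro S
    refine ⟨(hct S).aestronglyMeasurable, ?_⟩
    rw [hasFiniteIntegral_iff_ofReal (Filter.Eventually.of_forall (hnn S)), lintegral_det h]
    exact (hfin S).lt_top
  have hval : ∀ S : Finset (Fin n), ∫ x, (∑ i ∈ S, hs (F i) (c i) x).det =
      (volume (∑ i ∈ S, body (F i) (c i))).toReal := by
    intro S
    rw [integral_eq_lintegral_of_nonneg_ae (Filter.Eventually.of_forall (hnn S))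
      (hct S).aestronglyMeasurable, lintegral_det h]
  have hmv : mixedVol n (fun i => body (F i) (c i)) = ∫ x, mdisc n (fun i => hs (F i) (c i) x) := by
    simp only [← mdisc_eq_alt]
    rw [integral_finsetSum _ fun S _ => (hint S).const_mul _]
    simp only [integral_const_mul, hval]
    rw [mixedVol, Finset.sum_filter_of_ne, Finset.powerset_univ]
    intro S _ hne
    rw [Finset.nonempty_iff_ne_empty]
    rintro rfl
    apply hne
    have : Nonempty (Fin n) := ⟨⟨0, Nat.pos_of_ne_zero hn⟩⟩
    rw [Finset.sum_empty, ← Set.singleton_zero, measure_singleton]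
    simp
  have hI : Integrable fun x => mdisc n (fun i => hs (F i) (c i) x) := by
    simp only [← mdisc_eq_alt]
    exact integrable_finsetSum _ fun S _ => (hint S).const_mul _
  refine ⟨by rw [hmv]; exact integral_nonneg (mdisc_hs_nonneg h), ?_⟩
  rw [hmv, ofReal_integral_eq_lintegral_ofReal hI
    (Filter.Eventually.of_forall (mdisc_hs_nonneg h))]

lemma tendsto_hs {F : Finset (Fin n → ℝ)} {c : ℕ → (Fin n → ℝ) → ℝ} {c0 : (Fin n → ℝ) → ℝ}
    (h : Adm F c0) (hc : ∀ a ∈ F, Filter.Tendsto (fun k => c k a) Filter.atTop (nhds (c0 a)))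
    (x : Fin n → ℝ) : Filter.Tendsto (fun k => hs F (c k) x) Filter.atTop (nhds (hs F c0 x)) := by
  have hw : ∀ a ∈ F, Filter.Tendsto (fun k => wt (c k) x a) Filter.atTop (nhds (wt c0 x a)) :=
    fun a ha => (hc a ha).mul_const _
  have hZ : Filter.Tendsto (fun k => Z F (c k) x) Filter.atTop (nhds (Z F c0 x)) :=
    tendsto_finsetSum _ hw
  have hZ0 := (Z_pos h x).ne'
  have hg : Filter.Tendsto (fun k => gr F (c k) x) Filter.atTop (nhds (gr F c0 x)) := by
    rw [tendsto_pi_nhds]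
    intro j
    exact (tendsto_finsetSum _ fun a ha => (hw a ha).mul_const _).div hZ hZ0
  refine tendsto_finsetSum _ fun a ha => ((hw a ha).div hZ hZ0).smul ?_
  have hv : Continuous fun g : Fin n → ℝ => Matrix.vecMulVec (a - g) (a - g) :=
    Continuous.matrix_vecMulVec (continuous_const.sub continuous_id)
      (continuous_const.sub continuous_id)
  exact (hv.tendsto _).comp hg

lemma tendsto_mdisc {c : ℕ → Fin n → (Fin n → ℝ) → ℝ} {c0 : Fin n → (Fin n → ℝ) → ℝ}
    (h : ∀ i, Adm (F i) (c0 i))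
    (hc : ∀ i, ∀ a ∈ F i, Filter.Tendsto (fun k => c k i a) Filter.atTop (nhds (c0 i a)))
    (x : Fin n → ℝ) :
    Filter.Tendsto (fun k => mdisc n (fun i => hs (F i) (c k i) x)) Filter.atTop
      (nhds (mdisc n (fun i => hs (F i) (c0 i) x))) := by
  have hm : Continuous fun A : Fin n → Matrix (Fin n) (Fin n) ℝ => mdisc n A := by
    simp only [mdisc_apply]
    refine continuous_finsetSum _ fun σ _ => Continuous.matrix_det ?_
    refine continuous_matrix fun j k => ?_
    exact Continuous.matrix_elem (A := fun a : Fin n → Matrix (Fin n) (Fin n) ℝ => a (σ j))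
      (continuous_apply (σ j)) j k
  exact (hm.tendsto _).comp (tendsto_pi_nhds.2 fun i => tendsto_hs (h i) (hc i) x)

end MVaux

open MVaux

/-- **Monotonicity of the mixed volume**: if `Pᵢ ⊆ Qᵢ` for all `i`, then
`MV(P₁,…,Pₙ) ≤ MV(Q₁,…,Qₙ)`. -/
theorem mixedVol_mono (n : ℕ) (P Q : Fin n → Set (Fin n → ℝ))
    (hP : ∀ i, IsPolytope (P i)) (hQ : ∀ i, IsPolytope (Q i))
    (hsub : ∀ i, P i ⊆ Q i) :
    mixedVol n P ≤ mixedVol n Q := by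
  classical
  rcases eq_or_ne n 0 with rfl | hn
  · have : P = Q := Subsingleton.elim _ _
    rw [this]
  choose FP hFP hPe using hP
  choose FQ hFQ hQe using hQ
  set F : Fin n → Finset (Fin n → ℝ) := fun i => FP i ∪ FQ i with hF
  set c0 : Fin n → (Fin n → ℝ) → ℝ := fun i a => if a ∈ FP i then 1 else 0 with hc0
  set c : ℕ → Fin n → (Fin n → ℝ) → ℝ :=
    fun k i a => if a ∈ FP i then 1 else 1 / ((k : ℝ) + 1) with hc
  have hcpos : ∀ k i a, 0 < c k i a := fun k i a => by
    simp only [hc]; split_ifs <;> positivity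
  have h0 : ∀ i, Adm (F i) (c0 i) := fun i => by
    refine ⟨fun a _ => ?_, ?_⟩
    · simp only [hc0]; split_ifs <;> norm_num
    · obtain ⟨a, ha⟩ := hFP i
      exact ⟨a, Finset.mem_union_left _ ha, by simp [hc0, ha]⟩
  have hk : ∀ k i, Adm (F i) (c k i) := fun k i => by
    refine ⟨fun a _ => (hcpos k i a).le, ?_⟩
    obtain ⟨a, ha⟩ := hFP i
    exact ⟨a, Finset.mem_union_left _ ha, hcpos k i a⟩
  have eP : P = fun i => body (F i) (c0 i) := by
    funext i
    rw [hPe i, body]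
    congr 1
    ext a
    by_cases ha : a ∈ FP i <;> simp [hc0, hF, ha]
  have eQ : ∀ k, Q = fun i => body (F i) (c k i) := by
    intro k
    funext i
    have e : {a | a ∈ F i ∧ 0 < c k i a} = (FP i : Set (Fin n → ℝ)) ∪ FQ i := by
      ext a
      simp [hcpos, hF]
    rw [body, e]
    refine le_antisymm ?_ ?_
    · rw [hQe i]
      exact convexHull_mono Set.subset_union_right
    · refine convexHull_min (Set.union_subset ?_ ?_) ?_
      · refine subset_trans ?_ (hsub i)
        rw [hPe i]; exact subset_convexHull ℝ _
      · rw [hQe i]; exact subset_convexHull ℝ _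
      · rw [hQe i]; exact convex_convexHull ℝ _
  have hlim : ∀ i, ∀ a ∈ F i, Filter.Tendsto (fun k => c k i a) Filter.atTop (nhds (c0 i a)) := by
    intro i a _
    by_cases ha : a ∈ FP i
    · simp [hc, hc0, ha]
    · simp only [hc, hc0, ha, if_false]
      exact tendsto_one_div_add_atTop_nhds_zero_nat
  have hle : ENNReal.ofReal (mixedVol n P) ≤ ENNReal.ofReal (mixedVol n Q) := by
    have e1 := (mixedVol_eq hn h0).2
    rw [← eP] at e1
    rw [e1]
    calc ∫⁻ x, ENNReal.ofReal (mdisc n (fun i => hs (F i) (c0 i) x))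
        = ∫⁻ x, Filter.liminf (fun k => ENNReal.ofReal (mdisc n (fun i => hs (F i) (c k i) x)))
            Filter.atTop := by
          refine lintegral_congr fun x => ?_
          exact ((ENNReal.continuous_ofReal.tendsto _).comp
            (tendsto_mdisc h0 hlim x)).liminf_eq.symm
      _ ≤ Filter.liminf (fun k => ∫⁻ x, ENNReal.ofReal (mdisc n (fun i => hs (F i) (c k i) x)))
            Filter.atTop :=
          lintegral_liminf_le fun k => (continuous_mdisc (hk k)).measurable.ennreal_ofReal
      _ = Filter.liminf (fun _ : ℕ => ENNReal.ofReal (mixedVol n Q)) Filter.atTop := by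
          congr 1
          funext k
          rw [← (mixedVol_eq hn (hk k)).2, ← eQ k]
      _ = _ := Filter.liminf_const _
  have hnn : 0 ≤ mixedVol n Q := by
    rw [eQ 0]; exact (mixedVol_eq hn (hk 0)).1
  exact (ENNReal.ofReal_le_ofReal_iff hnn).1 hle
end

section
/- Let F_1,...,F_n ∈ Q[X_1,...,X_n,T], let V ⊂ A^{n+1} be their common zero set, and let π: V → A^1 be the projection (x,t) ↦ t. Assume #π^{-1}(t) ≤ D for generic t ∈ A^1 and there exists t_0 ∈ A^1 such that π^{-1}(t_0) is a zero-dimensional variety of degree D at which the Jacobian determinant J of F_1,...,F_n with respect to X_1,...,X_n does not vanish. Let V_dom be the union of all irreducible components C of V with closure of π(C) equal to A^1. Then V_dom is a nonempty equidimensional variety of dimension 1. -/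
/-- A Zariski-closed subset of affine space `ℂᵐ`: the common zero set of a
family of polynomials. -/
def ZClosed {m : ℕ} (S : Set (Fin m → ℂ)) : Prop :=
  ∃ I : Set (MvPolynomial (Fin m) ℂ), S = {x | ∀ f ∈ I, MvPolynomial.eval x f = 0}

/-- An irreducible affine variety: a nonempty Zariski-closed set which is not
the union of two proper Zariski-closed subsets. -/
def IsIrredVariety {m : ℕ} (C : Set (Fin m → ℂ)) : Prop :=
  ZClosed C ∧ C.Nonempty ∧
    ∀ A B : Set (Fin m → ℂ), ZClosed A → ZClosed B → C = A ∪ B → A = C ∨ B = C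

/-- An irreducible component of `V`: a maximal irreducible variety contained
in `V`. -/
def IsIrredComponent {m : ℕ} (V C : Set (Fin m → ℂ)) : Prop :=
  IsIrredVariety C ∧ C ⊆ V ∧
    ∀ C' : Set (Fin m → ℂ), IsIrredVariety C' → C ⊆ C' → C' ⊆ V → C' = C

/-- `C` has dimension at least `d`: there is a strictly increasing chain of
`d + 1` irreducible varieties ending at `C`. -/
def hasDimGE {m : ℕ} (C : Set (Fin m → ℂ)) (d : ℕ) : Prop :=
  ∃ ch : Fin (d + 1) → Set (Fin m → ℂ), (∀ i, IsIrredVariety (ch i)) ∧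
    (∀ i j : Fin (d + 1), i < j → ch i ⊂ ch j) ∧ ch (Fin.last d) = C

/-- `C` has dimension exactly `d`. -/
def dimEq {m : ℕ} (C : Set (Fin m → ℂ)) (d : ℕ) : Prop :=
  hasDimGE C d ∧ ¬ hasDimGE C (d + 1)

/-- The common zero set in `ℂ^{n+1}` of `F₁,…,Fₙ ∈ ℚ[X₁,…,Xₙ,T]` (the last
variable is `T`). -/
def zeroSet {n : ℕ} (F : Fin n → MvPolynomial (Fin (n + 1)) ℚ) :
    Set (Fin (n + 1) → ℂ) :=
  {x | ∀ i, MvPolynomial.aeval x (F i) = 0}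

/-- The Jacobian determinant of `F₁,…,Fₙ` with respect to `X₁,…,Xₙ` (all the
variables but the last one, `T`). -/
noncomputable def jacDet {n : ℕ} (F : Fin n → MvPolynomial (Fin (n + 1)) ℚ) :
    MvPolynomial (Fin (n + 1)) ℚ :=
  Matrix.det (Matrix.of fun i j : Fin n => MvPolynomial.pderiv (Fin.castSucc j) (F i))

/-- The projection `π(x, t) = t` on `ℂ^{n+1}`. -/
def projT {n : ℕ} (x : Fin (n + 1) → ℂ) : ℂ := x (Fin.last n)

/-- `Vdom`: the union of the irreducible components of the zero set of
`F₁,…,Fₙ` projecting dominantly onto `𝔸¹` under `π(x,t) = t` (a component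
dominates `𝔸¹` iff its image under `π` is infinite, i.e. Zariski dense). -/
def Vdom {n : ℕ} (F : Fin n → MvPolynomial (Fin (n + 1)) ℚ) :
    Set (Fin (n + 1) → ℂ) :=
  ⋃₀ {C | IsIrredComponent (zeroSet F) C ∧ (projT '' C).Infinite}

open MvPolynomial in
theorem aux_zc {m : ℕ} {C : Set (Fin m → ℂ)} (h : ZClosed C) :
    zeroLocus ℂ (vanishingIdeal ℂ C) = C := by
  obtain ⟨I, rfl⟩ := h
  apply Set.Subset.antisymm
  · intro x hx f hf
    have := hx f (by
      rw [mem_vanishingIdeal_iff]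
      intro y hy
      simpa [coe_aeval_eq_eval] using hy f hf)
    simpa [coe_aeval_eq_eval] using this
  · exact zeroLocus_vanishingIdeal_le _

open MvPolynomial in
theorem aux_zclosed_zeroLocus {m : ℕ} (I : Ideal (MvPolynomial (Fin m) ℂ)) :
    ZClosed (zeroLocus ℂ I) := by
  refine ⟨I, ?_⟩
  ext x
  simp

open MvPolynomial in
theorem aux_zclosed_inter {m : ℕ} {C : Set (Fin m → ℂ)} (h : ZClosed C)
    (f : MvPolynomial (Fin m) ℂ) : ZClosed (C ∩ {x | aeval x f = 0}) := by
  obtain ⟨I, rfl⟩ := h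
  refine ⟨insert f I, ?_⟩
  ext x
  simp [and_comm]

open MvPolynomial in
theorem aux_irr_prime {m : ℕ} {C : Set (Fin m → ℂ)} (h : IsIrredVariety C) :
    (vanishingIdeal ℂ C : Ideal (MvPolynomial (Fin m) ℂ)).IsPrime := by
  obtain ⟨hc, ⟨p, hp⟩, hirr⟩ := h
  refine ⟨?_, ?_⟩
  · intro h
    have h1 : (1 : MvPolynomial (Fin m) ℂ) ∈ vanishingIdeal ℂ C := by rw [h]; trivial
    have := h1 p hp
    simp at this
  · intro f g hfg
    have hU : C = (C ∩ {x | aeval x f = 0}) ∪ (C ∩ {x | aeval x g = 0}) := by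
      ext x
      constructor
      · intro hx
        have := hfg x hx
        rw [map_mul, mul_eq_zero] at this
        rcases this with h | h
        · exact Or.inl ⟨hx, h⟩
        · exact Or.inr ⟨hx, h⟩
      · rintro (h | h) <;> exact h.1
    rcases hirr _ _ (aux_zclosed_inter hc f) (aux_zclosed_inter hc g) hU with h | h
    · left
      intro x hx
      rw [← h] at hx
      exact hx.2
    · right
      intro x hx
      rw [← h] at hx
      exact hx.2

open MvPolynomial in
theorem aux_prime_irr {m : ℕ} (P : Ideal (MvPolynomial (Fin m) ℂ)) (hP : P.IsPrime) :
    IsIrredVariety (zeroLocus ℂ P) := by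
  have hv : vanishingIdeal ℂ (zeroLocus ℂ P) = P := IsPrime.vanishingIdeal_zeroLocus P
  refine ⟨aux_zclosed_zeroLocus P, ?_, ?_⟩
  · by_contra hne
    rw [Set.not_nonempty_iff_eq_empty] at hne
    rw [hne, vanishingIdeal_empty] at hv
    exact hP.ne_top hv.symm
  · intro A B hA hB hAB
    by_contra hcon
    push Not at hcon
    obtain ⟨h1, h2⟩ := hcon
    have key : ∀ A : Set (Fin m → ℂ), ZClosed A → A ⊆ zeroLocus ℂ P → A ≠ zeroLocus ℂ P →
        ∃ f ∈ vanishingIdeal ℂ A, f ∉ P := by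
      intro A hA hs hne
      by_contra hall
      push Not at hall
      apply hne
      apply Set.Subset.antisymm hs
      rw [← aux_zc hA]
      exact zeroLocus_anti_mono hall
    obtain ⟨f, hf, hfP⟩ := key A hA (by rw [hAB]; exact Set.subset_union_left) h1
    obtain ⟨g, hg, hgP⟩ := key B hB (by rw [hAB]; exact Set.subset_union_right) h2
    have : f * g ∈ P := by
      rw [← hv]
      intro x hx
      rw [hAB] at hx
      rw [map_mul]
      rcases hx with hx | hx
      · rw [hf x hx, zero_mul]
      · rw [hg x hx, mul_zero]
    rcases hP.mem_or_mem this with h | h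
    · exact hfP h
    · exact hgP h

open MvPolynomial in
theorem aux_minimal_component {m : ℕ} (I P : Ideal (MvPolynomial (Fin m) ℂ))
    (hP : P ∈ I.minimalPrimes) : IsIrredComponent (zeroLocus ℂ I) (zeroLocus ℂ P) := by
  have hPp : P.IsPrime := hP.1.1
  refine ⟨aux_prime_irr P hPp, zeroLocus_anti_mono hP.1.2, ?_⟩
  intro C' hC' h1 h2
  have hI : I ≤ vanishingIdeal ℂ C' :=
    le_zeroLocus_iff_le_vanishingIdeal.1 h2
  have hle : vanishingIdeal ℂ C' ≤ P := by
    have := vanishingIdeal_anti_mono (k := ℂ) h1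
    rwa [IsPrime.vanishingIdeal_zeroLocus P] at this
  have := hP.2 ⟨aux_irr_prime hC', hI⟩ hle
  have heq : vanishingIdeal ℂ C' = P := le_antisymm hle this
  rw [← heq, aux_zc hC'.1]

open MvPolynomial in
theorem aux_exists_component {n : ℕ} (I : Ideal (MvPolynomial (Fin (n+1)) ℂ))
    (hinf : (projT '' (zeroLocus ℂ I)).Infinite) :
    ∃ C, IsIrredComponent (zeroLocus ℂ I) C ∧ (projT '' C).Infinite := by
  by_contra hcon
  push Not at hcon
  apply hinf
  have hfin : (⋃ P ∈ I.minimalPrimes, projT '' (zeroLocus ℂ P)).Finite := by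
    apply Set.Finite.biUnion I.finite_minimalPrimes_of_isNoetherianRing
    intro P hP
    exact hcon _ (aux_minimal_component I P hP)
  refine hfin.subset ?_
  rintro _ ⟨x, hx, rfl⟩
  have hle : I ≤ vanishingIdeal ℂ {x} := by
    apply le_zeroLocus_iff_le_vanishingIdeal.1
    simpa using hx
  have hpr : (vanishingIdeal ℂ {x} : Ideal (MvPolynomial (Fin (n+1)) ℂ)).IsPrime :=
    Ideal.IsMaximal.isPrime inferInstance
  obtain ⟨P, hP, hPx⟩ := Ideal.exists_minimalPrimes_le hle
  rw [Set.mem_iUnion₂]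
  refine ⟨P, hP, x, ?_, rfl⟩
  intro f hf
  exact hPx hf x rfl

open MvPolynomial in
theorem aux_strict {m : ℕ} (f : MvPolynomial (Fin m) ℚ) (p : Fin m → ℂ) :
    HasStrictFDerivAt (fun x : Fin m → ℂ => aeval x f)
      (∑ k, aeval p (pderiv k f) • (ContinuousLinearMap.proj k : (Fin m → ℂ) →L[ℂ] ℂ)) p := by
  induction f using MvPolynomial.induction_on with
  | C a =>
    simp only [aeval_C]
    refine (hasStrictFDerivAt_const (𝕜 := ℂ) _ p).congr_fderiv ?_
    ext v
    simp
  | add f g hf hg =>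
    simp only [map_add]
    refine (hf.fun_add hg).congr_fderiv ?_
    ext v
    simp [add_mul, Finset.sum_add_distrib]
  | mul_X f i hf =>
    simp only [map_mul, aeval_X]
    have hX : HasStrictFDerivAt (fun x : Fin m → ℂ => x i)
      (ContinuousLinearMap.proj i : (Fin m → ℂ) →L[ℂ] ℂ) p :=
      (ContinuousLinearMap.proj i : (Fin m → ℂ) →L[ℂ] ℂ).hasStrictFDerivAt
    refine (hf.mul hX).congr_fderiv ?_
    ext v
    simp only [Derivation.leibniz, pderiv_X, smul_eq_mul, map_add, map_mul, aeval_X,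
      add_apply, smul_apply,
      sum_apply, ContinuousLinearMap.proj_apply, add_mul,
      Finset.sum_add_distrib, Finset.mul_sum]
    congr 1
    · rw [Finset.sum_eq_single i]
      · simp
      · intro b _ hb
        simp [hb.symm]
      · simp
    · refine Finset.sum_congr rfl fun k _ => ?_
      ring

open MvPolynomial Topology in
theorem aux_infinite {n : ℕ} (F : Fin n → MvPolynomial (Fin (n + 1)) ℚ)
    (p : Fin (n+1) → ℂ) (hp : p ∈ zeroSet F) (hJ : aeval p (jacDet F) ≠ 0) :
    (projT '' zeroSet F).Infinite := by
  let G : (Fin (n+1) → ℂ) → (Fin n → ℂ) × ℂ := fun x => (fun i => aeval x (F i), x (Fin.last n))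
  let L1 : (Fin (n+1) → ℂ) →L[ℂ] (Fin n → ℂ) := ContinuousLinearMap.pi fun i =>
    ∑ k, aeval p (pderiv k (F i)) • (ContinuousLinearMap.proj k : (Fin (n+1) → ℂ) →L[ℂ] ℂ)
  let L : (Fin (n+1) → ℂ) →L[ℂ] (Fin n → ℂ) × ℂ :=
    L1.prod (ContinuousLinearMap.proj (Fin.last n))
  have hG : HasStrictFDerivAt G L p := by
    refine HasStrictFDerivAt.prodMk ?_ ?_
    · rw [hasStrictFDerivAt_pi']
      intro i
      exact aux_strict (F i) p
    · exact (ContinuousLinearMap.proj (Fin.last n) : (Fin (n+1) → ℂ) →L[ℂ] ℂ).hasStrictFDerivAt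
  let M : Matrix (Fin n) (Fin n) ℂ :=
    Matrix.of fun i j => aeval p (pderiv (Fin.castSucc j) (F i))
  have hdet : M.det ≠ 0 := by
    intro h
    apply hJ
    rw [jacDet, AlgHom.map_det, ← h]
    rfl
  have hsurj : L.range = ⊤ := by
    rw [LinearMap.range_eq_top]
    rintro ⟨w, s⟩
    let u := M⁻¹.mulVec (fun i => w i - s * aeval p (pderiv (Fin.last n) (F i)))
    have hu : M.mulVec u = (fun i => w i - s * aeval p (pderiv (Fin.last n) (F i))) := by
      simp only [u]
      rw [Matrix.mulVec_mulVec, Matrix.mul_nonsing_inv _ (isUnit_iff_ne_zero.2 hdet),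
        Matrix.one_mulVec]
    refine ⟨Fin.snoc u s, ?_⟩
    refine Prod.ext ?_ ?_
    · funext i
      have hi := congrFun hu i
      simp only [Matrix.mulVec, dotProduct, M, Matrix.of_apply] at hi
      simp [L, L1, Fin.sum_univ_castSucc, hi]
      ring
    · simp [L]
  have hmap := hG.map_nhds_eq_of_surj hsurj
  have hr : Set.range G ∈ 𝓝 (G p) := by
    rw [← hmap]
    exact Filter.range_mem_map
  have hGp : G p = (0, p (Fin.last n)) := by
    refine Prod.ext ?_ rfl
    funext i
    exact hp i
  rw [hGp] at hr
  have hc : Filter.Tendsto (fun t : ℂ => ((0 : Fin n → ℂ), t)) (𝓝 (p (Fin.last n)))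
    (𝓝 (0, p (Fin.last n))) := by
    apply Continuous.tendsto'
    · fun_prop
    · rfl
  have hS := hc hr
  have : {t | (0, t) ∈ Set.range G} ⊆ projT '' zeroSet F := by
    rintro t ⟨x, hx⟩
    refine ⟨x, ?_, ?_⟩
    · intro i
      exact congrFun (congrArg Prod.fst hx) i
    · exact congrArg Prod.snd hx
  exact (infinite_of_mem_nhds _ hS).mono this

open MvPolynomial in
theorem aux_zeroSet_eq {n : ℕ} (F : Fin n → MvPolynomial (Fin (n + 1)) ℚ) :
    zeroSet F = zeroLocus ℂ (Ideal.span (Set.range fun i => map (algebraMap ℚ ℂ) (F i))) := by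
  rw [zeroLocus_span]
  ext x
  simp [zeroSet, aeval_def]

/-- The ring map from bivariate polynomials sending the inner variable to `a` and the outer
variable to `b`. -/
noncomputable def auxPhi {A : Type} [CommRing A] [Algebra ℂ A] (a b : A) :
    Polynomial (Polynomial ℂ) →+* A :=
  Polynomial.eval₂RingHom (Polynomial.aeval a : Polynomial ℂ →ₐ[ℂ] A).toRingHom b

theorem aux_chev {A : Type} [CommRing A] [IsDomain A] [Algebra ℂ A] [Algebra.FiniteType ℂ A]
    (a b : A) (hinj : Function.Injective (auxPhi a b)) :
    ∃ g : Polynomial (Polynomial ℂ), g ≠ 0 ∧ ∀ s u : ℂ, g.evalEval s u ≠ 0 →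
      ∃ Q : Ideal A, Q.IsPrime ∧ a - algebraMap ℂ A s ∈ Q ∧ b - algebraMap ℂ A u ∈ Q := by
  have hft : (auxPhi a b).FiniteType := by
    refine RingHom.FiniteType.of_comp_finiteType
      (f := (Polynomial.C.comp Polynomial.C : ℂ →+* Polynomial (Polynomial ℂ))) ?_
    have : (auxPhi a b).comp (Polynomial.C.comp Polynomial.C) = algebraMap ℂ A := by
      ext x
      · simp [auxPhi]
    rw [this]
    exact RingHom.finiteType_algebraMap.2 inferInstance
  have hfp : (auxPhi a b).FinitePresentation := RingHom.FinitePresentation.of_finiteType.1 hft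
  have hcon := PrimeSpectrum.isConstructible_range_comap hfp
  obtain ⟨S, hS⟩ := PrimeSpectrum.exists_constructibleSetData_iff.2 hcon
  let z : PrimeSpectrum (Polynomial (Polynomial ℂ)) :=
    PrimeSpectrum.comap (auxPhi a b) ⟨⊥, Ideal.isPrime_bot⟩
  have hzb : z.asIdeal = ⊥ := by
    simp only [z, PrimeSpectrum.comap_asIdeal]
    exact (RingHom.injective_iff_ker_eq_bot _).1 hinj
  have hz : z ∈ S.toSet := by rw [hS]; exact ⟨_, rfl⟩
  simp only [PrimeSpectrum.ConstructibleSetData.toSet, Set.mem_iUnion] at hz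
  obtain ⟨B, hB, hz1, hz2⟩ := hz
  refine ⟨B.f, ?_, ?_⟩
  · intro h0
    apply hz2
    simp [h0]
  intro s u hsu
  let w : PrimeSpectrum (Polynomial (Polynomial ℂ)) :=
    ⟨RingHom.ker (Polynomial.evalEvalRingHom s u), RingHom.ker_isPrime _⟩
  have hw : w ∈ S.toSet := by
    simp only [PrimeSpectrum.ConstructibleSetData.toSet, Set.mem_iUnion]
    refine ⟨B, hB, ?_, ?_⟩
    · rw [PrimeSpectrum.mem_zeroLocus] at hz1 ⊢
      intro x hx
      have := hz1 hx
      rw [hzb] at this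
      have h0 : x = 0 := this
      rw [h0]
      exact w.asIdeal.zero_mem
    · intro h
      rw [PrimeSpectrum.mem_zeroLocus] at h
      exact hsu (h rfl)
  rw [hS] at hw
  obtain ⟨q, hq⟩ := hw
  have hmem : ∀ x, auxPhi a b x ∈ q.asIdeal ↔ x.evalEval s u = 0 := by
    intro x
    have : x ∈ (PrimeSpectrum.comap (auxPhi a b) q).asIdeal ↔ x ∈ w.asIdeal := by rw [hq]
    exact this
  refine ⟨q.asIdeal, q.2, ?_, ?_⟩
  · have := (hmem (Polynomial.C (Polynomial.X - Polynomial.C s))).2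
      (by rw [Polynomial.evalEval_C]; simp)
    simpa [auxPhi] using this
  · have := (hmem (Polynomial.X - Polynomial.C (Polynomial.C u))).2 (by simp)
    simpa [auxPhi] using this

theorem aux_dep {A : Type} [CommRing A] [IsDomain A] [Algebra ℂ A]
    (h : Algebra.trdeg ℂ A ≤ 1) (a b : A) : ¬ Function.Injective (auxPhi a b) := by
  intro hinj
  let e : MvPolynomial (Fin 2) ℂ ≃ₐ[ℂ] Polynomial (Polynomial ℂ) :=
    (MvPolynomial.finSuccEquiv ℂ 1).trans
      (Polynomial.mapAlgEquiv (MvPolynomial.uniqueAlgEquiv ℂ (Fin 1)))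
  have hai : AlgebraicIndependent ℂ ![b, a] := by
    rw [AlgebraicIndependent]
    have : ((MvPolynomial.aeval ![b, a] : MvPolynomial (Fin 2) ℂ →ₐ[ℂ] A) : _ →+* A) =
        (auxPhi a b).comp (e : MvPolynomial (Fin 2) ℂ →+* Polynomial (Polynomial ℂ)) := by
      apply MvPolynomial.ringHom_ext
      · intro r
        simp [e, auxPhi, MvPolynomial.finSuccEquiv_apply, MvPolynomial.uniqueAlgEquiv]
      · intro i
        fin_cases i
        · simp [e, auxPhi, MvPolynomial.finSuccEquiv_apply]
        · have h1 : MvPolynomial.finSuccEquiv ℂ 1 (MvPolynomial.X 1) =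
              Polynomial.C (MvPolynomial.X 0) := MvPolynomial.finSuccEquiv_X_succ (j := 0)
          simp [e, auxPhi, h1, MvPolynomial.uniqueAlgEquiv]
    have h2 : Function.Injective ((auxPhi a b).comp
      (e : MvPolynomial (Fin 2) ℂ →+* Polynomial (Polynomial ℂ))) :=
      hinj.comp e.injective
    rw [← this] at h2
    exact h2
  have h3 := hai.cardinalMk_le_trdeg
  have := h3.trans h
  simp at this

theorem aux_trdeg {A : Type} [CommRing A] [IsDomain A] [Algebra ℂ A] (a : A)
    (s : Set A) (hs : Algebra.adjoin ℂ s = ⊤)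
    (ha : Function.Injective (Polynomial.aeval a : Polynomial ℂ →ₐ[ℂ] A))
    (hdep : ∀ b ∈ s, ¬ Function.Injective (auxPhi a b)) : Algebra.trdeg ℂ A ≤ 1 := by
  let R := Algebra.adjoin ℂ ({a} : Set A)
  have haR : a ∈ R := Algebra.subset_adjoin rfl
  let φ : Polynomial ℂ →ₐ[ℂ] R := Polynomial.aeval ⟨a, haR⟩
  have hφ : ∀ p, ((φ p : R) : A) = Polynomial.aeval a p := by
    intro p
    exact (Polynomial.aeval_algHom_apply R.val ⟨a, haR⟩ p).symm
  have hφi : Function.Injective φ := by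
    intro p q hpq
    apply ha
    rw [← hφ, ← hφ, hpq]
  have hb : ∀ b ∈ s, IsAlgebraic R b := by
    intro b hb
    have := hdep b hb
    rw [injective_iff_map_eq_zero] at this
    push Not at this
    obtain ⟨Q, hQ, hQ0⟩ := this
    refine ⟨Q.map φ.toRingHom, ?_, ?_⟩
    · rw [Polynomial.map_ne_zero_iff hφi]
      exact hQ0
    · rw [← hQ, Polynomial.aeval_def, Polynomial.eval₂_map, auxPhi]
      simp only [Polynomial.coe_eval₂RingHom]
      congr 1
      ext p
      · simp [hφ]
      · simp [hφ]
  have halg : Algebra.IsAlgebraic R A := by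
    refine ⟨fun x => ?_⟩
    have hx : x ∈ Algebra.adjoin ℂ s := by rw [hs]; trivial
    induction hx using Algebra.adjoin_induction with
    | mem x hx => exact hb x hx
    | algebraMap r =>
      rw [IsScalarTower.algebraMap_apply ℂ R A]
      exact isAlgebraic_algebraMap _
    | add x y _ _ hx hy => exact hx.add hy
    | mul x y _ _ hx hy => exact hx.mul hy
  have := Algebra.IsAlgebraic.trdeg_le_cardinalMk ℂ ({a} : Set A)
  simpa using this

theorem auxPhi_map {A B : Type} [CommRing A] [Algebra ℂ A] [CommRing B] [Algebra ℂ B]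
    (ψ : A →ₐ[ℂ] B) (a b : A) (p : Polynomial (Polynomial ℂ)) :
    ψ (auxPhi a b p) = auxPhi (ψ a) (ψ b) p := by
  have : (ψ : A →+* B).comp (auxPhi a b) = auxPhi (ψ a) (ψ b) := by
    ext x
    · simp [auxPhi]
    · simp [auxPhi]
    · simp [auxPhi]
  exact congrArg (fun f => f p) this

theorem auxPhi_evalEval (a b : ℂ) (p : Polynomial (Polynomial ℂ)) :
    auxPhi a b p = p.evalEval a b := by
  have : auxPhi a b = Polynomial.evalEvalRingHom a b := by
    ext x
    · simp [auxPhi]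
    · simp [auxPhi, Polynomial.evalEval_C]
    · simp [auxPhi]
  exact congrArg (fun f => f p) this

open MvPolynomial in
theorem aux_point {m : ℕ} (P : Ideal (MvPolynomial (Fin m) ℂ))
    (i j : Fin m) (s u : ℂ) (Q : Ideal (MvPolynomial (Fin m) ℂ ⧸ P)) (hQ : Q.IsPrime)
    (h1 : Ideal.Quotient.mk P (X i) - algebraMap ℂ _ s ∈ Q)
    (h2 : Ideal.Quotient.mk P (X j) - algebraMap ℂ _ u ∈ Q) :
    ∃ x ∈ zeroLocus ℂ P, x i = s ∧ x j = u := by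
  have hp : (Q.comap (Ideal.Quotient.mk P)).IsPrime := Ideal.comap_isPrime _ _
  obtain ⟨-, ⟨x, hx⟩, -⟩ := aux_prime_irr _ hp
  refine ⟨x, ?_, ?_, ?_⟩
  · intro f hf
    apply hx f
    rw [Ideal.mem_comap, Ideal.Quotient.eq_zero_iff_mem.2 hf]
    exact Q.zero_mem
  · have := hx (X i - C s) (by rw [Ideal.mem_comap, map_sub]; exact h1)
    simpa [sub_eq_zero] using this
  · have := hx (X j - C u) (by rw [Ideal.mem_comap, map_sub]; exact h2)
    simpa [sub_eq_zero] using this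

open MvPolynomial in
theorem aux_trdeg_C {n : ℕ} {C : Set (Fin (n+1) → ℂ)} (hC : IsIrredVariety C)
    (hinf : (projT '' C).Infinite) (T : Finset ℂ)
    (hT : ∀ t ∉ T, (C ∩ {x | projT x = t}).Finite) :
    Algebra.trdeg ℂ (MvPolynomial (Fin (n+1)) ℂ ⧸ vanishingIdeal ℂ C) ≤ 1 := by
  have hprime := aux_irr_prime hC
  have hz := aux_zc hC.1
  set P : Ideal (MvPolynomial (Fin (n+1)) ℂ) := vanishingIdeal ℂ C with hP
  let mk : MvPolynomial (Fin (n+1)) ℂ →ₐ[ℂ] (MvPolynomial (Fin (n+1)) ℂ ⧸ P) :=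
    Ideal.Quotient.mkₐ ℂ P
  have hmk : Function.Surjective mk := Ideal.Quotient.mkₐ_surjective ℂ P
  refine aux_trdeg (mk (X (Fin.last n))) (Set.range fun j => mk (X j)) ?_ ?_ ?_
  · have h1 := MvPolynomial.adjoin_range_X (R := ℂ) (σ := Fin (n+1))
    have h2 := AlgHom.map_adjoin mk (Set.range X)
    rw [h1, Algebra.map_top, ← Set.range_comp] at h2
    rw [(AlgHom.range_eq_top mk).2 hmk] at h2
    exact h2.symm
  · rw [injective_iff_map_eq_zero]
    intro p hp
    by_contra hp0
    apply hinf
    refine (p.roots.toFinset.finite_toSet).subset ?_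
    rintro _ ⟨x, hx, rfl⟩
    rw [Polynomial.aeval_algHom_apply] at hp
    have hmem : Polynomial.aeval (X (Fin.last n)) p ∈ P := Ideal.Quotient.eq_zero_iff_mem.1 hp
    have h3 := hmem x hx
    rw [← Polynomial.aeval_algHom_apply, aeval_X] at h3
    simp [hp0, projT]
    simpa using h3
  · rintro _ ⟨j, rfl⟩ hinj
    obtain ⟨g, hg0, hg⟩ := aux_chev _ _ hinj
    have hc : g.leadingCoeff ≠ 0 := Polynomial.leadingCoeff_ne_zero.2 hg0
    obtain ⟨t, ht⟩ := Infinite.exists_notMem_finset (T ∪ g.leadingCoeff.roots.toFinset)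
    rw [Finset.mem_union, not_or] at ht
    obtain ⟨htT, htr⟩ := ht
    have hlt : g.leadingCoeff.eval t ≠ 0 := by
      simpa [hc] using htr
    let h := g.map (Polynomial.evalRingHom t)
    have hh : h ≠ 0 := by
      intro h0
      apply hlt
      have := congrArg (fun q => Polynomial.coeff q g.natDegree) h0
      simpa [h, Polynomial.coeff_map] using this
    have hfib := (hT t htT).image (fun x => x j)
    have hfin2 : ((↑h.roots.toFinset : Set ℂ) ∪
        (fun x => x j) '' (C ∩ {x | projT x = t})).Finite :=
      (Finset.finite_toSet _).union hfib
    refine Set.infinite_univ (α := ℂ) (hfin2.subset ?_)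
    intro u _
    by_cases hu : h.eval u = 0
    · left
      simpa [hh] using hu
    · right
      have hgu : g.evalEval t u ≠ 0 := by
        rwa [← Polynomial.map_evalRingHom_eval]
      obtain ⟨Q, hQ, h1, h2⟩ := hg t u hgu
      obtain ⟨x, hx, hx1, hx2⟩ := aux_point P (Fin.last n) j t u Q hQ h1 h2
      rw [hz] at hx
      exact ⟨x, ⟨hx, hx1⟩, hx2⟩

open MvPolynomial in
theorem aux_single {m : ℕ} {C C1 : Set (Fin m → ℂ)} (hC : IsIrredVariety C)
    (htr : Algebra.trdeg ℂ (MvPolynomial (Fin m) ℂ ⧸ vanishingIdeal ℂ C) ≤ 1)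
    (hC1 : IsIrredVariety C1) (hlt : C1 ⊂ C) : ∃ r, ∀ x ∈ C1, x = r := by
  have hprime := aux_irr_prime hC
  have hprime1 := aux_irr_prime hC1
  have hf : ∃ f ∈ vanishingIdeal ℂ C1, f ∉ vanishingIdeal ℂ C := by
    by_contra hall
    push Not at hall
    apply hlt.2
    rw [← aux_zc hC1.1, ← aux_zc hC.1]
    exact zeroLocus_anti_mono hall
  obtain ⟨f, hf1, hfC⟩ := hf
  let mk : MvPolynomial (Fin m) ℂ →ₐ[ℂ] (MvPolynomial (Fin m) ℂ ⧸ vanishingIdeal ℂ C) :=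
    Ideal.Quotient.mkₐ ℂ _
  have hf0 : mk f ≠ 0 := fun h => hfC (Ideal.Quotient.eq_zero_iff_mem.1 h)
  have key : ∀ i : Fin m, ∃ r : ℂ, ∀ x ∈ C1, x i = r := by
    intro i
    have hd := aux_dep htr (mk (X i)) (mk f)
    rw [injective_iff_map_eq_zero] at hd
    push Not at hd
    obtain ⟨Q, hQ, hQ0⟩ := hd
    obtain ⟨k, Q', hQ', rfl⟩ := WfDvdMonoid.max_power_factor hQ0
      (Polynomial.irreducible_X (R := Polynomial ℂ))
    have hX : auxPhi (mk (X i)) (mk f) Polynomial.X = mk f := by simp [auxPhi]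
    rw [map_mul, map_pow, hX] at hQ
    have hQ2 := (mul_eq_zero.1 hQ).resolve_left (pow_ne_zero _ hf0)
    rw [← auxPhi_map] at hQ2
    have hmem : auxPhi (X i) f Q' ∈ vanishingIdeal ℂ C := Ideal.Quotient.eq_zero_iff_mem.1 hQ2
    rw [Polynomial.X_dvd_iff] at hQ'
    set q := Q'.coeff 0 with hq
    have hqx : ∀ x ∈ C1, q.eval (x i) = 0 := by
      intro x hx
      have h1 := hmem x (hlt.1 hx)
      rw [auxPhi_map, auxPhi_evalEval, hf1 x hx, aeval_X] at h1
      rw [hq, Polynomial.coeff_zero_eq_eval_zero]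
      simpa [Polynomial.evalEval] using h1
    have hpr : (q.roots.map fun r => (X i - MvPolynomial.C r : MvPolynomial (Fin m) ℂ)).prod ∈
        vanishingIdeal ℂ C1 := by
      intro x hx
      have h1 := hqx x hx
      rw [(IsAlgClosed.splits q).eq_prod_roots, Polynomial.eval_mul, Polynomial.eval_C] at h1
      have h2 := (mul_eq_zero.1 h1).resolve_left (Polynomial.leadingCoeff_ne_zero.2 hQ')
      rw [Polynomial.eval_multiset_prod, Multiset.map_map] at h2
      rw [map_multiset_prod, Multiset.map_map, ← h2]
      congr 1
      apply Multiset.map_congr rfl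
      intro r _
      simp
    rw [hprime1.multiset_prod_mem_iff_exists_mem] at hpr
    obtain ⟨w, hw, hr⟩ := hpr
    obtain ⟨r, -, rfl⟩ := Multiset.mem_map.1 hw
    refine ⟨r, fun x hx => ?_⟩
    have := hr x hx
    simpa [sub_eq_zero] using this
  choose r hr using key
  exact ⟨r, fun x hx => funext fun i => hr i x hx⟩

open MvPolynomial in
theorem aux_point_irr {m : ℕ} (x : Fin m → ℂ) : IsIrredVariety {x} := by
  have h1 : zeroLocus ℂ (vanishingIdeal ℂ {x} : Ideal (MvPolynomial (Fin m) ℂ)) = {x} := by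
    apply Set.Subset.antisymm
    · intro y hy
      funext i
      have := hy (X i - C (x i)) (by rw [mem_vanishingIdeal_singleton_iff]; simp)
      simpa [sub_eq_zero] using this
    · exact zeroLocus_vanishingIdeal_le _
  rw [← h1]
  exact aux_prime_irr _ (Ideal.IsMaximal.isPrime inferInstance)

/-- **Dominant-components lemma, first part.** Under the stated hypotheses
(generic fibers of `π` of cardinality at most `D`, and a special fiber
`π⁻¹(t₀)` consisting of exactly `D` points at which the Jacobian does not
vanish), `Vdom` is a nonempty equidimensional variety of dimension `1`, i.e.
every dominating component has dimension exactly `1`. -/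
theorem Vdom_equidimensional_one (n D : ℕ) (hD : 0 < D)
    (F : Fin n → MvPolynomial (Fin (n + 1)) ℚ)
    (hgen : ∃ T : Finset ℂ, ∀ t ∉ T,
      (zeroSet F ∩ {x | projT x = t}).Finite ∧
      (zeroSet F ∩ {x | projT x = t}).ncard ≤ D)
    (t0 : ℂ)
    (hfin : (zeroSet F ∩ {x | projT x = t0}).Finite)
    (hcard : (zeroSet F ∩ {x | projT x = t0}).ncard = D)
    (hJ : ∀ x ∈ zeroSet F ∩ {x | projT x = t0},
      MvPolynomial.aeval x (jacDet F) ≠ 0) :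
    (Vdom F).Nonempty ∧
      ∀ C, IsIrredComponent (zeroSet F) C → (projT '' C).Infinite → dimEq C 1 := by
  constructor
  · have hne : (zeroSet F ∩ {x | projT x = t0}).Nonempty := by
      rw [Set.nonempty_iff_ne_empty]
      intro h
      rw [h, Set.ncard_empty] at hcard
      omega
    obtain ⟨p, hp⟩ := hne
    have hinf := aux_infinite F p hp.1 (hJ p hp)
    rw [aux_zeroSet_eq] at hinf
    obtain ⟨C, hC, hCi⟩ := aux_exists_component _ hinf
    rw [← aux_zeroSet_eq] at hC
    obtain ⟨x, hx⟩ := hC.1.2.1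
    exact ⟨x, C, ⟨hC, hCi⟩, hx⟩
  · intro C hC hinf
    obtain ⟨T, hT⟩ := hgen
    constructor
    · obtain ⟨x, hx⟩ := hC.1.2.1
      refine ⟨![{x}, C], ?_, ?_, rfl⟩
      · intro i
        fin_cases i
        · exact aux_point_irr x
        · exact hC.1
      · have hs : ({x} : Set (Fin (n+1) → ℂ)) ⊂ C := by
          refine ⟨by simpa using hx, fun h => ?_⟩
          exact hinf (((Set.finite_singleton x).subset h).image _)
        intro i j hij
        fin_cases i <;> fin_cases j <;> first | exact hs | exact absurd hij (by decide)
    · rintro ⟨ch, h1, h2, h3⟩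
      have htr := aux_trdeg_C hC.1 hinf T fun t ht =>
        (hT t ht).1.subset (Set.inter_subset_inter_left _ hC.2.1)
      have hlt : ch 1 ⊂ C := by
        rw [← h3]
        exact h2 1 2 (by decide)
      obtain ⟨r, hr⟩ := aux_single hC.1 htr (h1 1) hlt
      have hlt0 : ch 0 ⊂ ch 1 := h2 0 1 (by decide)
      obtain ⟨y, hy⟩ := (h1 0).2.1
      apply hlt0.2
      intro x hx
      rw [hr x hx, ← hr y (hlt0.1 hy)]
      exact hy
end

section
/- With the hypotheses of the dominant-components lemma (F_1,...,F_n ∈ Q[X,T] defining V ⊂ A^{n+1}, generic fibers of π of size at most D, and a fiber π^{-1}(t_0) of exactly D smooth points where the Jacobian J with respect to X does not vanish), the variety V_dom equals the union of all irreducible components of V that intersect π^{-1}(t_0) nontrivially, and the restriction π|_{V_dom}: V_dom → A^1 is dominant of degree D. -/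
/-! ### Analytic part -/

lemma hasStrictFDerivAt_aeval_mv {m : ℕ} (f : MvPolynomial (Fin m) ℚ) (p : Fin m → ℂ) :
    HasStrictFDerivAt (fun x : Fin m → ℂ => MvPolynomial.aeval x f)
      (∑ j, (MvPolynomial.aeval p (MvPolynomial.pderiv j f)) •
        (ContinuousLinearMap.proj j : (Fin m → ℂ) →L[ℂ] ℂ)) p := by
  induction f using MvPolynomial.induction_on with
  | C a =>
    have h : (∑ j, (MvPolynomial.aeval p (MvPolynomial.pderiv j (MvPolynomial.C a))) •
        (ContinuousLinearMap.proj j : (Fin m → ℂ) →L[ℂ] ℂ)) = 0 := by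
      ext v
      simp
    rw [h]
    simp only [MvPolynomial.aeval_C]
    exact hasStrictFDerivAt_const (algebraMap ℚ ℂ a) p
  | add f g hf hg =>
    simp only [map_add]
    refine (hf.add hg).congr_fderiv ?_
    ext v
    simp [add_mul, Finset.sum_add_distrib]
  | mul_X f i hf =>
    simp only [map_mul, MvPolynomial.aeval_X]
    have h := hf.mul ((ContinuousLinearMap.proj i : (Fin m → ℂ) →L[ℂ] ℂ).hasStrictFDerivAt (x := p))
    refine h.congr_fderiv ?_
    ext v
    simp only [add_apply, smul_apply,
      sum_apply, ContinuousLinearMap.proj_apply, smul_eq_mul,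
      Derivation.leibniz, MvPolynomial.pderiv_X, map_add, map_mul, MvPolynomial.aeval_X, add_mul,
      Finset.sum_add_distrib, Finset.mul_sum]
    congr 1
    · rw [Finset.sum_eq_single i]
      · simp
      · intro b _ hb
        simp [hb.symm]
      · simp
    · exact Finset.sum_congr rfl fun j _ => by ring

lemma exists_nearby_point {n : ℕ} (F : Fin n → MvPolynomial (Fin (n + 1)) ℚ)
    (p : Fin (n + 1) → ℂ) (hp : p ∈ zeroSet F) (hJ : MvPolynomial.aeval p (jacDet F) ≠ 0)
    (U : Set (Fin (n + 1) → ℂ)) (hU : U ∈ nhds p) :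
    ∀ᶠ t in nhds (projT p), ∃ x ∈ U, x ∈ zeroSet F ∧ projT x = t := by
  set G : (Fin (n + 1) → ℂ) → (Fin n → ℂ) × ℂ :=
    fun x => (fun i => MvPolynomial.aeval x (F i), projT x) with hG
  set F' : (Fin (n + 1) → ℂ) →L[ℂ] (Fin n → ℂ) :=
    ContinuousLinearMap.pi fun i => ∑ j, (MvPolynomial.aeval p (MvPolynomial.pderiv j (F i))) •
        (ContinuousLinearMap.proj j : (Fin (n + 1) → ℂ) →L[ℂ] ℂ) with hF'
  have h1 : HasStrictFDerivAt (fun x : Fin (n + 1) → ℂ => fun i => MvPolynomial.aeval x (F i))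
      F' p := hasStrictFDerivAt_pi.2 fun i => hasStrictFDerivAt_aeval_mv (F i) p
  have h2 : HasStrictFDerivAt G
      (F'.prod (ContinuousLinearMap.proj (Fin.last n) : (Fin (n + 1) → ℂ) →L[ℂ] ℂ)) p :=
    h1.prodMk 
      ((ContinuousLinearMap.proj (Fin.last n) : (Fin (n + 1) → ℂ) →L[ℂ] ℂ).hasStrictFDerivAt)
  set M : Matrix (Fin n) (Fin n) ℂ := Matrix.of fun i j =>
    MvPolynomial.aeval p (MvPolynomial.pderiv (Fin.castSucc j) (F i)) with hM
  have hdet : M.det ≠ 0 := by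
    have : M.det = MvPolynomial.aeval p (jacDet F) := by
      rw [jacDet, AlgHom.map_det]
      rfl
    rwa [this]
  have hsurj : (F'.prod
      (ContinuousLinearMap.proj (Fin.last n) : (Fin (n + 1) → ℂ) →L[ℂ] ℂ)).range = ⊤ := by
    refine LinearMap.range_eq_top.2 ?_
    rintro ⟨w, s⟩
    let r : Fin n → ℂ := fun i =>
      w i - MvPolynomial.aeval p (MvPolynomial.pderiv (Fin.last n) (F i)) * s
    refine ⟨Fin.snoc (α := fun _ => ℂ) (M⁻¹.mulVec r) s, ?_⟩
    have hMr : M.mulVec (M⁻¹.mulVec r) = r := by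
      rw [Matrix.mulVec_mulVec, Matrix.mul_nonsing_inv _ (isUnit_iff_ne_zero.2 hdet),
        Matrix.one_mulVec]
    refine Prod.ext ?_ ?_
    · funext i
      have h2 : ∑ j, M i j * (M⁻¹.mulVec r) j = r i := congrFun hMr i
      have h3 : ∀ v : Fin (n + 1) → ℂ, F' v i =
          ∑ j, MvPolynomial.aeval p (MvPolynomial.pderiv j (F i)) * v j := by
        intro v
        simp [hF']
      change F' _ i = w i
      rw [h3, Fin.sum_univ_castSucc]
      simp only [Fin.snoc_castSucc, Fin.snoc_last]
      change ∑ j, M i j * (M⁻¹.mulVec r) j + _ = w i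
      rw [h2]
      simp only [r]
      ring
    · simp
  have h3 := h2.map_nhds_eq_of_surj hsurj
  have h4 : G p = (0, projT p) := by
    refine Prod.ext ?_ rfl
    funext i
    exact hp i
  have h5 : G '' U ∈ nhds (G p) := by
    rw [← h3]; exact Filter.image_mem_map hU
  rw [h4] at h5
  have hc : Filter.Tendsto (fun t : ℂ => ((0 : Fin n → ℂ), t)) (nhds (projT p))
      (nhds (0, projT p)) := (Continuous.prodMk_right (0 : Fin n → ℂ)).tendsto _
  filter_upwards [hc h5] with t ht
  obtain ⟨x, hxU, hx⟩ := ht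
  exact ⟨x, hxU, fun i => congrFun (congrArg Prod.fst hx) i, congrArg Prod.snd hx⟩

/-! ### Chevalley: images of closed sets in the line are finite or cofinite -/

lemma image_cofinite {σ : Type} [Finite σ] (I : Set (MvPolynomial σ ℂ)) (g : MvPolynomial σ ℂ)
    (hinf : {a : ℂ | ∃ x : σ → ℂ, (∀ f ∈ I, MvPolynomial.eval x f = 0) ∧
      MvPolynomial.eval x g = a}.Infinite) :
    {a : ℂ | ∃ x : σ → ℂ, (∀ f ∈ I, MvPolynomial.eval x f = 0) ∧
      MvPolynomial.eval x g = a}ᶜ.Finite := by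
  classical
  set J : Ideal (MvPolynomial σ ℂ) := Ideal.span I with hJ
  let q : MvPolynomial σ ℂ →ₐ[ℂ] (MvPolynomial σ ℂ ⧸ J) := Ideal.Quotient.mkₐ ℂ J
  let φ : Polynomial ℂ →ₐ[ℂ] (MvPolynomial σ ℂ ⧸ J) := Polynomial.aeval (q g)
  have hft : φ.toRingHom.FiniteType := by
    have h1 : (algebraMap ℂ (MvPolynomial σ ℂ ⧸ J)).FiniteType :=
      RingHom.finiteType_algebraMap.2 inferInstance
    have h2 : φ.toRingHom.comp (algebraMap ℂ (Polynomial ℂ)) =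
        algebraMap ℂ (MvPolynomial σ ℂ ⧸ J) := φ.comp_algebraMap
    exact RingHom.FiniteType.of_comp_finiteType (f := algebraMap ℂ (Polynomial ℂ)) (h2 ▸ h1)
  have hfp : φ.toRingHom.FinitePresentation := RingHom.FinitePresentation.of_finiteType.1 hft
  obtain ⟨S, hS⟩ := PrimeSpectrum.exists_constructibleSetData_iff.2
    (PrimeSpectrum.isConstructible_range_comap hfp)
  let pt : ℂ → PrimeSpectrum (Polynomial ℂ) := fun a =>
    PrimeSpectrum.comap (Polynomial.evalRingHom a) ⊥
  have hpt : ∀ a (h : Polynomial ℂ), h ∈ (pt a).asIdeal ↔ h.eval a = 0 := by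
    intro a h
    change Polynomial.evalRingHom a h ∈ (⊥ : Ideal ℂ) ↔ _
    simp
  have key : ∀ a : ℂ, (∃ x : σ → ℂ, (∀ f ∈ I, MvPolynomial.eval x f = 0) ∧
      MvPolynomial.eval x g = a) ↔ pt a ∈ S.toSet := by
    intro a
    rw [hS]
    constructor
    · rintro ⟨x, hx, rfl⟩
      have hx' : ∀ f ∈ J, MvPolynomial.aeval x f = 0 := by
        intro f hf
        have : J ≤ RingHom.ker (MvPolynomial.aeval x : MvPolynomial σ ℂ →ₐ[ℂ] ℂ) :=
          Ideal.span_le.2 fun f hf => hx f hf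
        exact this hf
      let ev : (MvPolynomial σ ℂ ⧸ J) →ₐ[ℂ] ℂ :=
        Ideal.Quotient.liftₐ J (MvPolynomial.aeval x) hx'
      refine ⟨PrimeSpectrum.comap ev.toRingHom ⊥, ?_⟩
      rw [← PrimeSpectrum.comap_comp_apply]
      have : ev.toRingHom.comp φ.toRingHom =
          Polynomial.evalRingHom (MvPolynomial.eval x g) := by
        have : ev.comp φ = Polynomial.aeval (MvPolynomial.eval x g) := by
          ext
          simp [φ, ev, q]
        ext y
        · have := congrArg (fun f : Polynomial ℂ →ₐ[ℂ] ℂ => f (Polynomial.C y)) this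
          simpa using this
        · have := congrArg (fun f : Polynomial ℂ →ₐ[ℂ] ℂ => f Polynomial.X) this
          simpa using this
      rw [this]
    · rintro ⟨P, hP⟩
      obtain ⟨M, hM, hPM⟩ := Ideal.exists_le_maximal P.asIdeal P.isPrime.ne_top
      have hM' : (M.comap q.toRingHom).IsMaximal :=
        Ideal.comap_isMaximal_of_surjective q.toRingHom Ideal.Quotient.mk_surjective
      obtain ⟨x, hx⟩ := MvPolynomial.isMaximal_iff_eq_vanishingIdeal_singleton.1 hM'
      have hmem : ∀ f, q f ∈ M ↔ MvPolynomial.eval x f = 0 := by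
        intro f
        have : f ∈ M.comap q.toRingHom ↔ MvPolynomial.eval x f = 0 := by
          rw [hx]; exact MvPolynomial.mem_vanishingIdeal_singleton_iff x f
        exact this
      refine ⟨x, fun f hf => ?_, ?_⟩
      · rw [← hmem]
        have : q f = 0 := Ideal.Quotient.eq_zero_iff_mem.2 (Ideal.subset_span hf)
        rw [this]; exact M.zero_mem
      · have h1 : (Polynomial.X - Polynomial.C a : Polynomial ℂ) ∈ (pt a).asIdeal := by
          rw [hpt]; simp
        rw [← hP] at h1
        have h2 : φ (Polynomial.X - Polynomial.C a) ∈ M := hPM h1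
        have h3 : φ (Polynomial.X - Polynomial.C a) = q (g - MvPolynomial.C a) := by
          simp only [φ, map_sub, Polynomial.aeval_X, Polynomial.aeval_C]
          rfl
        rw [h3, hmem] at h2
        simpa [sub_eq_zero] using h2
  have hset : {a : ℂ | ∃ x : σ → ℂ, (∀ f ∈ I, MvPolynomial.eval x f = 0) ∧
      MvPolynomial.eval x g = a} = ⋃ C ∈ S, {a | pt a ∈ C.toSet} := by
    ext a
    simp only [Set.mem_ofPred_eq, key, PrimeSpectrum.ConstructibleSetData.toSet, Set.mem_iUnion]
  rw [hset] at hinf ⊢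
  have : ∃ C ∈ S, {a | pt a ∈ C.toSet}.Infinite := by
    by_contra hcon
    push Not at hcon
    exact hinf (Set.Finite.biUnion S.finite_toSet fun C hC => by simpa using hcon C hC)
  obtain ⟨C, hCS, hC⟩ := this
  have hmemC : ∀ a, pt a ∈ C.toSet ↔ (∀ i, (C.g i).eval a = 0) ∧ C.f.eval a ≠ 0 := by
    intro a
    simp only [PrimeSpectrum.BasicConstructibleSetData.toSet, Set.mem_sdiff,
      PrimeSpectrum.mem_zeroLocus, Set.range_subset_iff, Set.singleton_subset_iff, SetLike.mem_coe,
      hpt]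
  have hg : ∀ i, C.g i = 0 := fun i =>
    Polynomial.eq_zero_of_infinite_isRoot _ (hC.mono fun a ha => ((hmemC a).1 ha).1 i)
  have hf : C.f ≠ 0 := by
    obtain ⟨a, ha⟩ := hC.nonempty
    intro h0
    exact ((hmemC a).1 ha).2 (by simp [h0])
  refine (Polynomial.finite_setOfPred_isRoot hf).subset ?_
  intro a ha
  by_contra hne
  exact ha (Set.mem_biUnion hCS ((hmemC a).2 ⟨fun i => by simp [hg i], hne⟩))

/-! ### The Zariski topology on affine space -/

/-- The closed point of the spectrum attached to a point of affine space. -/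
noncomputable def zPoint {m : ℕ} (x : Fin m → ℂ) : PrimeSpectrum (MvPolynomial (Fin m) ℂ) :=
  MvPolynomial.pointToPoint (k := ℂ) (K := ℂ) (σ := Fin m) x

/-- The Zariski topology on affine space. -/
noncomputable abbrev zTop (m : ℕ) : TopologicalSpace (Fin m → ℂ) :=
  TopologicalSpace.induced zPoint inferInstance

lemma zNoeth (m : ℕ) : @TopologicalSpace.NoetherianSpace (Fin m → ℂ) (zTop m) :=
  @Topology.IsInducing.noetherianSpace _ _ _ (zTop m) _ zPoint (@Topology.IsInducing.mk _ _ (zTop m) _ _ rfl)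

lemma zPoint_mem {m : ℕ} (x : Fin m → ℂ) (I : Set (MvPolynomial (Fin m) ℂ)) :
    zPoint (m := m) x ∈ PrimeSpectrum.zeroLocus I ↔ ∀ f ∈ I, MvPolynomial.eval x f = 0 := by
  rw [PrimeSpectrum.mem_zeroLocus]
  exact forall₂_congr fun f _ => MvPolynomial.mem_vanishingIdeal_singleton_iff x f

lemma zClosed_iff {m : ℕ} (S : Set (Fin m → ℂ)) :
    ZClosed S ↔ @IsClosed _ (zTop m) S := by
  rw [isClosed_induced_iff]
  constructor
  · rintro ⟨I, rfl⟩
    exact ⟨PrimeSpectrum.zeroLocus I, PrimeSpectrum.isClosed_zeroLocus I,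
      Set.ext fun x => zPoint_mem x I⟩
  · rintro ⟨t, ht, rfl⟩
    obtain ⟨I, rfl⟩ := (PrimeSpectrum.isClosed_iff_zeroLocus t).1 ht
    exact ⟨I, Set.ext fun x => zPoint_mem x I⟩

lemma isIrredVariety_iff {m : ℕ} (C : Set (Fin m → ℂ)) :
    IsIrredVariety C ↔ @IsClosed _ (zTop m) C ∧ @IsIrreducible _ (zTop m) C := by
  unfold IsIrredVariety IsIrreducible
  rw [@isPreirreducible_iff_isClosed_union_isClosed _ (zTop m), zClosed_iff]
  refine and_congr_right fun hC => and_congr Iff.rfl ?_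
  constructor
  · intro h A B hA hB hAB
    have h1 : C = (C ∩ A) ∪ (C ∩ B) := by
      rw [← Set.inter_union_distrib_left]
      exact (Set.inter_eq_left.2 hAB).symm
    rcases h (C ∩ A) (C ∩ B) ((zClosed_iff _).2 (@IsClosed.inter _ _ _ (zTop m) hC hA)) ((zClosed_iff _).2 (@IsClosed.inter _ _ _ (zTop m) hC hB)) h1
      with h2 | h2
    · exact Or.inl (Set.inter_eq_left.1 h2)
    · exact Or.inr (Set.inter_eq_left.1 h2)
  · intro h A B hA hB hAB
    rcases h A B ((zClosed_iff _).1 hA) ((zClosed_iff _).1 hB) hAB.subset with h1 | h1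
    · exact Or.inl (Set.Subset.antisymm (hAB ▸ Set.subset_union_left) h1)
    · exact Or.inr (Set.Subset.antisymm (hAB ▸ Set.subset_union_right) h1)

lemma irred_subset_sUnion {m : ℕ} {C : Set (Fin m → ℂ)} (hC : IsIrredVariety C)
    {S : Set (Set (Fin m → ℂ))} (hS : S.Finite) (hcl : ∀ s ∈ S, ZClosed s) (h : C ⊆ ⋃₀ S) :
    ∃ s ∈ S, C ⊆ s := by
  have h1 := (@isIrreducible_iff_sUnion_isClosed _ (zTop m) _).1 ((isIrredVariety_iff C).1 hC).2 hS.toFinset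
    (fun z hz => (zClosed_iff z).1 (hcl z (hS.mem_toFinset.1 hz))) (by simpa using h)
  obtain ⟨z, hz, hCz⟩ := h1
  exact ⟨z, hS.mem_toFinset.1 hz, hCz⟩

lemma exists_components {m : ℕ} {V : Set (Fin m → ℂ)} (hV : ZClosed V) :
    ∃ S : Set (Set (Fin m → ℂ)), S.Finite ∧ (∀ s ∈ S, IsIrredComponent V s) ∧ V = ⋃₀ S := by
  obtain ⟨S, hSf, hSc, hSi, hVS⟩ :=
    @TopologicalSpace.NoetherianSpace.exists_finite_set_isClosed_irreducible _ (zTop m) (zNoeth m) _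
      ((zClosed_iff V).1 hV)
  have hirr : ∀ s ∈ S, IsIrredVariety s := fun s hs =>
    (isIrredVariety_iff s).2 ⟨hSc s hs, hSi s hs⟩
  have hsub : ∀ s ∈ S, s ⊆ V := fun s hs => hVS ▸ Set.subset_sUnion_of_mem hs
  have hcomp : ∀ s, Maximal (· ∈ S) s → IsIrredComponent V s := by
    intro s hs
    refine ⟨hirr s hs.prop, hsub s hs.prop, fun C' hC' hsC' hC'V => ?_⟩
    obtain ⟨s', hs', hCs'⟩ := irred_subset_sUnion hC' hSf (fun s hs => (hirr s hs).1)
      (hC'V.trans hVS.subset)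
    exact Set.Subset.antisymm (hCs'.trans (hs.le_of_ge hs' (hsC'.trans hCs'))) hsC'
  refine ⟨{s | Maximal (· ∈ S) s}, hSf.subset fun s hs => hs.prop, fun s hs => hcomp s hs, ?_⟩
  apply Set.Subset.antisymm
  · intro x hx
    rw [hVS] at hx
    obtain ⟨s, hs, hxs⟩ := hx
    obtain ⟨s', hss', hs'⟩ := hSf.exists_le_maximal hs
    exact ⟨s', hs', hss' hxs⟩
  · exact Set.sUnion_subset fun s hs => hsub s hs.prop

lemma ZClosed.isClosed_euclidean {m : ℕ} {S : Set (Fin m → ℂ)} (hS : ZClosed S) : IsClosed S := by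
  obtain ⟨I, rfl⟩ := hS
  have : {x : Fin m → ℂ | ∀ f ∈ I, MvPolynomial.eval x f = 0} =
      ⋂ f ∈ I, {x | MvPolynomial.eval x f = 0} := by
    ext x
    simp
  rw [this]
  exact isClosed_biInter fun f _ => isClosed_eq (MvPolynomial.continuous_eval f) continuous_const

lemma zClosed_zeroSet {n : ℕ} (F : Fin n → MvPolynomial (Fin (n + 1)) ℚ) :
    ZClosed (zeroSet F) := by
  refine ⟨Set.range fun i => MvPolynomial.map (algebraMap ℚ ℂ) (F i), ?_⟩
  ext x
  simp [zeroSet, MvPolynomial.eval_map, MvPolynomial.aeval_def]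

lemma zClosed_fiber {n : ℕ} (t : ℂ) : ZClosed {x : Fin (n + 1) → ℂ | projT x = t} := by
  refine ⟨{MvPolynomial.X (Fin.last n) - MvPolynomial.C t}, ?_⟩
  ext x
  simp [projT, sub_eq_zero]

lemma zClosed_singleton {m : ℕ} (p : Fin m → ℂ) : ZClosed {p} := by
  refine ⟨Set.range fun i => MvPolynomial.X i - MvPolynomial.C (p i), ?_⟩
  ext x
  simp [sub_eq_zero, funext_iff]

/-- A nonempty irreducible set inside a finite set of fibers lies in one fiber. -/
lemma irred_subset_fiber {n : ℕ} {C : Set (Fin (n + 1) → ℂ)} (hC : IsIrredVariety C)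
    (hfin : (projT '' C).Finite) {p : Fin (n + 1) → ℂ} (hp : p ∈ C) :
    C ⊆ {x | projT x = projT p} := by
  obtain ⟨s, hs, hCs⟩ := irred_subset_sUnion hC
    (hfin.image fun t => {x : Fin (n + 1) → ℂ | projT x = t})
    (by rintro _ ⟨t, _, rfl⟩; exact zClosed_fiber t)
    (fun x hx => ⟨_, ⟨projT x, ⟨x, hx, rfl⟩, rfl⟩, rfl⟩)
  obtain ⟨t, _, rfl⟩ := hs
  have h1 : projT p = t := hCs hp
  rw [h1]
  exact hCs

lemma irred_finite_subset {m : ℕ} {C : Set (Fin m → ℂ)} (hC : IsIrredVariety C)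
    (hfin : C.Finite) {p : Fin m → ℂ} (hp : p ∈ C) : C ⊆ {p} := by
  obtain ⟨s, hs, hCs⟩ := irred_subset_sUnion hC
    (hfin.image fun x => ({x} : Set (Fin m → ℂ)))
    (by rintro _ ⟨t, _, rfl⟩; exact zClosed_singleton t)
    (fun x hx => ⟨_, ⟨x, hx, rfl⟩, rfl⟩)
  obtain ⟨t, _, rfl⟩ := hs
  have h1 : p = t := hCs hp
  rw [h1]
  exact hCs

/-- A closed set with infinite projection has cofinite projection. -/
lemma proj_cofinite {n : ℕ} {C : Set (Fin (n + 1) → ℂ)} (hC : ZClosed C)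
    (hinf : (projT '' C).Infinite) : (projT '' C)ᶜ.Finite := by
  obtain ⟨I, rfl⟩ := hC
  have h : projT '' {x : Fin (n + 1) → ℂ | ∀ f ∈ I, MvPolynomial.eval x f = 0} =
      {a : ℂ | ∃ x : Fin (n + 1) → ℂ, (∀ f ∈ I, MvPolynomial.eval x f = 0) ∧
      MvPolynomial.eval x (MvPolynomial.X (Fin.last n)) = a} := by
    ext a
    simp [projT]
  rw [h] at hinf ⊢
  exact image_cofinite _ _ hinf

/-- The set of parameters whose fiber has at least `D` points is finite or cofinite. -/
lemma many_points_cofinite {n D : ℕ} (hD : 0 < D) {V : Set (Fin (n + 1) → ℂ)} (hV : ZClosed V)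
    (hinf : {t : ℂ | ∃ y : Fin D → Fin (n + 1) → ℂ, Function.Injective y ∧
      ∀ i, y i ∈ V ∧ projT (y i) = t}.Infinite) :
    {t : ℂ | ∃ y : Fin D → Fin (n + 1) → ℂ, Function.Injective y ∧
      ∀ i, y i ∈ V ∧ projT (y i) = t}ᶜ.Finite := by
  classical
  obtain ⟨I, rfl⟩ := hV
  let σ : Type := (Fin D × Fin (n + 1)) ⊕ ((Fin D × Fin D) × Fin (n + 1))
  let i0 : Fin D := ⟨0, hD⟩
  let Y : Fin D → Fin (n + 1) → MvPolynomial σ ℂ := fun i k => MvPolynomial.X (Sum.inl (i, k))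
  let Z : Fin D → Fin D → Fin (n + 1) → MvPolynomial σ ℂ :=
    fun i j k => MvPolynomial.X (Sum.inr ((i, j), k))
  let K : Set (MvPolynomial σ ℂ) :=
    {h | ∃ i, ∃ f ∈ I, h = MvPolynomial.bind₁ (Y i) f} ∪
    {h | ∃ i, h = Y i (Fin.last n) - Y i0 (Fin.last n)} ∪
    {h | ∃ i j, i ≠ j ∧ h = ∑ k, Z i j k * (Y i k - Y j k) - 1}
  have hset : {t : ℂ | ∃ y : Fin D → Fin (n + 1) → ℂ, Function.Injective y ∧
      ∀ i, y i ∈ {x : Fin (n + 1) → ℂ | ∀ f ∈ I, MvPolynomial.eval x f = 0} ∧ projT (y i) = t} =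
      {a : ℂ | ∃ x : σ → ℂ, (∀ f ∈ K, MvPolynomial.eval x f = 0) ∧
        MvPolynomial.eval x (Y i0 (Fin.last n)) = a} := by
    have hbind : ∀ (x : σ → ℂ) i f, MvPolynomial.eval x (MvPolynomial.bind₁ (Y i) f) =
        MvPolynomial.eval (fun k => x (Sum.inl (i, k))) f := by
      intro x i f
      have h1 := MvPolynomial.eval₂Hom_bind₁ (RingHom.id ℂ) x (Y i) f
      have h2 : (fun k => MvPolynomial.eval₂Hom (RingHom.id ℂ) x (Y i k)) =
          fun k => x (Sum.inl (i, k)) := by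
        funext k
        simp [Y]
      rw [h2] at h1
      exact h1
    ext t
    constructor
    · rintro ⟨y, hy, hyt⟩
      have hz : ∀ i j : Fin D, i ≠ j → ∃ k, y i k ≠ y j k := fun i j hij =>
        Function.ne_iff.1 (hy.ne hij)
      choose! c hc using hz
      let x : σ → ℂ := Sum.elim (fun q => y q.1 q.2)
        (fun q => if q.2 = c q.1.1 q.1.2 then
          (y q.1.1 (c q.1.1 q.1.2) - y q.1.2 (c q.1.1 q.1.2))⁻¹ else 0)
      refine ⟨x, ?_, ?_⟩
      · rintro f ((⟨i, f, hf, rfl⟩ | ⟨i, rfl⟩) | ⟨i, j, hij, rfl⟩)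
        · rw [hbind]
          exact (hyt i).1 f hf
        · have h1 := (hyt i).2
          have h2 := (hyt i0).2
          simp only [projT] at h1 h2
          simp [Y, x, h1, h2]
        · simp only [Y, Z, x, map_sub, map_sum, map_mul, MvPolynomial.eval_X, Sum.elim_inl,
            Sum.elim_inr, map_one, ite_mul, zero_mul, Finset.sum_ite_eq', Finset.mem_univ, if_true]
          rw [inv_mul_cancel₀ (sub_ne_zero.2 (hc i j hij)), sub_self]
      · simpa [Y, x, projT] using (hyt i0).2
    · rintro ⟨x, hx, rfl⟩
      refine ⟨fun i k => x (Sum.inl (i, k)), ?_, ?_⟩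
      · intro i j hij
        by_contra hne
        have h1 := hx _ (Or.inr ⟨i, j, hne, rfl⟩)
        have h2 : ∀ k, x (Sum.inl (i, k)) = x (Sum.inl (j, k)) := fun k => congrFun hij k
        simp [Y, Z, h2] at h1
      · intro i
        refine ⟨fun f hf => ?_, ?_⟩
        · rw [← hbind]
          exact hx _ (Or.inl (Or.inl ⟨i, f, hf, rfl⟩))
        · have h1 := hx _ (Or.inl (Or.inr ⟨i, rfl⟩))
          simpa [Y, sub_eq_zero, projT] using h1
  rw [hset] at hinf ⊢
  exact image_cofinite _ _ hinf

/-- **Dominant-components lemma, second part.** Under the stated hypotheses,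
`Vdom` is the union of the irreducible components of the zero set meeting the
special fiber `π⁻¹(t₀)`, and `π` restricted to `Vdom` is dominant of degree
`D`: its image is Zariski dense and its generic fibers have exactly `D`
points. -/
theorem Vdom_eq_components_meeting_fiber (n D : ℕ) (hD : 0 < D)
    (F : Fin n → MvPolynomial (Fin (n + 1)) ℚ)
    (hgen : ∃ T : Finset ℂ, ∀ t ∉ T,
      (zeroSet F ∩ {x | projT x = t}).Finite ∧
      (zeroSet F ∩ {x | projT x = t}).ncard ≤ D)
    (t0 : ℂ)
    (hfin : (zeroSet F ∩ {x | projT x = t0}).Finite)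
    (hcard : (zeroSet F ∩ {x | projT x = t0}).ncard = D)
    (hJ : ∀ x ∈ zeroSet F ∩ {x | projT x = t0},
      MvPolynomial.aeval x (jacDet F) ≠ 0) :
    Vdom F = ⋃₀ {C | IsIrredComponent (zeroSet F) C ∧ (C ∩ {x | projT x = t0}).Nonempty}
      ∧ (projT '' Vdom F).Infinite
      ∧ ∃ T : Finset ℂ, ∀ t ∉ T,
          (Vdom F ∩ {x | projT x = t}).Finite ∧
          (Vdom F ∩ {x | projT x = t}).ncard = D := by
  classical
  obtain ⟨T0, hT0⟩ := hgen
  set V := zeroSet F with hVdef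
  have hV : ZClosed V := zClosed_zeroSet F
  obtain ⟨S, hSf, hScomp, hVS⟩ := exists_components hV
  obtain ⟨U, hU, hUd⟩ := hfin.t2_separation
  -- the finitely many parameters hit by non-dominant components
  set T' : Set ℂ := ⋃ s ∈ {s ∈ S | ¬ (projT '' s).Infinite}, projT '' s with hT'
  have hT'fin : T'.Finite := Set.Finite.biUnion (hSf.subset (Set.sep_subset _ _))
    fun s hs => Set.not_infinite.1 hs.2
  have hdom : ∀ x ∈ V, projT x ∉ T' → ∃ s ∈ S, (projT '' s).Infinite ∧ x ∈ s := by
    intro x hx hxT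
    rw [hVS] at hx
    obtain ⟨s, hs, hxs⟩ := hx
    refine ⟨s, hs, ?_, hxs⟩
    by_contra hfin'
    exact hxT (Set.mem_biUnion (x := s) ⟨hs, hfin'⟩ ⟨x, hxs, rfl⟩)
  have hnear : ∀ W : (Fin (n + 1) → ℂ) → Set (Fin (n + 1) → ℂ),
      (∀ p ∈ V ∩ {x | projT x = t0}, W p ∈ nhds p) →
      ∀ᶠ t in nhds t0, ∀ p ∈ V ∩ {x | projT x = t0}, ∃ x ∈ W p, x ∈ V ∧ projT x = t := by
    intro W hW
    rw [Filter.eventually_all_finite hfin]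
    intro p hp
    have h := exists_nearby_point F p hp.1 (hJ p hp) (W p) (hW p hp)
    have h2 : projT p = t0 := hp.2
    rwa [h2] at h
  have hinj : ∀ x : (Fin (n + 1) → ℂ) → (Fin (n + 1) → ℂ),
      (∀ p ∈ V ∩ {x | projT x = t0}, x p ∈ U p) → Set.InjOn x (V ∩ {x | projT x = t0}) := by
    intro x hx p hp q hq hpq
    by_contra hne
    exact Set.disjoint_left.1 (hUd hp hq hne) (hx p hp) (hpq ▸ hx q hq)
  -- dominant components meet the special fiber
  have hmeet : ∀ C, IsIrredComponent V C → (projT '' C).Infinite →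
      (C ∩ {x | projT x = t0}).Nonempty := by
    intro C hC hCinf
    by_contra hempty
    rw [Set.not_nonempty_iff_eq_empty] at hempty
    have hcl : IsClosed C := hC.1.1.isClosed_euclidean
    have hcof := proj_cofinite hC.1.1 hCinf
    have h1 := hnear (fun p => U p ∩ Cᶜ) (by
      intro p hp
      refine Filter.inter_mem ((hU p).2.mem_nhds (hU p).1) (hcl.isOpen_compl.mem_nhds ?_)
      intro hpC
      have : p ∈ C ∩ {x | projT x = t0} := ⟨hpC, hp.2⟩
      rw [hempty] at this
      exact this)
    have h2 := (infinite_of_mem_nhds t0 h1).sdiff (hcof.union T0.finite_toSet)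
    obtain ⟨t, ht, htn⟩ := h2.nonempty
    have ht' : ∀ p ∈ V ∩ {x | projT x = t0}, ∃ x ∈ U p ∩ Cᶜ, x ∈ V ∧ projT x = t := ht
    choose! x hxU hxV hxt using ht'
    have htC : t ∈ projT '' C := by
      by_contra h
      exact htn (Or.inl h)
    obtain ⟨c, hcC, hct⟩ := htC
    obtain ⟨hf, hle⟩ := hT0 t fun h => htn (Or.inr h)
    have hcard' : (x '' (V ∩ {x | projT x = t0})).ncard = D := by
      rw [Set.ncard_image_of_injOn (hinj x fun p hp => (hxU p hp).1), hcard]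
    have hcn : c ∉ x '' (V ∩ {x | projT x = t0}) := by
      rintro ⟨p, hp, rfl⟩
      exact (hxU p hp).2 hcC
    have hins : (insert c (x '' (V ∩ {x | projT x = t0}))).ncard = D + 1 := by
      rw [Set.ncard_insert_of_notMem hcn (hfin.image x), hcard']
    have hsub : insert c (x '' (V ∩ {x | projT x = t0})) ⊆ V ∩ {x | projT x = t} := by
      rintro y (rfl | ⟨p, hp, rfl⟩)
      · exact ⟨hC.2.1 hcC, hct⟩
      · exact ⟨hxV p hp, hxt p hp⟩
    have := Set.ncard_le_ncard hsub hf
    omega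
  -- components meeting the special fiber are dominant
  have hmeet' : ∀ C, IsIrredComponent V C → (C ∩ {x | projT x = t0}).Nonempty →
      (projT '' C).Infinite := by
    rintro C hC ⟨p, hpC, hpt⟩
    by_contra hCfin
    rw [Set.not_infinite] at hCfin
    have hpV : p ∈ V ∩ {x | projT x = t0} := ⟨hC.2.1 hpC, hpt⟩
    have hp0 : projT p = t0 := hpt
    have hex : ∃ s ∈ S, (projT '' s).Infinite ∧ p ∈ s := by
      by_contra hno
      push Not at hno
      have hW : (⋂ s ∈ {s ∈ S | (projT '' s).Infinite}, sᶜ) ∈ nhds p := by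
        rw [Filter.biInter_mem (hSf.subset (Set.sep_subset _ _))]
        intro s hs
        exact (hScomp s hs.1).1.1.isClosed_euclidean.isOpen_compl.mem_nhds (hno s hs.1 hs.2)
      have h1 := exists_nearby_point F p hpV.1 (hJ p hpV) _ hW
      obtain ⟨t, ⟨x, hxW, hxV, hxt⟩, htn⟩ :=
        ((infinite_of_mem_nhds _ h1).sdiff hT'fin).nonempty
      obtain ⟨s, hs, hsinf, hxs⟩ := hdom x hxV (hxt ▸ htn)
      exact Set.mem_iInter₂.1 hxW s ⟨hs, hsinf⟩ hxs
    obtain ⟨s, hs, hsinf, hps⟩ := hex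
    have hCsub : C ⊆ V ∩ {x | projT x = t0} := fun x hx =>
      ⟨hC.2.1 hx, hp0 ▸ irred_subset_fiber hC.1 hCfin hpC hx⟩
    have hCp : C ⊆ {p} := irred_finite_subset hC.1 (hfin.subset hCsub) hpC
    have hCs : C ⊆ s := hCp.trans (Set.singleton_subset_iff.2 hps)
    have heq := hC.2.2 s (hScomp s hs).1 hCs (hScomp s hs).2.1
    rw [heq] at hsinf
    exact hsinf hCfin
  -- generic fibers of `V` have at least `D` points
  have hmany : {t : ℂ | ∃ y : Fin D → Fin (n + 1) → ℂ, Function.Injective y ∧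
      ∀ i, y i ∈ V ∧ projT (y i) = t}ᶜ.Finite := by
    apply many_points_cofinite hD hV
    apply infinite_of_mem_nhds t0
    filter_upwards [hnear U fun p _ => (hU p).2.mem_nhds (hU p).1] with t ht
    choose! x hxU hxV hxt using ht
    have : Finite (V ∩ {x | projT x = t0} : Set (Fin (n + 1) → ℂ)) := hfin
    let e : Fin D ≃ (V ∩ {x | projT x = t0} : Set (Fin (n + 1) → ℂ)) :=
      (Finite.equivFinOfCardEq hcard).symm
    refine ⟨fun i => x (e i), ?_, fun i => ⟨hxV _ (e i).2, hxt _ (e i).2⟩⟩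
    intro i j hij
    exact e.injective (Subtype.ext (hinj x hxU (e i).2 (e j).2 hij))
  have hfib : ∃ T : Finset ℂ, ∀ t ∉ T,
      (Vdom F ∩ {x | projT x = t}).Finite ∧
      (Vdom F ∩ {x | projT x = t}).ncard = D := by
    refine ⟨T0 ∪ hmany.toFinset ∪ hT'fin.toFinset, fun t ht => ?_⟩
    simp only [Finset.mem_union, Set.Finite.mem_toFinset, not_or, Set.mem_compl_iff,
      not_not] at ht
    obtain ⟨⟨ht0, htm⟩, htT'⟩ := ht
    have heq : Vdom F ∩ {x | projT x = t} = V ∩ {x | projT x = t} := by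
      apply Set.Subset.antisymm
      · rintro x ⟨⟨C, hC, hxC⟩, hxt⟩
        exact ⟨hC.1.2.1 hxC, hxt⟩
      · rintro x ⟨hxV, hxt⟩
        have hxt' : projT x = t := hxt
        obtain ⟨s, hs, hsinf, hxs⟩ := hdom x hxV (hxt' ▸ htT')
        exact ⟨⟨s, ⟨hScomp s hs, hsinf⟩, hxs⟩, hxt⟩
    rw [heq]
    obtain ⟨hf, hle⟩ := hT0 t ht0
    refine ⟨hf, le_antisymm hle ?_⟩
    obtain ⟨y, hy, hyV⟩ := htm
    have h1 : (Set.range y).ncard = D := by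
      rw [← Set.image_univ, Set.ncard_image_of_injective _ hy, Set.ncard_univ, Nat.card_fin]
    rw [← h1]
    exact Set.ncard_le_ncard (by rintro _ ⟨i, rfl⟩; exact hyV i) hf
  refine ⟨?_, ?_, hfib⟩
  · unfold Vdom
    congr 1
    ext C
    exact ⟨fun h => ⟨h.1, hmeet C h.1 h.2⟩, fun h => ⟨h.1, hmeet' C h.1 h.2⟩⟩
  · obtain ⟨T, hT⟩ := hfib
    refine T.finite_toSet.infinite_compl.mono fun t ht => ?_
    have h1 := (hT t ht).2
    have h2 : (Vdom F ∩ {x | projT x = t}).Nonempty := by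
      apply Set.nonempty_of_ncard_ne_zero
      omega
    obtain ⟨x, hx, hxt⟩ := h2
    exact ⟨x, hx, hxt⟩
end
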